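/- There exists a constant C > 0, depending only on n, γ, μ, σ, K, R0, c3 (in particular independent of ε and u), such that: (i) if 0 < γ ≤ 1/μ, then |∇u(x)| ≤ C · sup_{Ω_{R0}} |u| for all x ∈ Ω_{R0/2}; and (ii) if γ > 1/μ, then |∇u(x)| ≤ C · sup_{Ω_{R0}} |u| · (ε + |x'|²)^{(α−1)/2} for all x = (x', x_n) ∈ Ω_{R0/2}, where α := (−(n−1) + √((n−1)² + 4(n−2 + 2/(μγ))))/2. -/

import Mathlib

open MeasureTheory Metric Set
open scoped RealInnerProductSpace ENNReal

noncomputable section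

/-- `n`-dimensional Euclidean space. -/
abbrev E (k : ℕ) := EuclideanSpace ℝ (Fin k)

/-- Laplacian: sum of pure second directional derivatives. -/
def elap {k : ℕ} (u : E k → ℝ) (x : E k) : ℝ :=
  ∑ i : Fin k, iteratedFDeriv ℝ 2 u x ![EuclideanSpace.single i 1, EuclideanSpace.single i 1]

/-- The horizontal part `x'` of `x = (x', x_n)`. -/
def epre {m : ℕ} (x : E (m+1)) : E m :=
  (EuclideanSpace.equiv (Fin m) ℝ).symm fun i => x i.castSucc

/-- The vertical (last) coordinate `x_n` of `x = (x', x_n)`. -/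
def lastC {m : ℕ} (x : E (m+1)) : ℝ := x (Fin.last m)

/-- Assemble the point `(p, t)`. -/
def eglue {m : ℕ} (p : E m) (t : ℝ) : E (m+1) :=
  (EuclideanSpace.equiv (Fin (m+1)) ℝ).symm fun i => Fin.lastCases t (fun j => p j) i

/-- The narrow region `Ω_{x0',r}`. -/
def neck {m : ℕ} (ε : ℝ) (f g : E m → ℝ) (x0 : E m) (r : ℝ) : Set (E (m+1)) :=
  {x | ‖epre x - x0‖ < r ∧ -(ε/2) + g (epre x) < lastC x ∧ lastC x < ε/2 + f (epre x)}

/-- The upper boundary `Γ₊`. -/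
def gammaP {m : ℕ} (ε R0 : ℝ) (f : E m → ℝ) : Set (E (m+1)) :=
  (fun p => eglue p (ε/2 + f p)) '' ball (0 : E m) R0

/-- The lower boundary `Γ₋`. -/
def gammaM {m : ℕ} (ε R0 : ℝ) (g : E m → ℝ) : Set (E (m+1)) :=
  (fun p => eglue p (-(ε/2) + g p)) '' ball (0 : E m) R0

/-- The unit normal on `Γ₊` (pointing upward). -/
def nuP {m : ℕ} (f : E m → ℝ) (p : E m) : E (m+1) :=
  (Real.sqrt (1 + ‖gradient f p‖^2))⁻¹ • eglue (-(gradient f p)) 1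

/-- The unit normal on `Γ₋` (pointing downward). -/
def nuM {m : ℕ} (g : E m → ℝ) (p : E m) : E (m+1) :=
  (Real.sqrt (1 + ‖gradient g p‖^2))⁻¹ • eglue (gradient g p) (-1)

/-- The region `Ω_{R0} ∪ Γ₊ ∪ Γ₋`. -/
def regio {m : ℕ} (ε R0 : ℝ) (f g : E m → ℝ) : Set (E (m+1)) :=
  neck ε f g 0 R0 ∪ gammaP ε R0 f ∪ gammaM ε R0 g

/-- `u` is a solution of the local Robin problem with constants `U1`, `U2`:
`u` is C¹ on `Ω_{R0} ∪ Γ₊ ∪ Γ₋`, harmonic in `Ω_{R0}`, and satisfies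
`u + γ ∂_ν u = U1` on `Γ₊` and `u + γ ∂_ν u = U2` on `Γ₋`. -/
def IsLocalSol {m : ℕ} (ε R0 γ : ℝ) (f g : E m → ℝ) (u : E (m+1) → ℝ) (U1 U2 : ℝ) : Prop :=
  (∀ x ∈ regio ε R0 f g, DifferentiableAt ℝ u x) ∧
  ContinuousOn (fun x => gradient u x) (regio ε R0 f g) ∧
  ContDiffOn ℝ 2 u (neck ε f g 0 R0) ∧
  (∀ x ∈ neck ε f g 0 R0, elap u x = 0) ∧
  (∀ p ∈ ball (0 : E m) R0,
    u (eglue p (ε/2 + f p)) + γ * ⟪nuP f p, gradient u (eglue p (ε/2 + f p))⟫ = U1) ∧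
  (∀ p ∈ ball (0 : E m) R0,
    u (eglue p (-(ε/2) + g p)) + γ * ⟪nuM g p, gradient u (eglue p (-(ε/2) + g p))⟫ = U2)

/-- `f` is C^{1,1} with C^{1,1} norm at most `c`. -/
def C11 {k : ℕ} (c : ℝ) (f : E k → ℝ) : Prop :=
  Differentiable ℝ f ∧ (∀ p, |f p| ≤ c) ∧ (∀ p, ‖gradient f p‖ ≤ c) ∧
    LipschitzWith c.toNNReal (fun p => gradient f p)

/-- The standing hypotheses on `f`, `g`:  C^{1,1} norms at most `c2`,
`f(0)=g(0)=0`, `∇f(0)=∇g(0)=0`, and `c1 |x'|² ≤ f - g` on `|x'| < R0`. -/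
def FGSetting {m : ℕ} (R0 c1 c2 : ℝ) (f g : E m → ℝ) : Prop :=
  C11 c2 f ∧ C11 c2 g ∧ f 0 = 0 ∧ g 0 = 0 ∧ gradient f 0 = 0 ∧ gradient g 0 = 0 ∧
    ∀ p : E m, ‖p‖ < R0 → c1 * ‖p‖^2 ≤ f p - g p

/-- `f` is C^{2,σ} with C^{2,σ} norm at most `c`. -/
def C2Sigma {k : ℕ} (c σ : ℝ) (f : E k → ℝ) : Prop :=
  ContDiff ℝ 2 f ∧ (∀ p, |f p| ≤ c) ∧ (∀ p, ‖gradient f p‖ ≤ c) ∧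
    (∀ p, ‖fderiv ℝ (fun q => gradient f q) p‖ ≤ c) ∧
    (∀ p q, ‖fderiv ℝ (fun q => gradient f q) p - fderiv ℝ (fun q => gradient f q) q‖
        ≤ c * ‖p - q‖ ^ σ)

/-- Flip the sign of the `j`-th coordinate. -/
def flipCoord {k : ℕ} (j : Fin k) (x : E k) : E k :=
  (EuclideanSpace.equiv (Fin k) ℝ).symm fun i => if i = j then -(x i) else x i

/-- `g` is `C²` at `x`, with gradient `d` and Laplacian `l` there. -/
def HasLap {n : ℕ} (g : E n → ℝ) (x d : E n) (l : ℝ) : Prop :=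
  ContDiffAt ℝ 2 g x ∧ HasGradientAt g d x ∧
    ∀ b : OrthonormalBasis (Fin n) ℝ (E n), ∑ i, fderiv ℝ (fderiv ℝ g) x (b i) (b i) = l

namespace HasLap

variable {n : ℕ} {g h : E n → ℝ} {x d d' : E n} {l l' : ℝ}

theorem congr (hg : HasLap g x d l) (hd : d = d') (hl : l = l') : HasLap g x d' l' := by
  subst hd hl; exact hg

theorem eventually_differentiableAt (hg : ContDiffAt ℝ 2 g x) :
    ∀ᶠ y in nhds x, DifferentiableAt ℝ g y := by
  filter_upwards [hg.eventually (by simp)] with y hy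
  exact hy.differentiableAt (by simp)

theorem differentiableAt_fderiv (hg : ContDiffAt ℝ 2 g x) :
    DifferentiableAt ℝ (fderiv ℝ g) x :=
  (hg.fderiv_right (m := 1) (by norm_num)).differentiableAt (by simp)

theorem fderiv_apply (hg : HasLap g x d l) (v : E n) : fderiv ℝ g x v = ⟪d, v⟫ :=
  hg.2.1.fderiv_apply

theorem add (hg : HasLap g x d l) (hh : HasLap h x d' l') :
    HasLap (fun y => g y + h y) x (d + d') (l + l') := by
  refine ⟨hg.1.add hh.1, ?_, fun b => ?_⟩
  · rw [hasGradientAt_iff_hasFDerivAt, map_add]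
    exact hg.2.1.hasFDerivAt.add hh.2.1.hasFDerivAt
  · have e : fderiv ℝ (fun y => g y + h y) =ᶠ[nhds x] fun y => fderiv ℝ g y + fderiv ℝ h y := by
      filter_upwards [eventually_differentiableAt hg.1, eventually_differentiableAt hh.1]
        with y h1 h2
      exact fderiv_add h1 h2
    rw [e.fderiv_eq, ← hg.2.2 b, ← hh.2.2 b, ← Finset.sum_add_distrib]
    refine Finset.sum_congr rfl fun i _ => ?_
    have := ((differentiableAt_fderiv hg.1).hasFDerivAt.add
      (differentiableAt_fderiv hh.1).hasFDerivAt).fderiv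
    change fderiv ℝ (fderiv ℝ g + fderiv ℝ h) x (b i) (b i) = _
    rw [this]; simp

theorem mul (hg : HasLap g x d l) (hh : HasLap h x d' l') :
    HasLap (fun y => g y * h y) x (g x • d' + h x • d)
      (g x * l' + h x * l + 2 * ⟪d, d'⟫) := by
  refine ⟨hg.1.mul hh.1, ?_, fun b => ?_⟩
  · rw [hasGradientAt_iff_hasFDerivAt, map_add, map_smul, map_smul]
    exact hg.2.1.hasFDerivAt.mul hh.2.1.hasFDerivAt
  · have e : fderiv ℝ (fun y => g y * h y) =ᶠ[nhds x]
        fun y => g y • fderiv ℝ h y + h y • fderiv ℝ g y := by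
      filter_upwards [eventually_differentiableAt hg.1, eventually_differentiableAt hh.1]
        with y h1 h2
      exact fderiv_mul h1 h2
    have h3 := ((hg.2.1.hasFDerivAt.smul (differentiableAt_fderiv hh.1).hasFDerivAt).add
      (hh.2.1.hasFDerivAt.smul (differentiableAt_fderiv hg.1).hasFDerivAt)).fderiv
    have h4 : ∀ i, fderiv ℝ (fderiv ℝ fun y => g y * h y) x (b i) (b i) =
        g x * fderiv ℝ (fderiv ℝ h) x (b i) (b i) + h x * fderiv ℝ (fderiv ℝ g) x (b i) (b i)
          + 2 * (⟪d, b i⟫ * ⟪b i, d'⟫) := by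
      intro i
      rw [e.fderiv_eq]
      change fderiv ℝ ((fun y => g y • fderiv ℝ h y) + fun y => h y • fderiv ℝ g y) x _ _ = _
      erw [h3]
      simp [hg.fderiv_apply, hh.fderiv_apply, real_inner_comm d' (b i)]
      ring
    simp only [h4, Finset.sum_add_distrib, ← Finset.mul_sum, hg.2.2 b, hh.2.2 b,
      b.sum_inner_mul_inner]

theorem const (c : ℝ) : HasLap (fun _ : E n => c) x 0 0 := by
  refine ⟨contDiffAt_const, hasGradientAt_const _ _, fun b => ?_⟩
  have : fderiv ℝ (fun _ : E n => c) = fun _ => 0 := by ext; simp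
  simp [this]

theorem const_mul (c : ℝ) (hg : HasLap g x d l) : HasLap (fun y => c * g y) x (c • d) (c * l) :=
  ((const c).mul hg).congr (by simp) (by simp)

theorem neg (hg : HasLap g x d l) : HasLap (fun y => - g y) x (-d) (-l) := by
  simpa using hg.const_mul (-1)

theorem sub (hg : HasLap g x d l) (hh : HasLap h x d' l') :
    HasLap (fun y => g y - h y) x (d - d') (l - l') := by
  simpa [sub_eq_add_neg] using hg.add hh.neg

theorem comp {φ φ' : ℝ → ℝ} {φ'' : ℝ} (hg : HasLap g x d l) (hc : ContDiffAt ℝ 2 φ (g x))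
    (h1 : ∀ᶠ s in nhds (g x), HasDerivAt φ (φ' s) s) (h2 : HasDerivAt φ' φ'' (g x)) :
    HasLap (fun y => φ (g y)) x (φ' (g x) • d) (φ'' * ‖d‖ ^ 2 + φ' (g x) * l) := by
  refine ⟨hc.comp x hg.1, ?_, fun b => ?_⟩
  · rw [hasGradientAt_iff_hasFDerivAt, map_smul]
    exact h1.self_of_nhds.comp_hasFDerivAt x hg.2.1.hasFDerivAt
  · have e : fderiv ℝ (fun y => φ (g y)) =ᶠ[nhds x] fun y => φ' (g y) • fderiv ℝ g y := by
      filter_upwards [eventually_differentiableAt hg.1, hg.1.continuousAt.eventually h1]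
        with y h1 h2
      exact (h2.comp_hasFDerivAt y h1.hasFDerivAt).fderiv
    have h3 := ((h2.comp_hasFDerivAt x hg.2.1.hasFDerivAt).smul
      (differentiableAt_fderiv hg.1).hasFDerivAt).fderiv
    have h4 : ∀ i, fderiv ℝ (fderiv ℝ fun y => φ (g y)) x (b i) (b i) =
        φ'' * (⟪d, b i⟫ * ⟪b i, d⟫) + φ' (g x) * fderiv ℝ (fderiv ℝ g) x (b i) (b i) := by
      intro i
      rw [e.fderiv_eq]
      erw [h3]
      simp [hg.fderiv_apply, real_inner_comm d (b i)]
      ring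
    simp only [h4, Finset.sum_add_distrib, ← Finset.mul_sum, hg.2.2 b,
      b.sum_inner_mul_inner, real_inner_self_eq_norm_sq]

theorem inner (a : E n) : HasLap (fun y => ⟪a, y⟫) x a 0 := by
  have hf : fderiv ℝ (fun y : E n => ⟪a, y⟫) = fun _ => innerSL ℝ a := by
    ext1 y
    exact (innerSL ℝ a).hasFDerivAt.fderiv
  refine ⟨contDiffAt_const.inner ℝ contDiffAt_id, ?_, fun b => ?_⟩
  · rw [hasGradientAt_iff_hasFDerivAt]
    exact (innerSL ℝ a).hasFDerivAt
  · simp [hf]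

theorem norm_sub_sq (p : E n) :
    HasLap (fun y => ‖y - p‖ ^ 2) x ((2 : ℝ) • (x - p)) (2 * n) := by
  have hd : ∀ y : E n, HasFDerivAt (fun y => ‖y - p‖ ^ 2) ((2 : ℝ) • innerSL ℝ (y - p)) y := by
    intro y
    have h := ((hasFDerivAt_id y).sub_const p).norm_sq
    refine h.congr_fderiv ?_
    ext v
    simp [two_smul]
  have hf : fderiv ℝ (fun y : E n => ‖y - p‖ ^ 2) = fun y => (2 : ℝ) • innerSL ℝ (y - p) := by
    ext1 y
    exact (hd y).fderiv
  refine ⟨(contDiffAt_id.sub contDiffAt_const).norm_sq ℝ, ?_, fun b => ?_⟩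
  · rw [hasGradientAt_iff_hasFDerivAt, map_smul]
    exact hd x
  · have h2 : HasFDerivAt (fun y : E n => (2 : ℝ) • innerSL ℝ (y - p))
        ((2 : ℝ) • (innerSL ℝ : E n →L[ℝ] E n →L[ℝ] ℝ)) x := by
      have := ((innerSL ℝ : E n →L[ℝ] E n →L[ℝ] ℝ).hasFDerivAt.comp x
        ((hasFDerivAt_id x).sub_const p)).const_smul (2 : ℝ)
      exact this
    rw [hf, h2.fderiv]
    have : ∀ i, ((2 : ℝ) • (innerSL ℝ : E n →L[ℝ] E n →L[ℝ] ℝ)) (b i) (b i) = 2 := by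
      intro i
      simp only [smul_apply, smul_eq_mul]
      erw [innerSL_apply_apply, real_inner_self_eq_norm_sq, b.norm_eq_one]
      norm_num
    rw [Finset.sum_congr rfl fun i _ => this i]
    simp [mul_comm]

theorem of_elap (hg : ContDiffAt ℝ 2 g x) (h0 : elap g x = l) :
    HasLap g x (gradient g x) l := by
  refine ⟨hg, (hg.differentiableAt (by simp)).hasGradientAt, fun b => ?_⟩
  have h1 := congrFun (InnerProductSpace.laplacian_eq_iteratedFDeriv_orthonormalBasis g b) x
  have h2 := congrFun (InnerProductSpace.laplacian_eq_iteratedFDeriv_orthonormalBasis g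
    (EuclideanSpace.basisFun (Fin n) ℝ)) x
  rw [h1] at h2
  simp only [iteratedFDeriv_two_apply] at h2
  rw [← h0, elap]
  simpa [iteratedFDeriv_two_apply] using h2

end HasLap

theorem deriv_deriv_nonpos_of_isLocalMax {φ φ' : ℝ → ℝ} {c : ℝ} (hm : IsLocalMax φ 0)
    (h1 : ∀ᶠ t in nhds (0 : ℝ), HasDerivAt φ (φ' t) t) (h2 : HasDerivAt φ' c 0) : c ≤ 0 := by
  by_contra! hc
  have e : deriv φ =ᶠ[nhds 0] φ' := h1.mono fun t ht => ht.deriv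
  have hd : deriv (deriv φ) 0 = c := by rw [e.deriv_eq]; exact h2.deriv
  have hmin := isLocalMin_of_deriv_deriv_pos (by rw [hd]; exact hc) hm.deriv_eq_zero
    h1.self_of_nhds.continuousAt
  have h3 : ∀ᶠ t in nhds (0 : ℝ), φ t = φ 0 := by
    filter_upwards [hm, hmin] with t ha hb using le_antisymm ha hb
  have h4 : deriv φ =ᶠ[nhds 0] fun _ => 0 := by
    filter_upwards [h3.eventually_nhds] with t ht
    have : φ =ᶠ[nhds t] fun _ => φ 0 := ht
    rw [this.deriv_eq]; simp
  have := h4.deriv_eq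
  simp at this
  linarith

/-- Derivatives of the restriction of a `C²` function to a line. -/
theorem hasDerivAt_line {n : ℕ} {g : E n → ℝ} {x : E n} (hg : ContDiffAt ℝ 2 g x) (b : E n) :
    (∀ᶠ t in nhds (0 : ℝ), HasDerivAt (fun t : ℝ => g (x + t • b)) (fderiv ℝ g (x + t • b) b) t) ∧
    HasDerivAt (fun t : ℝ => fderiv ℝ g (x + t • b) b) (fderiv ℝ (fderiv ℝ g) x b b) 0 := by
  have hl : ∀ t : ℝ, HasDerivAt (fun t : ℝ => x + t • b) b t := fun t => by
    simpa using ((hasDerivAt_id t).smul_const b).const_add x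
  have hx : x + (0 : ℝ) • b = x := by simp
  constructor
  · have hc : ContinuousAt (fun t : ℝ => x + t • b) 0 := (hl 0).continuousAt
    have h0 : ∀ᶠ y in nhds ((fun t : ℝ => x + t • b) 0), DifferentiableAt ℝ g y := by
      simp only [hx]; exact HasLap.eventually_differentiableAt hg
    have := hc.eventually h0
    filter_upwards [this] with t ht
    exact ht.hasFDerivAt.comp_hasDerivAt t (hl t)
  · have h1 : HasFDerivAt (fderiv ℝ g) (fderiv ℝ (fderiv ℝ g) x) (x + (0 : ℝ) • b) := by
      rw [hx]; exact (HasLap.differentiableAt_fderiv hg).hasFDerivAt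
    have h2 := h1.comp_hasDerivAt 0 (hl 0)
    exact h2.clm_apply (hasDerivAt_const 0 b) |>.congr_deriv (by simp)

/-- At an interior local maximum the Laplacian is nonpositive. -/
theorem HasLap.nonpos_of_isLocalMax {n : ℕ} {g : E n → ℝ} {x d : E n} {l : ℝ}
    (hg : HasLap g x d l) (hm : IsLocalMax g x) : l ≤ 0 := by
  rw [← hg.2.2 (EuclideanSpace.basisFun (Fin n) ℝ)]
  refine Finset.sum_nonpos fun i _ => ?_
  set b := EuclideanSpace.basisFun (Fin n) ℝ i
  obtain ⟨h1, h2⟩ := hasDerivAt_line hg.1 b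
  refine deriv_deriv_nonpos_of_isLocalMax ?_ h1 h2
  have hc : ContinuousAt (fun t : ℝ => x + t • b) 0 := by fun_prop
  have := hc.eventually (p := fun y => g y ≤ g x) (by simp only [zero_smul, add_zero]; exact hm)
  filter_upwards [this] with t ht
  simpa using ht

theorem hasDerivAt_max_zero_pow (k : ℕ) (s : ℝ) :
    HasDerivAt (fun s : ℝ => max 0 s ^ (k + 2)) ((k + 2) * max 0 s ^ (k + 1)) s := by
  rcases lt_trichotomy s 0 with hs | rfl | hs
  · have e : (fun s : ℝ => max 0 s ^ (k + 2)) =ᶠ[nhds s] fun _ => 0 := by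
      filter_upwards [Iio_mem_nhds hs] with t ht
      simp [max_eq_left (le_of_lt (show t < 0 from ht))]
    rw [max_eq_left hs.le]
    simpa using (hasDerivAt_const s (0 : ℝ)).congr_of_eventuallyEq e
  · rw [hasDerivAt_iff_isLittleO]
    simp only [max_self, ne_eq, Nat.add_eq_zero_iff, one_ne_zero, and_false, not_false_eq_true,
      zero_pow, sub_zero, OfNat.ofNat_ne_zero, mul_zero, smul_zero]
    refine Asymptotics.IsBigO.trans_isLittleO (g := fun t : ℝ => t ^ 2) ?_ ?_
    · refine Asymptotics.IsBigO.of_bound 1 ?_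
      filter_upwards [Metric.ball_mem_nhds (0 : ℝ) one_pos] with t ht
      have h1 : |t| ≤ 1 := by simpa using (le_of_lt (show dist t 0 < 1 from ht))
      have h0 : 0 ≤ max 0 t := le_max_left _ _
      have h2 : max 0 t ≤ |t| := max_le (abs_nonneg _) (le_abs_self _)
      rw [Real.norm_of_nonneg (by positivity), Real.norm_of_nonneg (by positivity), one_mul,
        ← sq_abs t]
      calc max 0 t ^ (k + 2) ≤ |t| ^ (k + 2) := by gcongr
        _ ≤ |t| ^ 2 := pow_le_pow_of_le_one (abs_nonneg _) h1 (by omega)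
    · simpa using Asymptotics.isLittleO_pow_id (𝕜 := ℝ) (by norm_num : 1 < 2)
  · have e : (fun s : ℝ => max 0 s ^ (k + 2)) =ᶠ[nhds s] fun t => t ^ (k + 2) := by
      filter_upwards [Ioi_mem_nhds hs] with t ht
      simp only [max_eq_right (le_of_lt (show 0 < t from ht))]
    rw [max_eq_right hs.le]
    have := (hasDerivAt_pow (k + 2) s).congr_of_eventuallyEq e
    simpa using this

theorem contDiff_max_zero_cube : ContDiff ℝ 2 (fun s : ℝ => max 0 s ^ 3) := by
  have h3 : ∀ s : ℝ, HasDerivAt (fun s : ℝ => max 0 s ^ 3) (3 * max 0 s ^ 2) s := fun s => by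
    have := hasDerivAt_max_zero_pow 1 s
    norm_num at this; exact this
  have h2 : ∀ s : ℝ, HasDerivAt (fun s : ℝ => 3 * max 0 s ^ 2) (3 * (2 * max 0 s)) s := fun s => by
    have := (hasDerivAt_max_zero_pow 0 s).const_mul 3
    norm_num at this; exact this
  have e3 : deriv (fun s : ℝ => max 0 s ^ 3) = fun s => 3 * max 0 s ^ 2 :=
    funext fun s => (h3 s).deriv
  have e2 : deriv (fun s : ℝ => 3 * max 0 s ^ 2) = fun s => 3 * (2 * max 0 s) :=
    funext fun s => (h2 s).deriv
  rw [show (2 : WithTop ℕ∞) = 1 + 1 by norm_num, contDiff_succ_iff_deriv, e3]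
  refine ⟨fun s => (h3 s).differentiableAt, by simp, ?_⟩
  rw [show (1 : WithTop ℕ∞) = 0 + 1 by norm_num, contDiff_succ_iff_deriv, e2]
  refine ⟨fun s => (h2 s).differentiableAt, by simp, ?_⟩
  rw [contDiff_zero]
  fun_prop

/-- `C²` cutoff of the nonpositive function `s`: it vanishes for `s ≤ -h/4` and has slope `1` at
`s = 0`. -/
def cubeCut (h s : ℝ) : ℝ := 16 / (3 * h ^ 2) * max 0 (s + h / 4) ^ 3

def cubeCut' (h s : ℝ) : ℝ := 16 / h ^ 2 * max 0 (s + h / 4) ^ 2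

def cubeCut'' (h s : ℝ) : ℝ := 32 / h ^ 2 * max 0 (s + h / 4)

theorem HasLap.cubeCut {n : ℕ} {G : E n → ℝ} {x d : E n} {l : ℝ} (hG : HasLap G x d l)
    {h : ℝ} (hh : 0 < h) :
    HasLap (fun y => cubeCut h (G y)) x (cubeCut' h (G x) • d)
      (cubeCut'' h (G x) * ‖d‖ ^ 2 + cubeCut' h (G x) * l) := by
  have h3 : ∀ s, HasDerivAt (_root_.cubeCut h) (cubeCut' h s) s := fun s => by
    have := ((hasDerivAt_max_zero_pow 1 (s + h / 4)).comp_add_const s (h / 4)).const_mul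
      (16 / (3 * h ^ 2))
    norm_num at this
    refine this.congr_deriv ?_
    unfold cubeCut'; field_simp
  have h2 : ∀ s, HasDerivAt (cubeCut' h) (cubeCut'' h s) s := fun s => by
    have := ((hasDerivAt_max_zero_pow 0 (s + h / 4)).comp_add_const s (h / 4)).const_mul
      (16 / (h ^ 2))
    norm_num at this
    refine this.congr_deriv ?_
    unfold cubeCut''; ring
  refine hG.comp ?_ (Filter.Eventually.of_forall h3) (h2 _)
  unfold _root_.cubeCut
  refine ContDiff.contDiffAt ?_
  exact contDiff_const.mul (contDiff_max_zero_cube.comp (contDiff_id.add contDiff_const))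

theorem cubeCut_bounds {h s : ℝ} (hh : 0 < h) (hs : s ≤ 0) :
    0 ≤ cubeCut h s ∧ 0 ≤ cubeCut' h s ∧ cubeCut' h s ≤ 1 ∧ 0 ≤ cubeCut'' h s ∧
      cubeCut'' h s ≤ 8 / h := by
  have h0 : 0 ≤ max 0 (s + h / 4) := le_max_left _ _
  have h1 : max 0 (s + h / 4) ≤ h / 4 := max_le (by linarith) (by linarith)
  refine ⟨by unfold cubeCut; positivity, by unfold cubeCut'; positivity, ?_,
    by unfold cubeCut''; positivity, ?_⟩
  · unfold cubeCut'
    calc 16 / h ^ 2 * max 0 (s + h / 4) ^ 2 ≤ 16 / h ^ 2 * (h / 4) ^ 2 := by gcongr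
      _ = 1 := by field_simp; norm_num
  · unfold cubeCut''
    calc 32 / h ^ 2 * max 0 (s + h / 4) ≤ 32 / h ^ 2 * (h / 4) := by gcongr
      _ = 8 / h := by field_simp; norm_num

theorem cubeCut_eq_zero {h s : ℝ} (hs : s ≤ -h / 4) : cubeCut h s = 0 ∧ cubeCut' h s = 0 := by
  have : max 0 (s + h / 4) = 0 := max_eq_left (by linarith)
  simp [cubeCut, cubeCut', this]

theorem cubeCut'_zero {h : ℝ} (hh : 0 < h) : cubeCut' h 0 = 1 := by
  rw [cubeCut', zero_add, max_eq_right (by positivity)]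
  field_simp; norm_num

/-- The modulus `8 (2 r / ρ - (r / ρ)²)`. -/
def modulus (ρ r : ℝ) : ℝ := 8 * (2 * (r / ρ) - (r / ρ) ^ 2)

theorem hasDerivAt_modulus (ρ r : ℝ) :
    HasDerivAt (modulus ρ) (16 / ρ * (1 - r / ρ)) r := by
  have h := (hasDerivAt_id r).div_const ρ
  have := ((h.const_mul 2).sub (h.pow 2)).const_mul 8
  refine this.congr_deriv ?_
  simp; ring

/-- One-sided first order condition. -/
theorem deriv_nonpos_of_right_max {φ : ℝ → ℝ} {d : ℝ} (h : HasDerivAt φ d 0)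
    (hm : ∀ᶠ t in nhdsWithin (0 : ℝ) (Ioi 0), φ t ≤ φ 0) : d ≤ 0 := by
  have ht := hasDerivAt_iff_tendsto_slope.1 h
  have ht' := ht.mono_left (nhdsWithin_mono 0 (fun t (ht : t ∈ Ioi (0 : ℝ)) => ne_of_gt ht))
  refine le_of_tendsto ht' ?_
  filter_upwards [hm, self_mem_nhdsWithin] with t h1 h2
  rw [slope_def_field]
  exact div_nonpos_of_nonpos_of_nonneg (by linarith) (by simpa using le_of_lt h2)

/-- Every unit vector belongs to an orthonormal basis. -/
theorem exists_orthonormalBasis_mem {n : ℕ} {e : E n} (he : ‖e‖ = 1) :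
    ∃ b : OrthonormalBasis (Fin n) ℝ (E n), ∃ i, b i = e := by
  have hn : 0 < n := by
    rcases Nat.eq_zero_or_pos n with rfl | h
    · have : e = 0 := Subsingleton.elim _ _
      simp [this] at he
    · exact h
  have ho : Orthonormal ℝ (Set.domRestrict ({(⟨0, hn⟩ : Fin n)} : Set (Fin n)) fun _ => e) := by
    constructor
    · intro i; exact he
    · intro i j hij; exact absurd (Subsingleton.elim i j) hij
  obtain ⟨b, hb⟩ := ho.exists_orthonormalBasis_extension_of_card_eq (by simp)
  exact ⟨b, ⟨0, hn⟩, hb _ rfl⟩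

/-- First and second order conditions at an interior maximum of a doubled function. -/
theorem two_point_max {n : ℕ} {P W : E n → ℝ} {x y dP dW ν p : E n} {lP lW ρ B : ℝ}
    (hP : HasLap P x dP lP) (hW : HasLap W y dW lW) (hxy : x ≠ y)
    (hm : IsLocalMax (fun z : E n × E n => P z.1 - W z.2 -
      modulus ρ ‖z.1 - z.2‖ * (1 + B * (⟪ν, z.1 - p⟫ + ⟪ν, z.2 - p⟫))) (x, y)) :
    ⟪dP, ν⟫ - ⟪dW, ν⟫ = modulus ρ ‖x - y‖ * (2 * B * ‖ν‖ ^ 2) ∧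
    lP - lW + 64 / ρ ^ 2 * (1 + B * (⟪ν, x - p⟫ + ⟪ν, y - p⟫)) ≤ 0 := by
  set A := 1 + B * (⟪ν, x - p⟫ + ⟪ν, y - p⟫) with hA
  have hline : ∀ b b' : E n, ∀ᶠ t in nhds (0 : ℝ),
      P (x + t • b) - W (y + t • b') - modulus ρ ‖x + t • b - (y + t • b')‖ *
        (1 + B * (⟪ν, x + t • b - p⟫ + ⟪ν, y + t • b' - p⟫)) ≤
      P x - W y - modulus ρ ‖x - y‖ * A := by
    intro b b'
    have hc : Filter.Tendsto (fun t : ℝ => (x + t • b, y + t • b')) (nhds 0) (nhds (x, y)) := by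
      have : Continuous (fun t : ℝ => (x + t • b, y + t • b')) := by fun_prop
      simpa using this.tendsto 0
    exact hc.eventually hm
  -- the doubled function along the diagonal direction `(b, b)`
  have hdiag : ∀ b : E n, ∃ φ : ℝ → ℝ, IsLocalMax φ 0 ∧
      φ = fun t => P (x + t • b) - W (y + t • b) -
        (modulus ρ ‖x - y‖ * A + t * (modulus ρ ‖x - y‖ * (2 * B * ⟪ν, b⟫))) := by
    intro b
    refine ⟨_, ?_, rfl⟩
    have := hline b b
    unfold IsLocalMax IsMaxFilter
    filter_upwards [this] with t ht
    have e1 : x + t • b - (y + t • b) = x - y := by abel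
    have e2 : ∀ z : E n, ⟪ν, z + t • b - p⟫ = ⟪ν, z - p⟫ + t * ⟪ν, b⟫ := by
      intro z
      rw [show z + t • b - p = (z - p) + t • b by abel, inner_add_right, real_inner_smul_right]
    rw [e1, e2, e2] at ht
    simp only [zero_smul, add_zero, zero_mul]
    rw [hA] at ht ⊢
    linarith
  have hd1 : ∀ b : E n, ⟪dP, b⟫ - ⟪dW, b⟫ = modulus ρ ‖x - y‖ * (2 * B * ⟪ν, b⟫) := by
    intro b
    obtain ⟨φ, hφ, rfl⟩ := hdiag b
    obtain ⟨p1, p2⟩ := hasDerivAt_line hP.1 b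
    obtain ⟨w1, w2⟩ := hasDerivAt_line hW.1 b
    have := (p1.self_of_nhds.sub w1.self_of_nhds).sub
      (((hasDerivAt_id (0 : ℝ)).mul_const (modulus ρ ‖x - y‖ * (2 * B * ⟪ν, b⟫))).const_add
        (modulus ρ ‖x - y‖ * A))
    have h0 := hφ.hasDerivAt_eq_zero this
    simp only [zero_smul, add_zero, hP.fderiv_apply, hW.fderiv_apply] at h0
    linarith
  refine ⟨by rw [hd1 ν, real_inner_self_eq_norm_sq], ?_⟩
  have hd2 : ∀ b : E n, fderiv ℝ (fderiv ℝ P) x b b - fderiv ℝ (fderiv ℝ W) y b b ≤ 0 := by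
    intro b
    obtain ⟨φ, hφ, rfl⟩ := hdiag b
    obtain ⟨p1, p2⟩ := hasDerivAt_line hP.1 b
    obtain ⟨w1, w2⟩ := hasDerivAt_line hW.1 b
    have h2 := (p2.sub w2).sub (hasDerivAt_const (0 : ℝ) (modulus ρ ‖x - y‖ * (2 * B * ⟪ν, b⟫)))
    have := deriv_deriv_nonpos_of_isLocalMax hφ ?_ h2
    · simpa using this
    · filter_upwards [p1, w1] with t q1 q2
      have := (q1.sub q2).sub (((hasDerivAt_id t).mul_const
        (modulus ρ ‖x - y‖ * (2 * B * ⟪ν, b⟫))).const_add (modulus ρ ‖x - y‖ * A))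
      rw [one_mul] at this
      exact this
  have hr : 0 < ‖x - y‖ := norm_pos_iff.2 (sub_ne_zero.2 hxy)
  set r := ‖x - y‖ with hr'
  set e : E n := r⁻¹ • (x - y) with he
  have he1 : ‖e‖ = 1 := by
    rw [he, norm_smul, norm_inv, Real.norm_of_nonneg hr.le, ← hr']
    field_simp
  have hxe : x - y = r • e := by rw [he, smul_smul, mul_inv_cancel₀ hr.ne', one_smul]
  have hd3 : fderiv ℝ (fderiv ℝ P) x e e - fderiv ℝ (fderiv ℝ W) y e e + 64 / ρ ^ 2 * A ≤ 0 := by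
    obtain ⟨p1, p2⟩ := hasDerivAt_line hP.1 e
    obtain ⟨w1, w2⟩ := hasDerivAt_line hW.1 (-e)
    have hφ : IsLocalMax (fun t => P (x + t • e) - W (y + t • (-e)) -
        modulus ρ (r + 2 * t) * A) 0 := by
      unfold IsLocalMax IsMaxFilter
      filter_upwards [hline e (-e), Ioi_mem_nhds (show -r / 2 < 0 by linarith)] with t ht htr
      have e1 : x + t • e - (y + t • (-e)) = (r + 2 * t) • e := by
        rw [show x + t • e - (y + t • (-e)) = (x - y) + (2 * t) • e by
          rw [smul_neg, mul_smul, two_smul]; abel, hxe, add_smul]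
      have e2 : ⟪ν, x + t • e - p⟫ + ⟪ν, y + t • (-e) - p⟫ = ⟪ν, x - p⟫ + ⟪ν, y - p⟫ := by
        rw [show x + t • e - p = (x - p) + t • e by abel,
          show y + t • (-e) - p = (y - p) - t • e by rw [smul_neg]; abel,
          inner_add_right, inner_sub_right (y := y - p)]
        ring
      have hpos : 0 ≤ r + 2 * t := by
        have : -r / 2 < t := htr
        linarith
      rw [e1, e2, norm_smul, he1, mul_one, Real.norm_of_nonneg hpos] at ht
      simpa using ht
    have hmod : ∀ t, HasDerivAt (fun t => modulus ρ (r + 2 * t) * A)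
        (16 / ρ * (1 - (r + 2 * t) / ρ) * 2 * A) t := by
      intro t
      have h1 : HasDerivAt (fun t : ℝ => r + 2 * t) 2 t := by
        simpa using ((hasDerivAt_id t).const_mul 2).const_add r
      exact ((hasDerivAt_modulus ρ (r + 2 * t)).comp t h1).mul_const A
    have hmod2 : HasDerivAt (fun t => 16 / ρ * (1 - (r + 2 * t) / ρ) * 2 * A)
        (-(64 / ρ ^ 2 * A)) 0 := by
      have h1 : HasDerivAt (fun t : ℝ => r + 2 * t) 2 0 := by
        simpa using ((hasDerivAt_id (0 : ℝ)).const_mul 2).const_add r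
      have := ((((h1.div_const ρ).const_sub 1).const_mul (16 / ρ)).mul_const 2).mul_const A
      refine this.congr_deriv ?_
      ring
    have := deriv_deriv_nonpos_of_isLocalMax hφ ?_ ((p2.sub w2).sub hmod2)
    · simp only [map_neg, neg_apply, neg_neg] at this
      linarith
    · filter_upwards [p1, w1] with t q1 q2
      exact (q1.sub q2).sub (hmod t)
  obtain ⟨b, i, hi⟩ := exists_orthonormalBasis_mem he1
  rw [← hP.2.2 b, ← hW.2.2 b, ← Finset.sum_sub_distrib, ← Finset.add_sum_erase _ _
    (Finset.mem_univ i), hi]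
  have := Finset.sum_nonpos (s := Finset.univ.erase i) fun k _ => hd2 (b k)
  linarith

/-- A scalar function with `c`-Lipschitz gradient, of norm between `1` and `1 + c`. -/
structure NiceDefining {n : ℕ} (c : ℝ) (F : E n → ℝ) : Prop where
  contDiff : ContDiff ℝ 2 F
  lip : ∀ x y, ‖gradient F x - gradient F y‖ ≤ c * ‖x - y‖
  one_le : ∀ x, 1 ≤ ‖gradient F x‖
  le : ∀ x, ‖gradient F x‖ ≤ 1 + c

namespace NiceDefining

variable {n : ℕ} {c : ℝ} {F : E n → ℝ}

theorem differentiable (hF : NiceDefining c F) : Differentiable ℝ F :=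
  hF.contDiff.differentiable (by simp)

theorem hasGradientAt (hF : NiceDefining c F) (x : E n) : HasGradientAt F (gradient F x) x :=
  (hF.differentiable x).hasGradientAt

theorem taylor (hF : NiceDefining c F) (hc : 0 ≤ c) (x y : E n) :
    |F y - F x - ⟪gradient F x, y - x⟫| ≤ c * ‖y - x‖ ^ 2 := by
  have := Convex.norm_image_sub_le_of_norm_hasFDerivWithin_le' (𝕜 := ℝ) (f := F)
    (f' := fun z => fderiv ℝ F z) (φ := fderiv ℝ F x) (C := c * ‖y - x‖)
    (s := segment ℝ x y) (x := x) (y := y)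
    (fun z _ => (hF.differentiable z).hasFDerivAt.hasFDerivWithinAt) ?_ (convex_segment x y)
    (left_mem_segment ℝ x y) (right_mem_segment ℝ x y)
  · rw [(hF.hasGradientAt x).fderiv_apply, Real.norm_eq_abs] at this
    rw [pow_two, ← mul_assoc]; exact this
  · intro z hz
    have h1 : fderiv ℝ F z - fderiv ℝ F x =
        InnerProductSpace.toDual ℝ (E n) (gradient F z - gradient F x) := by
      rw [map_sub]; simp [gradient]
    rw [h1, LinearIsometryEquiv.norm_map]
    refine (hF.lip z x).trans ?_
    gcongr
    have := norm_sub_le_of_mem_segment hz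
    simpa using this

theorem lap (hF : NiceDefining c F) (hc : 0 ≤ c) (x : E n) :
    ∃ l, HasLap F x (gradient F x) l ∧ |l| ≤ n * c := by
  have hL := HasLap.of_elap (hF.contDiff.contDiffAt (x := x)) rfl
  refine ⟨_, hL, ?_⟩
  rw [← hL.2.2 (EuclideanSpace.basisFun (Fin n) ℝ)]
  have hlip : LipschitzWith c.toNNReal (fderiv ℝ F) := by
    refine LipschitzWith.of_dist_le_mul fun z w => ?_
    have h1 : fderiv ℝ F z - fderiv ℝ F w =
        InnerProductSpace.toDual ℝ (E n) (gradient F z - gradient F w) := by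
      rw [map_sub]; simp [gradient]
    rw [dist_eq_norm, h1, LinearIsometryEquiv.norm_map, dist_eq_norm, Real.coe_toNNReal c hc]
    exact hF.lip z w
  have hn : ‖fderiv ℝ (fderiv ℝ F) x‖ ≤ c := by
    have := norm_fderiv_le_of_lipschitz ℝ hlip (x₀ := x)
    rwa [Real.coe_toNNReal c hc] at this
  refine (Finset.abs_sum_le_sum_abs _ _).trans ?_
  refine (Finset.sum_le_card_nsmul _ _ c fun i _ => ?_).trans (by simp)
  set b := EuclideanSpace.basisFun (Fin n) ℝ i
  have hb : ‖b‖ = 1 := (EuclideanSpace.basisFun (Fin n) ℝ).norm_eq_one i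
  have := (fderiv ℝ (fderiv ℝ F) x).le_opNorm₂ b b
  rw [hb, mul_one, mul_one, Real.norm_eq_abs] at this
  linarith

end NiceDefining

/-- A thin domain `{F ≤ 0, G ≤ 0}` near `p`, with a solution `u` of the Robin problem there. -/
structure ThinSetting {n : ℕ} (c k R h : ℝ) (F G u : E n → ℝ) (p : E n) : Prop where
  hc : 0 < c
  hk : 0 < k
  hR : 0 < R
  hh : 0 < h
  hBR : (6 * c + 2) * R ≤ 1 / 4
  hkR : k * R ≤ 1 / 2
  hkc : k * c ^ 2 * R ^ 2 ≤ 6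
  hF : NiceDefining c F
  hG : NiceDefining c G
  hFp : F p < 0
  hGp : G p ≤ - h / 2
  thin : ∀ x, F x ≤ 0 → G x ≤ 0 → ‖x - p‖ ≤ R → F x + G x ≤ -h
  bdd : ∀ x, F x ≤ 0 → G x ≤ 0 → ‖x - p‖ ≤ R → |u x| ≤ 1
  diff : ∀ x, F x ≤ 0 → G x ≤ 0 → ‖x - p‖ ≤ R → DifferentiableAt ℝ u x
  bdF : ∀ x, F x = 0 → G x ≤ 0 → ‖x - p‖ ≤ R →
    ⟪gradient u x, gradient F x⟫ = - (k * (‖gradient F x‖ * u x))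
  bdG : ∀ x, F x ≤ 0 → G x = 0 → ‖x - p‖ ≤ R →
    ⟪gradient u x, gradient G x⟫ = - (k * (‖gradient G x‖ * u x))
  harm : ∀ x, F x < 0 → G x < 0 → ‖x - p‖ ≤ R → ContDiffAt ℝ 2 u x ∧ elap u x = 0

/-- Direction of the weight. -/
def unitGrad {n : ℕ} (F : E n → ℝ) (p : E n) : E n := ‖gradient F p‖⁻¹ • gradient F p

/-- Slope of the boundary penalization. -/
def slopeT (c k : ℝ) : ℝ := 4 * k * (1 + c) + 27 * c + 15 * (6 * c + 2) * (1 + c)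

/-- Penalization term in the doubling argument. -/
def penalty {n : ℕ} (c k R h : ℝ) (F G : E n → ℝ) (p x : E n) : ℝ :=
  6 / R ^ 2 * (‖x - p‖ ^ 2 * (1 + (6 * c + 2) * ⟪unitGrad F p, x - p⟫)) +
    slopeT c k * cubeCut h (G x)

/-- Gradient of the penalization term. -/
def penaltyGrad {n : ℕ} (c k R h : ℝ) (F G : E n → ℝ) (p x : E n) : E n :=
  (6 / R ^ 2) • (‖x - p‖ ^ 2 • ((6 * c + 2) • unitGrad F p) +
      (1 + (6 * c + 2) * ⟪unitGrad F p, x - p⟫) • ((2 : ℝ) • (x - p))) +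
    slopeT c k • cubeCut' h (G x) • gradient G x

/-- The doubled penalization. -/
def doubled {n : ℕ} (c k R h ρ : ℝ) (F G : E n → ℝ) (p x y : E n) : ℝ :=
  modulus ρ ‖x - y‖ * (1 + (6 * c + 2) * (⟪unitGrad F p, x - p⟫ + ⟪unitGrad F p, y - p⟫)) +
    penalty c k R h F G p x + penalty c k R h F G p y

/-- Exponentially weighted function. -/
def weighted {n : ℕ} (k : ℝ) (F u : E n → ℝ) (p x : E n) : ℝ :=
  Real.exp (k * ⟪unitGrad F p, x - p⟫) * u x

theorem HasLap.inner_sub {n : ℕ} (a p x : E n) : HasLap (fun y => ⟪a, y - p⟫) x a 0 := by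
  have := (HasLap.inner (x := x) a).sub (HasLap.const ⟪a, p⟫)
  simpa [inner_sub_right] using this

theorem hasLap_exp {n : ℕ} (k : ℝ) (a p x : E n) :
    HasLap (fun y => Real.exp (k * ⟪a, y - p⟫)) x
      ((k * Real.exp (k * ⟪a, x - p⟫)) • a) (k ^ 2 * Real.exp (k * ⟪a, x - p⟫) * ‖a‖ ^ 2) := by
  have h1 : HasLap (fun y => k * ⟪a, y - p⟫) x (k • a) (k * 0) := (HasLap.inner_sub a p x).const_mul k
  have h2 := h1.comp (φ := Real.exp) (φ' := Real.exp) (φ'' := Real.exp (k * ⟪a, x - p⟫))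
    Real.contDiff_exp.contDiffAt (Filter.Eventually.of_forall Real.hasDerivAt_exp)
    (Real.hasDerivAt_exp _)
  refine h2.congr ?_ ?_
  · rw [smul_smul, mul_comm]
  · rw [norm_smul, mul_pow, Real.norm_eq_abs, sq_abs]; ring

namespace ThinSetting

variable {n : ℕ} {c k R h ρ : ℝ} {F G u : E n → ℝ} {p x y : E n}

theorem neg (S : ThinSetting c k R h F G u p) :
    ThinSetting c k R h F G (fun x => - u x) p := by
  have hgr : ∀ x, F x ≤ 0 → G x ≤ 0 → ‖x - p‖ ≤ R →
      gradient (fun x => - u x) x = - gradient u x := by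
    intro x h1 h2 h3
    have := (S.diff x h1 h2 h3).hasGradientAt
    refine HasGradientAt.gradient ?_
    rw [hasGradientAt_iff_hasFDerivAt, map_neg]
    exact this.hasFDerivAt.neg
  exact { S with
    bdd := fun x h1 h2 h3 => by rw [abs_neg]; exact S.bdd x h1 h2 h3
    diff := fun x h1 h2 h3 => (S.diff x h1 h2 h3).neg
    bdF := fun x h1 h2 h3 => by
      rw [hgr x h1.le h2 h3, inner_neg_left, S.bdF x h1 h2 h3]; ring
    bdG := fun x h1 h2 h3 => by
      rw [hgr x h1 h2.le h3, inner_neg_left, S.bdG x h1 h2 h3]; ring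
    harm := fun x h1 h2 h3 => by
      obtain ⟨q1, q2⟩ := S.harm x h1 h2 h3
      have := (HasLap.of_elap q1 q2).neg
      refine ⟨this.1, ?_⟩
      have h4 := HasLap.of_elap this.1 rfl
      rw [← h4.2.2 (EuclideanSpace.basisFun (Fin n) ℝ),
        this.2.2 (EuclideanSpace.basisFun (Fin n) ℝ), neg_zero] }

theorem norm_unitGrad (S : ThinSetting c k R h F G u p) : ‖unitGrad F p‖ = 1 := by
  have := S.hF.one_le p
  rw [unitGrad, norm_smul, norm_inv, norm_norm, inv_mul_cancel₀ (by positivity)]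

theorem hasLap_penalty (S : ThinSetting c k R h F G u p) (x : E n) (hx : G x ≤ 0)
    (hxR : ‖x - p‖ ≤ R) :
    ∃ l, HasLap (penalty c k R h F G p) x (penaltyGrad c k R h F G p x) l ∧
      l ≤ 6 / R ^ 2 * (5 / 2 * n + 1) + slopeT c k * (8 * (1 + c) ^ 2 / h + n * c) := by
  obtain ⟨lG, hlG, hlG'⟩ := S.hG.lap S.hc.le x
  have hc := S.hc
  have hk := S.hk
  have hR := S.hR
  have hh := S.hh
  set ν := unitGrad F p with hν
  have hν1 : ‖ν‖ = 1 := S.norm_unitGrad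
  have h1 : HasLap (fun y => 1 + (6 * c + 2) * ⟪ν, y - p⟫) x (0 + (6 * c + 2) • ν)
      (0 + (6 * c + 2) * 0) :=
    (HasLap.const 1).add ((HasLap.inner_sub ν p x).const_mul _)
  have h2 := ((HasLap.norm_sub_sq (x := x) p).mul h1).const_mul (6 / R ^ 2)
  have h3 := (hlG.cubeCut hh).const_mul (slopeT c k)
  refine ⟨_, (h2.add h3).congr ?_ rfl, ?_⟩
  · rw [penaltyGrad, zero_add]
  · have hip : |⟪ν, x - p⟫| ≤ R := by
      have := abs_real_inner_le_norm ν (x - p)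
      rw [hν1, one_mul] at this; linarith
    have hT : 0 ≤ slopeT c k := by unfold slopeT; positivity
    obtain ⟨b0, b1, b2, b3, b4⟩ := cubeCut_bounds hh hx
    have hBR := S.hBR
    have hip' := abs_le.1 hip
    have e1 : (6 * c + 2) * ⟪ν, x - p⟫ ≤ 1 / 4 := by
      refine le_trans ?_ hBR
      gcongr; exact hip'.2
    have e2 : ‖x - p‖ ^ 2 * (0 + (6 * c + 2) * 0) + (1 + (6 * c + 2) * ⟪ν, x - p⟫) * (2 * n) +
        2 * ⟪(2 : ℝ) • (x - p), 0 + (6 * c + 2) • ν⟫ ≤ 5 / 2 * n + 1 := by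
      rw [zero_add ((6 * c + 2) • ν), inner_smul_left, inner_smul_right,
        real_inner_comm ν (x - p)]
      simp only [conj_trivial]
      have : (0 : ℝ) ≤ n := Nat.cast_nonneg n
      have h5 := mul_le_mul_of_nonneg_right e1 this
      linarith
    have hg : ‖gradient G x‖ ^ 2 ≤ (1 + c) ^ 2 := by
      gcongr; exact S.hG.le x
    have e3 : cubeCut'' h (G x) * ‖gradient G x‖ ^ 2 + cubeCut' h (G x) * lG ≤
        8 * (1 + c) ^ 2 / h + n * c := by
      have f1 : cubeCut'' h (G x) * ‖gradient G x‖ ^ 2 ≤ 8 / h * (1 + c) ^ 2 := by gcongr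
      have f2 : cubeCut' h (G x) * lG ≤ 1 * (n * c) := by
        have : (0 : ℝ) ≤ n * c := by positivity
        calc cubeCut' h (G x) * lG ≤ cubeCut' h (G x) * (n * c) := by
              gcongr; exact (le_abs_self _).trans hlG'
          _ ≤ 1 * (n * c) := by gcongr
      have : 8 * (1 + c) ^ 2 / h = 8 / h * (1 + c) ^ 2 := by ring
      linarith
    gcongr

/-- Lower bound for the normal derivative of the doubled penalization at a boundary maximum. -/
theorem inner_gradient_ge_of_max (S : ThinSetting c k R h F G u p) {w : E n → ℝ} {N : E n}
    (hw : DifferentiableAt ℝ w x) (hxy : x ≠ y) (hG : G x ≤ 0) (hx : ‖x - p‖ ≤ R)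
    (hm : ∀ᶠ t in nhdsWithin (0 : ℝ) (Ioi 0),
      w (x - t • N) - doubled c k R h ρ F G p (x - t • N) y ≤
        w x - doubled c k R h ρ F G p x y) :
    16 / ρ * (1 - ‖x - y‖ / ρ) * (⟪N, x - y⟫ / ‖x - y‖) *
        (1 + (6 * c + 2) * (⟪unitGrad F p, x - p⟫ + ⟪unitGrad F p, y - p⟫)) +
      modulus ρ ‖x - y‖ * ((6 * c + 2) * ⟪unitGrad F p, N⟫) +
      ⟪penaltyGrad c k R h F G p x, N⟫ ≤ ⟪gradient w x, N⟫ := by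
  obtain ⟨l, hl, -⟩ := S.hasLap_penalty x hG hx
  set ν := unitGrad F p with hν
  have hr : 0 < ‖x - y‖ := norm_pos_iff.2 (sub_ne_zero.2 hxy)
  have hline : HasDerivAt (fun t : ℝ => x - t • N) (-N) 0 := by
    simpa using ((hasDerivAt_id (0 : ℝ)).smul_const N).const_sub x
  have hx0 : x - (0 : ℝ) • N = x := by simp
  have d1 : HasDerivAt (fun t : ℝ => w (x - t • N)) (-⟪gradient w x, N⟫) 0 := by
    have h1 : HasFDerivAt w (fderiv ℝ w x) (x - (0 : ℝ) • N) := by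
      rw [hx0]; exact hw.hasFDerivAt
    refine (h1.comp_hasDerivAt 0 hline).congr_deriv ?_
    rw [map_neg, hw.hasGradientAt.fderiv_apply]
  have d2 : HasDerivAt (fun t : ℝ => penalty c k R h F G p (x - t • N))
      (-⟪penaltyGrad c k R h F G p x, N⟫) 0 := by
    have h1 : HasFDerivAt (penalty c k R h F G p) (fderiv ℝ (penalty c k R h F G p) x)
        (x - (0 : ℝ) • N) := by
      rw [hx0]; exact (hl.1.differentiableAt (by simp)).hasFDerivAt
    refine (h1.comp_hasDerivAt 0 hline).congr_deriv ?_
    rw [map_neg, hl.fderiv_apply]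
  have d3 : HasDerivAt (fun t : ℝ => ‖x - t • N - y‖) (-(⟪N, x - y⟫ / ‖x - y‖)) 0 := by
    have h1 := ((hline.sub_const y).norm_sq).sqrt (by
      simp only [hx0]; positivity)
    simp only [hx0, Real.sqrt_sq hr.le, Real.sqrt_sq (norm_nonneg _)] at h1
    refine h1.congr_deriv ?_
    rw [inner_neg_right, real_inner_comm]
    field_simp
  have d4 : HasDerivAt (fun t : ℝ => modulus ρ ‖x - t • N - y‖)
      (16 / ρ * (1 - ‖x - y‖ / ρ) * (-(⟪N, x - y⟫ / ‖x - y‖))) 0 := by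
    have h1 : HasDerivAt (modulus ρ) (16 / ρ * (1 - ‖x - y‖ / ρ)) ‖x - (0 : ℝ) • N - y‖ := by
      rw [hx0]; exact hasDerivAt_modulus _ _
    exact HasDerivAt.comp (h₂ := modulus ρ) (h := fun t : ℝ => ‖x - t • N - y‖) (0 : ℝ) h1 d3
  have d5 : HasDerivAt (fun t : ℝ => 1 + (6 * c + 2) * (⟪ν, x - t • N - p⟫ + ⟪ν, y - p⟫))
      ((6 * c + 2) * (-⟪ν, N⟫)) 0 := by
    have h1 : HasDerivAt (fun t : ℝ => ⟪ν, x - t • N - p⟫) (-⟪ν, N⟫) 0 := by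
      have := (hasDerivAt_const (0 : ℝ) ν).inner ℝ (hline.sub_const p)
      simpa using this
    exact ((h1.add_const _).const_mul _).const_add 1
  have d := d1.sub (((d4.mul d5).add d2).add_const (penalty c k R h F G p y))
  have := deriv_nonpos_of_right_max d ?_
  · simp only [hx0] at this
    linarith
  · filter_upwards [hm] with t ht
    simp only [doubled, Pi.sub_apply, Pi.add_apply, Pi.mul_apply, hx0] at ht ⊢
    exact ht

end ThinSetting

theorem modulus_nonneg {ρ r : ℝ} (hρ : 0 < ρ) (hr : 0 ≤ r) (hr' : r ≤ ρ) : 0 ≤ modulus ρ r := by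
  have h1 : 0 ≤ r / ρ := by positivity
  have h2 : r / ρ ≤ 1 := by rw [div_le_one hρ]; exact hr'
  unfold modulus; nlinarith

theorem modulus_le (ρ r : ℝ) : modulus ρ r ≤ 8 := by
  unfold modulus; nlinarith [sq_nonneg (r / ρ - 1)]

theorem modulus_term_ge {ρ r c A q : ℝ} (hr : 0 < r) (hr' : r < ρ) (hc : 0 ≤ c)
    (hA0 : 0 ≤ A) (hA : A ≤ 3 / 2) (hq : -(c * r ^ 2) ≤ q) :
    -(3 / 2 * c * modulus ρ r) ≤ 16 / ρ * (1 - r / ρ) * (q / r) * A := by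
  have hρ : 0 < ρ := hr.trans hr'
  have h1 : 0 < r / ρ := by positivity
  have h2 : r / ρ ≤ 1 := by rw [div_le_one hρ]; exact hr'.le
  have h3 : -(c * r) ≤ q / r := by
    rw [le_div_iff₀ hr]; linarith [hq, (by ring : -(c * r) * r = -(c * r ^ 2))]
  have h4 : 0 ≤ 16 / ρ * (1 - r / ρ) * A := by
    have : 0 ≤ 1 - r / ρ := by linarith
    positivity
  have h5 := mul_le_mul_of_nonneg_left h3 h4
  have h6 : 16 / ρ * (1 - r / ρ) * A * -(c * r) = -(c * (16 * (r / ρ) * (1 - r / ρ)) * A) := by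
    ring
  have h7 : 16 * (r / ρ) * (1 - r / ρ) ≤ modulus ρ r := by
    unfold modulus; nlinarith [sq_nonneg (r / ρ)]
  have h8 : 0 ≤ modulus ρ r := modulus_nonneg hρ hr.le hr'.le
  have h9 : c * (16 * (r / ρ) * (1 - r / ρ)) * A ≤ c * modulus ρ r * (3 / 2) := by
    gcongr
  linarith

/-- A function with negative derivative is negative to the right. -/
theorem eventually_nonpos_of_deriv_neg {φ : ℝ → ℝ} {d : ℝ} (h : HasDerivAt φ d 0) (hd : d < 0)
    (h0 : φ 0 = 0) : ∀ᶠ t in nhdsWithin (0 : ℝ) (Ioi 0), φ t ≤ 0 := by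
  have ht := (hasDerivAt_iff_tendsto_slope.1 h).mono_left
    (nhdsWithin_mono 0 (fun t (ht : t ∈ Ioi (0 : ℝ)) => ne_of_gt ht))
  filter_upwards [ht.eventually (gt_mem_nhds hd), self_mem_nhdsWithin] with t h1 h2
  have h2' : 0 < t := h2
  rw [slope_def_field, h0, sub_zero, sub_zero, div_lt_iff₀ h2'] at h1
  linarith

theorem boundary_num_F {c k R d m s a q N : ℝ} (hc : 0 < c) (hk : 0 < k) (hR : 0 < R)
    (hkc : k * c ^ 2 * R ^ 2 ≤ 6) (hm0 : 0 < m) (hcd : c * d ≤ 1 / 24) (hd0 : 0 ≤ d)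
    (hN1 : 1 ≤ N) (hNs : N - s ≤ c ^ 2 * d ^ 2 / 2) (ha : |a| ≤ 1 / 4)
    (hq : -(c * d ^ 2) ≤ q)
    (key : -(3 / 2 * c * m) + m * ((6 * c + 2) * s) +
      6 / R ^ 2 * (d ^ 2 * ((6 * c + 2) * s) + (1 + a) * (2 * q)) ≤ 2 * k * (N - s)) : False := by
  have hw := abs_le.1 ha
  have hs2 : 1 / 2 ≤ s := by
    have h0 : 0 ≤ c * d := by positivity
    have : (c * d) ^ 2 ≤ 1 := pow_le_one₀ h0 (by linarith)
    rw [mul_pow] at this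
    linarith
  have e1 : 3 * c + 1 ≤ (6 * c + 2) * s := by
    have := mul_le_mul_of_nonneg_left hs2 (by positivity : 0 ≤ 6 * c + 2)
    linarith
  have h1 : 0 < m * ((6 * c + 2) * s - 3 / 2 * c) := mul_pos hm0 (by linarith)
  have hcd2 : 0 ≤ c * d ^ 2 := by positivity
  have h2 : d ^ 2 ≤ d ^ 2 * ((6 * c + 2) * s) + (1 + a) * (2 * q) := by
    have e2 : d ^ 2 * (3 * c + 1) ≤ d ^ 2 * ((6 * c + 2) * s) := by gcongr
    have e3 : (1 + a) * (2 * -(c * d ^ 2)) ≤ (1 + a) * (2 * q) := by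
      have : 0 ≤ 1 + a := by linarith
      gcongr
    have e4 : a * (c * d ^ 2) ≤ 1 / 4 * (c * d ^ 2) := by gcongr; exact hw.2
    linarith
  have h3 : 6 / R ^ 2 * d ^ 2 ≤
      6 / R ^ 2 * (d ^ 2 * ((6 * c + 2) * s) + (1 + a) * (2 * q)) := by gcongr
  have h4 : k * c ^ 2 ≤ 6 / R ^ 2 := by
    rw [le_div_iff₀ (by positivity)]; exact hkc
  have h5 : k * c ^ 2 * d ^ 2 ≤ 6 / R ^ 2 * d ^ 2 := by gcongr
  have h6 : 2 * k * (N - s) ≤ 2 * k * (c ^ 2 * d ^ 2 / 2) := by gcongr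
  linarith

theorem boundary_num_G {c k R d m s a q N : ℝ} (hc : 0 < c) (hk : 0 < k) (hR : 0 < R)
    (hm0 : 0 ≤ m) (hm8 : m ≤ 8) (hd0 : 0 ≤ d) (hdR : d ≤ R)
    (hN1 : 1 ≤ N) (hN2 : N ≤ 1 + c) (hs : |s| ≤ 1 + c) (ha : |a| ≤ 1 / 4)
    (hq : -(c * d ^ 2) ≤ q)
    (key : -(3 / 2 * c * m) + m * ((6 * c + 2) * s) +
      (6 / R ^ 2 * (d ^ 2 * ((6 * c + 2) * s) + (1 + a) * (2 * q)) +
        (4 * k * (1 + c) + 27 * c + 15 * (6 * c + 2) * (1 + c)) * N ^ 2) ≤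
      2 * k * (N - s)) : False := by
  have hw := abs_le.1 ha
  have hs2 := abs_le.1 hs
  obtain ⟨X, hX⟩ : ∃ X, X = (6 * c + 2) * (1 + c) := ⟨_, rfl⟩
  have hX0 : 0 < X := by rw [hX]; positivity
  obtain ⟨Y, hY⟩ : ∃ Y, Y = (6 * c + 2) * s := ⟨_, rfl⟩
  have e1 : -X ≤ Y := by
    have := mul_le_mul_of_nonneg_left hs2.1 (by positivity : 0 ≤ 6 * c + 2)
    rw [hX, hY]; linarith
  rw [mul_assoc 15, ← hX, ← hY] at key
  have h1 : -(8 * X) ≤ m * Y := by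
    have := mul_le_mul_of_nonneg_left e1 hm0
    have := mul_le_mul_of_nonneg_right hm8 hX0.le
    linarith
  have h1' : 3 / 2 * c * m ≤ 3 / 2 * c * 8 := by gcongr
  have hcd2 : 0 ≤ c * d ^ 2 := by positivity
  have hdR : d ^ 2 ≤ R ^ 2 := by gcongr
  have h2 : -(R ^ 2 * (X + 5 / 2 * c)) ≤ d ^ 2 * Y + (1 + a) * (2 * q) := by
    have e2 : d ^ 2 * -X ≤ d ^ 2 * Y := by gcongr
    have e3 : (1 + a) * (2 * -(c * d ^ 2)) ≤ (1 + a) * (2 * q) := by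
      have : 0 ≤ 1 + a := by linarith
      gcongr
    have e4 : a * (c * d ^ 2) ≤ 1 / 4 * (c * d ^ 2) := by gcongr; exact hw.2
    have e5 : d ^ 2 * (X + 5 / 2 * c) ≤ R ^ 2 * (X + 5 / 2 * c) := by gcongr
    linarith
  have h3 : 6 / R ^ 2 * -(R ^ 2 * (X + 5 / 2 * c)) ≤
      6 / R ^ 2 * (d ^ 2 * Y + (1 + a) * (2 * q)) := by gcongr
  have h3' : 6 / R ^ 2 * -(R ^ 2 * (X + 5 / 2 * c)) = - (6 * X + 15 * c) := by
    field_simp; ring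
  have hT : 0 ≤ 4 * k * (1 + c) + 27 * c + 15 * X := by positivity
  have h4 : (4 * k * (1 + c) + 27 * c + 15 * X) * 1 ≤
      (4 * k * (1 + c) + 27 * c + 15 * X) * N ^ 2 := by
    have : 1 ≤ N ^ 2 := one_le_pow₀ hN1
    gcongr
  have h5 : 2 * k * (N - s) ≤ 2 * k * (2 * (1 + c)) := by
    gcongr; linarith
  linarith

namespace ThinSetting

variable {n : ℕ} {c k R h ρ : ℝ} {F G u : E n → ℝ} {p x y : E n}

theorem abs_inner_unitGrad_le (S : ThinSetting c k R h F G u p) (hx : ‖x - p‖ ≤ R) :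
    |⟪unitGrad F p, x - p⟫| ≤ R := by
  have := abs_real_inner_le_norm (unitGrad F p) (x - p)
  rw [S.norm_unitGrad, one_mul] at this; linarith

theorem abs_weight_le (S : ThinSetting c k R h F G u p) (hx : ‖x - p‖ ≤ R) :
    |(6 * c + 2) * ⟪unitGrad F p, x - p⟫| ≤ 1 / 4 := by
  have hc := S.hc
  rw [abs_mul, abs_of_pos (by positivity)]
  exact le_trans (mul_le_mul_of_nonneg_left (S.abs_inner_unitGrad_le hx) (by positivity)) S.hBR

theorem exp_le (S : ThinSetting c k R h F G u p) (hx : ‖x - p‖ ≤ R) :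
    Real.exp (k * ⟪unitGrad F p, x - p⟫) ≤ 2 := by
  have h1 : k * ⟪unitGrad F p, x - p⟫ ≤ 1 / 2 := by
    refine le_trans ?_ S.hkR
    have := S.hk
    gcongr; exact (le_abs_self _).trans (S.abs_inner_unitGrad_le hx)
  refine (Real.exp_le_exp.2 h1).trans ?_
  have h2 : Real.exp (1 / 2) ^ 2 = Real.exp 1 := by rw [← Real.exp_nat_mul]; norm_num
  have h3 := Real.exp_one_lt_d9
  have h4 := Real.exp_pos (1 / 2)
  nlinarith

theorem abs_weighted_le (S : ThinSetting c k R h F G u p) (hF : F x ≤ 0) (hG : G x ≤ 0)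
    (hx : ‖x - p‖ ≤ R) : |weighted k F u p x| ≤ 2 := by
  rw [weighted, abs_mul, abs_of_pos (Real.exp_pos _)]
  have h1 := S.exp_le hx
  have h2 := S.bdd x hF hG hx
  nlinarith [abs_nonneg (u x), Real.exp_pos (k * ⟪unitGrad F p, x - p⟫)]

theorem hasGradientAt_weighted (S : ThinSetting c k R h F G u p) (hF : F x ≤ 0) (hG : G x ≤ 0)
    (hx : ‖x - p‖ ≤ R) : HasGradientAt (weighted k F u p)
      (Real.exp (k * ⟪unitGrad F p, x - p⟫) • (gradient u x + (k * u x) • unitGrad F p)) x := by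
  have h1 := (hasLap_exp k (unitGrad F p) p x).2.1.hasFDerivAt.mul
    (S.diff x hF hG hx).hasGradientAt.hasFDerivAt
  rw [hasGradientAt_iff_hasFDerivAt]
  refine h1.congr_fderiv ?_
  rw [smul_add, map_add, map_smul, map_smul, map_smul, map_smul, smul_smul, smul_smul]
  congr 2
  ring

theorem hasLap_weighted (S : ThinSetting c k R h F G u p) (hF : F x < 0) (hG : G x < 0)
    (hx : ‖x - p‖ ≤ R) : ∃ d, HasLap (weighted k F u p) x d
      (2 * k * ⟪d, unitGrad F p⟫ - k ^ 2 * weighted k F u p x) := by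
  obtain ⟨q1, q2⟩ := S.harm x hF hG hx
  refine ⟨_, ((hasLap_exp k (unitGrad F p) p x).mul (HasLap.of_elap q1 q2)).congr rfl ?_⟩
  simp only [weighted, inner_add_left, real_inner_smul_left, real_inner_self_eq_norm_sq,
    S.norm_unitGrad, real_inner_comm (gradient u x) (unitGrad F p)]
  ring

theorem eventually_mem_of_gradient {H H' : E n → ℝ}
    (hH : NiceDefining c H) (hH' : NiceDefining c H') (hx : H x = 0) (hx' : H' x < 0) :
    ∀ᶠ t in nhdsWithin (0 : ℝ) (Ioi 0),
      H (x - t • gradient H x) ≤ 0 ∧ H' (x - t • gradient H x) ≤ 0 := by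
  set N := gradient H x with hN
  have hline : HasDerivAt (fun t : ℝ => x - t • N) (-N) 0 := by
    simpa using ((hasDerivAt_id (0 : ℝ)).smul_const N).const_sub x
  have hx0 : x - (0 : ℝ) • N = x := by simp
  have d1 : HasDerivAt (fun t : ℝ => H (x - t • N)) (-⟪N, N⟫) 0 := by
    have h1 : HasFDerivAt H (fderiv ℝ H x) (x - (0 : ℝ) • N) := by
      rw [hx0]; exact (hH.differentiable x).hasFDerivAt
    refine (h1.comp_hasDerivAt 0 hline).congr_deriv ?_
    rw [map_neg, (hH.hasGradientAt x).fderiv_apply]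
  have hneg : -⟪N, N⟫ < 0 := by
    rw [real_inner_self_eq_norm_sq]
    have := hH.one_le x
    nlinarith
  refine (eventually_nonpos_of_deriv_neg d1 hneg (by simpa using hx)).and ?_
  have hcont : ContinuousAt (fun t : ℝ => H' (x - t • N)) 0 :=
    (hH'.differentiable.continuous.comp (by fun_prop : Continuous fun t : ℝ => x - t • N)).continuousAt
  have : ∀ᶠ t in nhds (0 : ℝ), H' (x - t • N) < 0 := by
    refine hcont.eventually (gt_mem_nhds ?_)
    simpa using hx'
  exact (this.filter_mono nhdsWithin_le_nhds).mono fun t ht => ht.le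

theorem normal_max (S : ThinSetting c k R h F G u p) {H H' : E n → ℝ}
    (hH : NiceDefining c H) (hH' : NiceDefining c H') (hHx : H x = 0) (hHx' : H' x < 0)
    (hFx : F x ≤ 0) (hGx : G x ≤ 0) (hx : ‖x - p‖ ≤ R) (hy : ‖y - p‖ ≤ R)
    (hHy : H y ≤ 0) (hxy : x ≠ y) (hr : ‖x - y‖ < ρ)
    (hb : ⟪gradient u x, gradient H x⟫ = - (k * (‖gradient H x‖ * u x)))
    (hm : ∀ᶠ z in nhds x, H z ≤ 0 → H' z ≤ 0 →
      weighted k F u p z - doubled c k R h ρ F G p z y ≤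
        weighted k F u p x - doubled c k R h ρ F G p x y) :
    -(3 / 2 * c * modulus ρ ‖x - y‖) +
      modulus ρ ‖x - y‖ * ((6 * c + 2) * ⟪unitGrad F p, gradient H x⟫) +
      ⟪penaltyGrad c k R h F G p x, gradient H x⟫ ≤
    2 * k * (‖gradient H x‖ - ⟪unitGrad F p, gradient H x⟫) := by
  have hr0 : 0 < ‖x - y‖ := norm_pos_iff.2 (sub_ne_zero.2 hxy)
  have hgw := S.hasGradientAt_weighted hFx hGx hx
  have hev : ∀ᶠ t in nhdsWithin (0 : ℝ) (Ioi 0),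
      weighted k F u p (x - t • gradient H x) -
        doubled c k R h ρ F G p (x - t • gradient H x) y ≤
        weighted k F u p x - doubled c k R h ρ F G p x y := by
    have ht : Filter.Tendsto (fun t : ℝ => x - t • gradient H x) (nhdsWithin 0 (Ioi 0))
        (nhds x) := by
      have : Continuous fun t : ℝ => x - t • gradient H x := by fun_prop
      have := this.tendsto 0
      simp only [zero_smul, sub_zero] at this
      exact this.mono_left nhdsWithin_le_nhds
    filter_upwards [ht.eventually hm, eventually_mem_of_gradient hH hH' hHx hHx'] with t h1 h2
    exact h1 h2.1 h2.2
  have key := S.inner_gradient_ge_of_max hgw.differentiableAt hxy hGx hx hev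
  have hT := hH.taylor S.hc.le x y
  have hq : -(c * ‖x - y‖ ^ 2) ≤ ⟪gradient H x, x - y⟫ := by
    have := (abs_le.1 hT).2
    have e : ⟪gradient H x, y - x⟫ = - ⟪gradient H x, x - y⟫ := by
      rw [← inner_neg_right, neg_sub]
    rw [← neg_le, ]
    have h1 := (abs_le.1 hT).1
    rw [norm_sub_rev y x, hHx, e] at h1
    linarith
  have hwx := abs_le.1 (S.abs_weight_le hx)
  have hwy := abs_le.1 (S.abs_weight_le hy)
  have hm1 := modulus_term_ge hr0 hr S.hc.le
    (A := 1 + (6 * c + 2) * (⟪unitGrad F p, x - p⟫ + ⟪unitGrad F p, y - p⟫))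
    (by linarith) (by linarith) hq
  refine le_trans (by linarith) (key.trans ?_)
  rw [hgw.gradient, real_inner_smul_left, inner_add_left, real_inner_smul_left, hb]
  have hE := S.exp_le hx
  have hE0 := Real.exp_pos (k * ⟪unitGrad F p, x - p⟫)
  have hu := S.bdd x hFx hGx hx
  have hk := S.hk
  set D := ‖gradient H x‖ - ⟪unitGrad F p, gradient H x⟫ with hD
  have hD0 : 0 ≤ D := by
    have := real_inner_le_norm (unitGrad F p) (gradient H x)
    rw [S.norm_unitGrad, one_mul] at this
    linarith
  have e : Real.exp (k * ⟪unitGrad F p, x - p⟫) * (-(k * (‖gradient H x‖ * u x)) +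
      k * u x * ⟪unitGrad F p, gradient H x⟫) =
      k * D * (Real.exp (k * ⟪unitGrad F p, x - p⟫) * (- u x)) := by rw [hD]; ring
  rw [e]
  have h2 : Real.exp (k * ⟪unitGrad F p, x - p⟫) * (- u x) ≤ 2 * 1 := by
    have : - u x ≤ 1 := (neg_le_abs _).trans hu
    nlinarith
  have := mul_le_mul_of_nonneg_left h2 (mul_nonneg hk.le hD0)
  linarith

theorem inner_ge (S : ThinSetting c k R h F G u p) {H : E n → ℝ} (hH : NiceDefining c H)
    (hHx : H x = 0) (hHp : H p ≤ 0) : -(c * ‖x - p‖ ^ 2) ≤ ⟪x - p, gradient H x⟫ := by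
  have h1 := (abs_le.1 (hH.taylor S.hc.le x p)).1
  have e : ⟪gradient H x, p - x⟫ = - ⟪x - p, gradient H x⟫ := by
    rw [← real_inner_comm, ← inner_neg_left, neg_sub]
  rw [norm_sub_rev p x, hHx, e] at h1
  linarith

theorem inner_penaltyGrad (N : E n) : ⟪penaltyGrad c k R h F G p x, N⟫ =
    6 / R ^ 2 * (‖x - p‖ ^ 2 * ((6 * c + 2) * ⟪unitGrad F p, N⟫) +
      (1 + (6 * c + 2) * ⟪unitGrad F p, x - p⟫) * (2 * ⟪x - p, N⟫)) +
    slopeT c k * (cubeCut' h (G x) * ⟪gradient G x, N⟫) := by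
  simp only [penaltyGrad, inner_add_left, real_inner_smul_left]

theorem not_max_F (S : ThinSetting c k R h F G u p) (hFx : F x = 0) (hGx : G x ≤ 0)
    (hx : ‖x - p‖ ≤ R) (hy : ‖y - p‖ ≤ R) (hFy : F y ≤ 0) (hxy : x ≠ y) (hr : ‖x - y‖ < ρ)
    (hm : ∀ᶠ z in nhds x, F z ≤ 0 → G z ≤ 0 →
      weighted k F u p z - doubled c k R h ρ F G p z y ≤
        weighted k F u p x - doubled c k R h ρ F G p x y) : False := by
  have hc := S.hc
  have hk := S.hk
  have hR := S.hR
  have hr0 : 0 < ‖x - y‖ := norm_pos_iff.2 (sub_ne_zero.2 hxy)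
  have hthin := S.thin x hFx.le hGx hx
  have hh := S.hh
  have key := S.normal_max S.hF S.hG hFx (by linarith) hFx.le hGx hx hy hFy hxy hr
    (S.bdF x hFx hGx hx) hm
  have hi := S.inner_ge S.hF hFx S.hFp.le
  rw [inner_penaltyGrad, (cubeCut_eq_zero (by linarith : G x ≤ -h / 4)).2, zero_mul, mul_zero,
    add_zero] at key
  set d := ‖x - p‖ with hd
  set N := gradient F x with hN
  set s := ⟪unitGrad F p, N⟫ with hs
  set m := modulus ρ ‖x - y‖ with hm'
  have hd0 : 0 ≤ d := norm_nonneg _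
  have hm0 : 0 < m := by
    have hρ : 0 < ρ := hr0.trans hr
    have h1 : 0 < ‖x - y‖ / ρ := by positivity
    have h2 : ‖x - y‖ / ρ < 1 := by rw [div_lt_one hρ]; exact hr
    rw [hm']; unfold modulus; nlinarith
  have hcd : c * d ≤ 1 / 24 := by
    have := S.hBR
    nlinarith
  -- the normal at `x` is close to the normal at `p`
  have hNs : ‖N‖ - s ≤ c ^ 2 * d ^ 2 / 2 := by
    have hP := S.hF.one_le p
    have h1 : ‖N - gradient F p‖ ^ 2 ≤ (c * d) ^ 2 := by
      gcongr; exact S.hF.lip x p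
    rw [norm_sub_sq_real] at h1
    have h2 : s * ‖gradient F p‖ = ⟪N, gradient F p⟫ := by
      rw [hs, unitGrad, real_inner_smul_left, real_inner_comm]
      field_simp
    have h3 : (‖N‖ - s) * ‖gradient F p‖ ≤ c ^ 2 * d ^ 2 / 2 := by
      nlinarith [sq_nonneg (‖N‖ - ‖gradient F p‖)]
    have h4 : 0 ≤ ‖N‖ - s := by
      have := real_inner_le_norm (unitGrad F p) N
      rw [S.norm_unitGrad, one_mul] at this
      linarith
    nlinarith
  exact boundary_num_F hc hk hR S.hkc hm0 hcd hd0 (S.hF.one_le x) hNs (S.abs_weight_le hx) hi key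

theorem not_max_G (S : ThinSetting c k R h F G u p) (hFx : F x ≤ 0) (hGx : G x = 0)
    (hx : ‖x - p‖ ≤ R) (hy : ‖y - p‖ ≤ R) (hGy : G y ≤ 0) (hxy : x ≠ y) (hr : ‖x - y‖ < ρ)
    (hm : ∀ᶠ z in nhds x, F z ≤ 0 → G z ≤ 0 →
      weighted k F u p z - doubled c k R h ρ F G p z y ≤
        weighted k F u p x - doubled c k R h ρ F G p x y) : False := by
  have hc := S.hc
  have hk := S.hk
  have hR := S.hR
  have hr0 : 0 < ‖x - y‖ := norm_pos_iff.2 (sub_ne_zero.2 hxy)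
  have hthin := S.thin x hFx hGx.le hx
  have hh := S.hh
  have hGp := S.hGp
  have key := S.normal_max S.hG S.hF hGx (by linarith) hFx hGx.le hx hy hGy hxy hr
    (S.bdG x hFx hGx hx) (hm.mono fun z hz h1 h2 => hz h2 h1)
  have hi := S.inner_ge S.hG hGx (by linarith)
  rw [inner_penaltyGrad, hGx, cubeCut'_zero hh, one_mul, real_inner_self_eq_norm_sq] at key
  have hs1 : |⟪unitGrad F p, gradient G x⟫| ≤ 1 + c := by
    have := abs_real_inner_le_norm (unitGrad F p) (gradient G x)
    rw [S.norm_unitGrad, one_mul] at this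
    exact this.trans (S.hG.le x)
  exact boundary_num_G hc hk hR (modulus_nonneg (hr0.trans hr) hr0.le hr.le) (modulus_le _ _)
    (norm_nonneg _) hx (S.hG.one_le x) (S.hG.le x) hs1 (S.abs_weight_le hx) hi key

theorem abs_inner_penaltyGrad_le (S : ThinSetting c k R h F G u p) (hGx : G x ≤ 0)
    (hx : ‖x - p‖ ≤ R) : |⟪penaltyGrad c k R h F G p x, unitGrad F p⟫| ≤
      17 / R + slopeT c k * (1 + c) := by
  have hc := S.hc
  have hk := S.hk
  have hR := S.hR
  have hT : 0 ≤ slopeT c k := by unfold slopeT; positivity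
  obtain ⟨b0, b1, b2, b3, b4⟩ := cubeCut_bounds S.hh hGx
  have hw := abs_le.1 (S.abs_weight_le hx)
  rw [inner_penaltyGrad, real_inner_self_eq_norm_sq, S.norm_unitGrad]
  have h1 : |cubeCut' h (G x) * ⟪gradient G x, unitGrad F p⟫| ≤ 1 + c := by
    have h2 := abs_real_inner_le_norm (gradient G x) (unitGrad F p)
    rw [S.norm_unitGrad, mul_one] at h2
    rw [abs_mul, abs_of_nonneg b1]
    have := S.hG.le x
    calc _ ≤ 1 * (1 + c) := by gcongr; linarith
      _ = 1 + c := one_mul _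
  have h2 : |⟪x - p, unitGrad F p⟫| ≤ R := by
    rw [real_inner_comm]; exact S.abs_inner_unitGrad_le hx
  have h3 : |‖x - p‖ ^ 2 * ((6 * c + 2) * 1 ^ 2) +
      (1 + (6 * c + 2) * ⟪unitGrad F p, x - p⟫) * (2 * ⟪x - p, unitGrad F p⟫)| ≤ 11 / 4 * R := by
    have e1 : ‖x - p‖ ^ 2 * ((6 * c + 2) * 1 ^ 2) ≤ R / 4 := by
      have : ‖x - p‖ ^ 2 ≤ R ^ 2 := by gcongr
      have h5 := S.hBR
      calc ‖x - p‖ ^ 2 * ((6 * c + 2) * 1 ^ 2) ≤ R ^ 2 * ((6 * c + 2) * 1 ^ 2) := by gcongr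
        _ = R * ((6 * c + 2) * R) := by ring
        _ ≤ R * (1 / 4) := by gcongr
        _ = R / 4 := by ring
    have e2 : |(1 + (6 * c + 2) * ⟪unitGrad F p, x - p⟫) * (2 * ⟪x - p, unitGrad F p⟫)| ≤
        5 / 4 * (2 * R) := by
      rw [abs_mul, abs_mul, abs_of_pos (by norm_num : (0 : ℝ) < 2)]
      gcongr
      rw [abs_le]; constructor <;> linarith
    refine (abs_add_le _ _).trans ?_
    rw [abs_of_nonneg (by positivity)]
    linarith
  refine (abs_add_le _ _).trans ?_
  rw [abs_mul, abs_mul, abs_of_nonneg hT, abs_of_pos (by positivity : 0 < 6 / R ^ 2)]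
  have h4 : 6 / R ^ 2 * (11 / 4 * R) ≤ 17 / R := by
    rw [show 6 / R ^ 2 * (11 / 4 * R) = (33 / 2) / R by field_simp; norm_num]
    gcongr; norm_num
  refine add_le_add (le_trans ?_ h4) ?_ <;> gcongr

theorem not_max_interior (S : ThinSetting c k R h F G u p) (hFx : F x < 0) (hGx : G x < 0)
    (hFy : F y < 0) (hGy : G y < 0) (hx : ‖x - p‖ ≤ R) (hy : ‖y - p‖ ≤ R) (hxy : x ≠ y)
    (hr : ‖x - y‖ < ρ)
    (hρ : 2 * (6 / R ^ 2 * (5 / 2 * n + 1) + slopeT c k * (8 * (1 + c) ^ 2 / h + n * c)) +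
      4 * k * (17 / R + slopeT c k * (1 + c)) + 4 * k ^ 2 < 32 / ρ ^ 2)
    (hm : IsLocalMax (fun z : E n × E n => weighted k F u p z.1 - weighted k F u p z.2 -
      doubled c k R h ρ F G p z.1 z.2) (x, y)) : False := by
  obtain ⟨dx, hdx⟩ := S.hasLap_weighted hFx hGx hx
  obtain ⟨dy, hdy⟩ := S.hasLap_weighted hFy hGy hy
  obtain ⟨lx, hlx, hlx'⟩ := S.hasLap_penalty x hGx.le hx
  obtain ⟨ly, hly, hly'⟩ := S.hasLap_penalty y hGy.le hy
  obtain ⟨h1, h2⟩ := two_point_max (hdx.sub hlx) (hdy.add hly) hxy (ν := unitGrad F p)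
    (B := 6 * c + 2) (p := p) (ρ := ρ) (by
      refine hm.congr (Filter.Eventually.of_forall fun z => ?_)
      simp only [doubled]; ring)
  rw [inner_sub_left, inner_add_left, S.norm_unitGrad, one_pow, mul_one] at h1
  have hc := S.hc
  have hk := S.hk
  have hr0 : 0 < ‖x - y‖ := norm_pos_iff.2 (sub_ne_zero.2 hxy)
  have hm0 : 0 ≤ modulus ρ ‖x - y‖ := modulus_nonneg (hr0.trans hr) hr0.le hr.le
  have g1 := (abs_le.1 (S.abs_inner_penaltyGrad_le hGx.le hx)).1
  have g2 := (abs_le.1 (S.abs_inner_penaltyGrad_le hGy.le hy)).1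
  have hwx := abs_le.1 (S.abs_weight_le hx)
  have hwy := abs_le.1 (S.abs_weight_le hy)
  have v1 := (abs_le.1 (S.abs_weighted_le hFx.le hGx.le hx)).2
  have v2 := (abs_le.1 (S.abs_weighted_le hFy.le hGy.le hy)).1
  have h3 : 32 / ρ ^ 2 ≤ 64 / ρ ^ 2 *
      (1 + (6 * c + 2) * (⟪unitGrad F p, x - p⟫ + ⟪unitGrad F p, y - p⟫)) := by
    calc 32 / ρ ^ 2 = 64 / ρ ^ 2 * (1 / 2) := by ring
      _ ≤ _ := by gcongr; linarith
  have h4 : 0 ≤ modulus ρ ‖x - y‖ * (2 * (6 * c + 2)) := by positivity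
  have h5 : -(2 * (17 / R + slopeT c k * (1 + c))) ≤ ⟪dx, unitGrad F p⟫ - ⟪dy, unitGrad F p⟫ := by
    linarith
  have h6 := mul_le_mul_of_nonneg_left h5 (by positivity : 0 ≤ 2 * k)
  have h7 : k ^ 2 * (weighted k F u p x - weighted k F u p y) ≤ k ^ 2 * 4 := by
    gcongr; linarith
  linarith

end ThinSetting

namespace ThinSetting

variable {n : ℕ} {c k R h ρ : ℝ} {F G u : E n → ℝ} {p x y : E n}

theorem doubled_comm (x y : E n) :
    doubled c k R h ρ F G p x y = doubled c k R h ρ F G p y x := by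
  simp only [doubled, norm_sub_rev x y]; ring

theorem penalty_ge (S : ThinSetting c k R h F G u p) (hGx : G x ≤ 0) (hx : ‖x - p‖ ≤ R) :
    6 / R ^ 2 * (‖x - p‖ ^ 2 * (3 / 4)) ≤ penalty c k R h F G p x := by
  have hc := S.hc
  have hk := S.hk
  have hR := S.hR
  have hT : 0 ≤ slopeT c k := by unfold slopeT; positivity
  have h1 := (cubeCut_bounds S.hh hGx).1
  have hw := abs_le.1 (S.abs_weight_le hx)
  have h2 : 0 ≤ slopeT c k * cubeCut h (G x) := by positivity
  have h3 : 6 / R ^ 2 * (‖x - p‖ ^ 2 * (3 / 4)) ≤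
      6 / R ^ 2 * (‖x - p‖ ^ 2 * (1 + (6 * c + 2) * ⟪unitGrad F p, x - p⟫)) := by
    gcongr; linarith
  unfold penalty
  linarith

theorem continuousAt_doubled (S : ThinSetting c k R h F G u p) (z : E n × E n) :
    ContinuousAt (fun z : E n × E n => doubled c k R h ρ F G p z.1 z.2) z := by
  have hG : Continuous G := S.hG.differentiable.continuous
  unfold doubled penalty modulus cubeCut
  fun_prop

theorem weighted_sub_le (S : ThinSetting c k R h F G u p) (hρ0 : 0 < ρ)
    (hρ : 2 * (6 / R ^ 2 * (5 / 2 * n + 1) + slopeT c k * (8 * (1 + c) ^ 2 / h + n * c)) +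
      4 * k * (17 / R + slopeT c k * (1 + c)) + 4 * k ^ 2 < 32 / ρ ^ 2)
    (hFx : F x ≤ 0) (hGx : G x ≤ 0) (hx : ‖x - p‖ ≤ R) (hFy : F y ≤ 0) (hGy : G y ≤ 0)
    (hy : ‖y - p‖ ≤ R) (hxy : ‖x - y‖ ≤ ρ) :
    weighted k F u p x - weighted k F u p y ≤ doubled c k R h ρ F G p x y := by
  have hR := S.hR
  have hFc : Continuous F := S.hF.differentiable.continuous
  have hGc : Continuous G := S.hG.differentiable.continuous
  set T : Set (E n) := {x | F x ≤ 0 ∧ G x ≤ 0 ∧ ‖x - p‖ ≤ R} with hT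
  have hTc : IsClosed T := by
    refine (isClosed_le hFc continuous_const).inter
      ((isClosed_le hGc continuous_const).inter
        (isClosed_le (by fun_prop : Continuous fun x : E n => ‖x - p‖) continuous_const))
  have hTk : IsCompact T := by
    refine (isCompact_closedBall p R).of_isClosed_subset hTc fun z hz => ?_
    rw [mem_closedBall, dist_eq_norm]; exact hz.2.2
  set K : Set (E n × E n) := (T ×ˢ T) ∩ {z | ‖z.1 - z.2‖ ≤ ρ} with hK
  have hKc : IsCompact K :=
    (hTk.prod hTk).inter_right
      (isClosed_le (by fun_prop : Continuous fun z : E n × E n => ‖z.1 - z.2‖) continuous_const)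
  set Φ : E n × E n → ℝ := fun z => weighted k F u p z.1 - weighted k F u p z.2 -
    doubled c k R h ρ F G p z.1 z.2 with hΦ
  have hwc : ∀ z ∈ T, ContinuousAt (weighted k F u p) z := fun z hz =>
    (S.hasGradientAt_weighted hz.1 hz.2.1 hz.2.2).differentiableAt.continuousAt
  have hΦc : ContinuousOn Φ K := by
    intro z hz
    refine ContinuousAt.continuousWithinAt ?_
    exact ((hwc _ hz.1.1).comp continuousAt_fst |>.sub
      ((hwc _ hz.1.2).comp continuousAt_snd)).sub (S.continuousAt_doubled z)
  obtain ⟨⟨a, b⟩, hab, hmax⟩ := hKc.exists_isMaxOn ⟨(x, y), ⟨⟨hFx, hGx, hx⟩, hFy, hGy, hy⟩, hxy⟩ hΦc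
  have hle : Φ (x, y) ≤ Φ (a, b) := hmax ⟨⟨⟨hFx, hGx, hx⟩, hFy, hGy, hy⟩, hxy⟩
  suffices Φ (a, b) ≤ 0 by
    have : Φ (x, y) ≤ 0 := hle.trans this
    simp only [hΦ] at this
    linarith
  by_contra! hpos
  obtain ⟨⟨⟨hFa, hGa, ha⟩, hFb, hGb, hb⟩, habρ⟩ := hab
  simp only at hFa hGa ha hFb hGb hb
  replace habρ : ‖a - b‖ ≤ ρ := habρ
  have qa := S.penalty_ge hGa ha
  have qb := S.penalty_ge hGb hb
  have qa0 : 0 ≤ 6 / R ^ 2 * (‖a - p‖ ^ 2 * (3 / 4)) := by positivity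
  have qb0 : 0 ≤ 6 / R ^ 2 * (‖b - p‖ ^ 2 * (3 / 4)) := by positivity
  have wa := abs_le.1 (S.abs_weighted_le hFa hGa ha)
  have wb := abs_le.1 (S.abs_weighted_le hFb hGb hb)
  have ta := abs_le.1 (S.abs_weight_le ha)
  have tb := abs_le.1 (S.abs_weight_le hb)
  have hm0 : 0 ≤ modulus ρ ‖a - b‖ := modulus_nonneg hρ0 (norm_nonneg _) habρ
  have hA : 1 / 2 ≤ 1 + (6 * c + 2) * (⟪unitGrad F p, a - p⟫ + ⟪unitGrad F p, b - p⟫) := by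
    linarith
  simp only [hΦ, doubled] at hpos
  have hmA : modulus ρ ‖a - b‖ * (1 / 2) ≤ modulus ρ ‖a - b‖ *
      (1 + (6 * c + 2) * (⟪unitGrad F p, a - p⟫ + ⟪unitGrad F p, b - p⟫)) := by gcongr
  have hne : a ≠ b := by
    rintro rfl
    linarith
  have hr : ‖a - b‖ < ρ := by
    refine lt_of_le_of_ne habρ fun he => ?_
    have : modulus ρ ‖a - b‖ = 8 := by
      rw [he]; unfold modulus; rw [div_self hρ0.ne']; norm_num
    rw [this] at hmA hpos
    linarith
  have hR2 : 6 / R ^ 2 * (R ^ 2 * (3 / 4)) = 9 / 2 := by field_simp; norm_num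
  have ha' : ‖a - p‖ < R := by
    refine lt_of_le_of_ne ha fun he => ?_
    rw [he, hR2] at qa
    linarith
  have hb' : ‖b - p‖ < R := by
    refine lt_of_le_of_ne hb fun he => ?_
    rw [he, hR2] at qb
    linarith
  -- local maximality
  have hev : ∀ᶠ z in nhds (a, b), F z.1 ≤ 0 → G z.1 ≤ 0 → F z.2 ≤ 0 → G z.2 ≤ 0 →
      Φ z ≤ Φ (a, b) := by
    have e1 : ∀ᶠ z : E n × E n in nhds (a, b), ‖z.1 - p‖ < R :=
      (by fun_prop : ContinuousAt (fun z : E n × E n => ‖z.1 - p‖) (a, b)).eventually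
        (gt_mem_nhds ha')
    have e2 : ∀ᶠ z : E n × E n in nhds (a, b), ‖z.2 - p‖ < R :=
      (by fun_prop : ContinuousAt (fun z : E n × E n => ‖z.2 - p‖) (a, b)).eventually
        (gt_mem_nhds hb')
    have e3 : ∀ᶠ z : E n × E n in nhds (a, b), ‖z.1 - z.2‖ < ρ :=
      (by fun_prop : ContinuousAt (fun z : E n × E n => ‖z.1 - z.2‖) (a, b)).eventually
        (gt_mem_nhds hr)
    filter_upwards [e1, e2, e3] with z h1 h2 h3 f1 g1 f2 g2
    exact hmax ⟨⟨⟨f1, g1, h1.le⟩, f2, g2, h2.le⟩, h3.le⟩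
  have hev1 : ∀ᶠ z in nhds a, F z ≤ 0 → G z ≤ 0 →
      weighted k F u p z - doubled c k R h ρ F G p z b ≤
        weighted k F u p a - doubled c k R h ρ F G p a b := by
    have ht : Filter.Tendsto (fun z : E n => (z, b)) (nhds a) (nhds (a, b)) :=
      (by fun_prop : Continuous fun z : E n => (z, b)).tendsto a
    filter_upwards [ht.eventually hev] with z hz f1 g1
    have := hz f1 g1 hFb hGb
    simp only [hΦ] at this
    linarith
  have hev2 : ∀ᶠ z in nhds b, F z ≤ 0 → G z ≤ 0 →
      weighted k F (fun x => - u x) p z - doubled c k R h ρ F G p z a ≤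
        weighted k F (fun x => - u x) p b - doubled c k R h ρ F G p b a := by
    have ht : Filter.Tendsto (fun z : E n => (a, z)) (nhds b) (nhds (a, b)) :=
      (by fun_prop : Continuous fun z : E n => (a, z)).tendsto b
    filter_upwards [ht.eventually hev] with z hz f1 g1
    have := hz hFa hGa f1 g1
    simp only [hΦ] at this
    rw [doubled_comm z a, doubled_comm b a]
    simp only [weighted, mul_neg] at this ⊢
    linarith
  have hr' : ‖b - a‖ < ρ := by rw [norm_sub_rev]; exact hr
  rcases hFa.lt_or_eq with hFa' | hFa'
  swap; · exact S.not_max_F hFa' hGa ha hb hFb hne hr hev1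
  rcases hGa.lt_or_eq with hGa' | hGa'
  swap; · exact S.not_max_G hFa hGa' ha hb hGb hne hr hev1
  rcases hFb.lt_or_eq with hFb' | hFb'
  swap; · exact S.neg.not_max_F hFb' hGb hb ha hFa hne.symm hr' hev2
  rcases hGb.lt_or_eq with hGb' | hGb'
  swap; · exact S.neg.not_max_G hFb hGb' hb ha hGa hne.symm hr' hev2
  refine S.not_max_interior hFa' hGa' hFb' hGb' ha hb hne hr hρ ?_
  have e1 : ∀ᶠ z : E n × E n in nhds (a, b), F z.1 < 0 :=
    (by fun_prop : ContinuousAt (fun z : E n × E n => F z.1) (a, b)).eventually (gt_mem_nhds hFa')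
  have e2 : ∀ᶠ z : E n × E n in nhds (a, b), G z.1 < 0 :=
    (by fun_prop : ContinuousAt (fun z : E n × E n => G z.1) (a, b)).eventually (gt_mem_nhds hGa')
  have e3 : ∀ᶠ z : E n × E n in nhds (a, b), F z.2 < 0 :=
    (by fun_prop : ContinuousAt (fun z : E n × E n => F z.2) (a, b)).eventually (gt_mem_nhds hFb')
  have e4 : ∀ᶠ z : E n × E n in nhds (a, b), G z.2 < 0 :=
    (by fun_prop : ContinuousAt (fun z : E n × E n => G z.2) (a, b)).eventually (gt_mem_nhds hGb')
  unfold IsLocalMax IsMaxFilter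
  filter_upwards [hev, e1, e2, e3, e4] with z hz h1 h2 h3 h4
  exact hz h1.le h2.le h3.le h4.le

theorem norm_gradient_le (S : ThinSetting c k R h F G u p) (hρ0 : 0 < ρ)
    (hρ : 2 * (6 / R ^ 2 * (5 / 2 * n + 1) + slopeT c k * (8 * (1 + c) ^ 2 / h + n * c)) +
      4 * k * (17 / R + slopeT c k * (1 + c)) + 4 * k ^ 2 < 32 / ρ ^ 2) :
    ‖gradient u p‖ ≤ 32 / ρ + k := by
  have hR := S.hR
  have hh := S.hh
  have hk := S.hk
  have hc := S.hc
  have hFp := S.hFp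
  have hGp := S.hGp
  have hFc : Continuous F := S.hF.differentiable.continuous
  have hGc : Continuous G := S.hG.differentiable.continuous
  have hpp : ‖p - p‖ ≤ R := by simpa using hR.le
  have hgp := S.hasGradientAt_weighted (x := p) hFp.le (by linarith) hpp
  simp only [sub_self, inner_zero_right, mul_zero, Real.exp_zero, one_smul] at hgp
  have hpen : penalty c k R h F G p p = 0 := by
    simp [penalty, (cubeCut_eq_zero (by linarith : G p ≤ -h / 4)).1]
  have hlip : ∀ᶠ x in nhds p, ‖weighted k F u p x - weighted k F u p p‖ ≤ 32 / ρ * ‖x - p‖ := by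
    have e1 : ∀ᶠ x in nhds p, F x < 0 := hFc.continuousAt.eventually (gt_mem_nhds hFp)
    have e2 : ∀ᶠ x in nhds p, G x < -h / 4 :=
      hGc.continuousAt.eventually (gt_mem_nhds (by linarith))
    have e3 : ∀ {δ : ℝ}, 0 < δ → ∀ᶠ x in nhds p, ‖x - p‖ < δ := fun hδ => by
      filter_upwards [Metric.ball_mem_nhds p hδ] with x hx
      rwa [mem_ball, dist_eq_norm] at hx
    filter_upwards [e1, e2, e3 hR, e3 hρ0, e3 (δ := R ^ 2 / ρ) (by positivity)]
      with x h1 h2 h3 h4 h5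
    have hG0 : G x ≤ 0 := by linarith
    have hGp0 : G p ≤ 0 := by linarith
    have i1 := S.weighted_sub_le hρ0 hρ h1.le hG0 h3.le hFp.le hGp0 hpp h4.le
    have i2 := S.weighted_sub_le hρ0 hρ hFp.le hGp0 hpp h1.le hG0 h3.le
      (by rw [norm_sub_rev]; exact h4.le)
    rw [doubled_comm] at i2
    have hd : doubled c k R h ρ F G p x p ≤ 32 / ρ * ‖x - p‖ := by
      have hw := abs_le.1 (S.abs_weight_le h3.le)
      rw [doubled, hpen, sub_self, inner_zero_right, add_zero, add_zero, penalty,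
        (cubeCut_eq_zero h2.le).1, mul_zero, add_zero]
      set A := 1 + (6 * c + 2) * ⟪unitGrad F p, x - p⟫
      have hA0 : 0 ≤ A := by linarith
      have hA1 : A ≤ 5 / 4 := by linarith
      have j1 : modulus ρ ‖x - p‖ ≤ 16 / ρ * ‖x - p‖ := by
        have : modulus ρ ‖x - p‖ = 16 / ρ * ‖x - p‖ - 8 * (‖x - p‖ / ρ) ^ 2 := by
          unfold modulus; ring
        have : 0 ≤ 8 * (‖x - p‖ / ρ) ^ 2 := by positivity
        linarith
      have j2 : modulus ρ ‖x - p‖ * A ≤ 16 / ρ * ‖x - p‖ * (5 / 4) := by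
        have := modulus_nonneg hρ0 (norm_nonneg (x - p)) h4.le
        gcongr
      have j3 : 6 / R ^ 2 * (‖x - p‖ ^ 2 * A) ≤ 15 / 2 / ρ * ‖x - p‖ := by
        calc 6 / R ^ 2 * (‖x - p‖ ^ 2 * A) = 6 / R ^ 2 * (‖x - p‖ * ‖x - p‖ * A) := by ring
          _ ≤ 6 / R ^ 2 * (‖x - p‖ * (R ^ 2 / ρ) * (5 / 4)) := by gcongr
          _ = 15 / 2 / ρ * ‖x - p‖ := by field_simp; ring
      have j4 : 16 / ρ * ‖x - p‖ * (5 / 4) + 15 / 2 / ρ * ‖x - p‖ =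
        (55 / 2) * (‖x - p‖ / ρ) := by ring
      have j5 : 32 / ρ * ‖x - p‖ = 32 * (‖x - p‖ / ρ) := by ring
      have : 0 ≤ ‖x - p‖ / ρ := by positivity
      linarith
    rw [Real.norm_eq_abs, abs_le]
    constructor <;> linarith
  have hn := hgp.hasFDerivAt.le_of_lip' (by positivity) hlip
  rw [LinearIsometryEquiv.norm_map] at hn
  have hu := S.bdd p hFp.le (by linarith) hpp
  have e : gradient u p = (gradient u p + (k * u p) • unitGrad F p) - (k * u p) • unitGrad F p := by
    abel
  rw [e]
  refine (norm_sub_le _ _).trans (add_le_add hn ?_)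
  rw [norm_smul, S.norm_unitGrad, mul_one, Real.norm_eq_abs, abs_mul, abs_of_pos hk]
  nlinarith

end ThinSetting

theorem epre_apply {m : ℕ} (x : E (m+1)) (i : Fin m) : epre x i = x i.castSucc := by
  simp [epre]

theorem eglue_castSucc {m : ℕ} (p : E m) (t : ℝ) (i : Fin m) : eglue p t i.castSucc = p i := by
  simp [eglue]

theorem eglue_last {m : ℕ} (p : E m) (t : ℝ) : eglue p t (Fin.last m) = t := by
  simp [eglue]

@[simp] theorem epre_eglue {m : ℕ} (p : E m) (t : ℝ) : epre (eglue p t) = p := by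
  ext i; rw [epre_apply, eglue_castSucc]

@[simp] theorem lastC_eglue {m : ℕ} (p : E m) (t : ℝ) : lastC (eglue p t) = t := eglue_last p t

theorem ext_epre_lastC {m : ℕ} {x y : E (m+1)} (h : epre x = epre y) (h' : lastC x = lastC y) :
    x = y := by
  ext i
  refine Fin.lastCases h' (fun i => ?_) i
  rw [← epre_apply, ← epre_apply, h]

@[simp] theorem eglue_epre_lastC {m : ℕ} (x : E (m+1)) : eglue (epre x) (lastC x) = x :=
  ext_epre_lastC (by simp) (by simp)

/-- The horizontal projection as a continuous linear map. -/
def epreL (m : ℕ) : E (m+1) →L[ℝ] E m :=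
  LinearMap.toContinuousLinearMap
    { toFun := epre
      map_add' := fun x y => by ext i; simp [epre_apply]
      map_smul' := fun a x => by ext i; simp [epre_apply] }

theorem epreL_apply {m : ℕ} (x : E (m+1)) : epreL m x = epre x := rfl

theorem epre_add {m : ℕ} (x y : E (m+1)) : epre (x + y) = epre x + epre y := (epreL m).map_add x y

theorem epre_sub {m : ℕ} (x y : E (m+1)) : epre (x - y) = epre x - epre y := (epreL m).map_sub x y

theorem epre_smul {m : ℕ} (a : ℝ) (x : E (m+1)) : epre (a • x) = a • epre x :=
  (epreL m).map_smul a x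

theorem lastC_add {m : ℕ} (x y : E (m+1)) : lastC (x + y) = lastC x + lastC y := rfl

theorem lastC_sub {m : ℕ} (x y : E (m+1)) : lastC (x - y) = lastC x - lastC y := rfl

theorem lastC_smul {m : ℕ} (a : ℝ) (x : E (m+1)) : lastC (a • x) = a * lastC x := rfl

theorem inner_eq_epre_lastC {m : ℕ} (x y : E (m+1)) :
    ⟪x, y⟫ = ⟪epre x, epre y⟫ + lastC x * lastC y := by
  simp [PiLp.inner_apply, Fin.sum_univ_castSucc, epre_apply, lastC, mul_comm]

theorem norm_sq_eq_epre_lastC {m : ℕ} (x : E (m+1)) : ‖x‖ ^ 2 = ‖epre x‖ ^ 2 + lastC x ^ 2 := by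
  rw [← real_inner_self_eq_norm_sq, inner_eq_epre_lastC, real_inner_self_eq_norm_sq]; ring

theorem norm_epre_le {m : ℕ} (x : E (m+1)) : ‖epre x‖ ≤ ‖x‖ := by
  have := norm_sq_eq_epre_lastC x
  exact abs_le_of_sq_le_sq' (by nlinarith [sq_nonneg (lastC x)]) (norm_nonneg _) |>.2

theorem lastC_eq_inner {m : ℕ} (x : E (m+1)) : lastC x = ⟪eglue 0 1, x⟫ := by
  simp [inner_eq_epre_lastC]

theorem contDiff_lastC {m : ℕ} : ContDiff ℝ 2 (lastC : E (m+1) → ℝ) := by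
  rw [show (lastC : E (m+1) → ℝ) = fun x => ⟪eglue 0 1, x⟫ from funext lastC_eq_inner]
  exact contDiff_const.inner ℝ contDiff_id

theorem hasGradientAt_lastC {m : ℕ} (x : E (m+1)) : HasGradientAt lastC (eglue 0 1) x := by
  rw [show (lastC : E (m+1) → ℝ) = fun x => ⟪eglue 0 1, x⟫ from funext lastC_eq_inner]
  exact (InnerProductSpace.toDual ℝ (E (m+1)) (eglue 0 1)).hasFDerivAt

theorem hasGradientAt_comp_epre {m : ℕ} {φ : E m → ℝ} {x : E (m+1)} {d : E m}
    (h : HasGradientAt φ d (epre x)) : HasGradientAt (fun y => φ (epre y)) (eglue d 0) x := by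
  have := HasFDerivAt.comp x (g := φ) (f := epre) h.hasFDerivAt (epreL m).hasFDerivAt
  rw [hasGradientAt_iff_hasFDerivAt]
  refine this.congr_fderiv ?_
  ext y
  simp [inner_eq_epre_lastC, epreL_apply]

/-- Defining function of the side of the neck bounded by the graph of `s φ`. -/
def graphF {m : ℕ} (ε s : ℝ) (φ : E m → ℝ) (x : E (m+1)) : ℝ := s * lastC x - ε / 2 - φ (epre x)

theorem C2Sigma.neg {m : ℕ} {c σ : ℝ} {φ : E m → ℝ} (h : C2Sigma c σ φ) :
    C2Sigma c σ fun x => - φ x := by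
  obtain ⟨h1, h2, h3, h4, h5⟩ := h
  have e : ∀ p, gradient (fun x => - φ x) p = - gradient φ p := fun p => by
    have : (fun x => - φ x) = fun x => (-1 : ℝ) • φ x := by simp
    simp only [gradient]
    rw [show (fun x => - φ x) = - φ from rfl, fderiv_neg, map_neg]
  have e' : ∀ p, fderiv ℝ (fun q => gradient (fun x => - φ x) q) p =
      - fderiv ℝ (fun q => gradient φ q) p := fun p => by
    rw [show (fun q => gradient (fun x => - φ x) q) = fun q => - gradient φ q from funext e]
    exact fderiv_neg
  refine ⟨h1.neg, fun p => by simpa using h2 p, fun p => by rw [e, norm_neg]; exact h3 p,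
    fun p => by rw [e', norm_neg]; exact h4 p, fun p q => ?_⟩
  rw [e', e', ← norm_neg]
  simpa [neg_sub, sub_eq_add_neg, add_comm] using h5 p q

theorem C2Sigma.contDiff_gradient {m : ℕ} {c σ : ℝ} {φ : E m → ℝ} (h : C2Sigma c σ φ) :
    ContDiff ℝ 1 (gradient φ) :=
  (InnerProductSpace.toDual ℝ (E m)).symm.contDiff.comp (h.1.fderiv_right (by norm_num))

theorem C2Sigma.hasGradientAt {m : ℕ} {c σ : ℝ} {φ : E m → ℝ} (h : C2Sigma c σ φ) (x : E m) :
    HasGradientAt φ (gradient φ x) x :=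
  (h.1.differentiable (by simp) x).hasGradientAt

theorem C2Sigma.lip {m : ℕ} {c σ : ℝ} {φ : E m → ℝ} (h : C2Sigma c σ φ) (x y : E m) :
    ‖gradient φ x - gradient φ y‖ ≤ c * ‖x - y‖ :=
  convex_univ.norm_image_sub_le_of_norm_fderiv_le
    (fun z _ => h.contDiff_gradient.differentiable (by simp) z) (fun z _ => h.2.2.2.1 z)
    (mem_univ _) (mem_univ _)

theorem hasGradientAt_graphF {m : ℕ} {c σ ε s : ℝ} {φ : E m → ℝ} (h : C2Sigma c σ φ)
    (x : E (m+1)) : HasGradientAt (graphF ε s φ) (eglue (- gradient φ (epre x)) s) x := by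
  have h1 := hasGradientAt_comp_epre (h.hasGradientAt (epre x))
  have h2 := hasGradientAt_lastC x
  rw [hasGradientAt_iff_hasFDerivAt] at h1 h2 ⊢
  refine (((h2.const_mul s).sub_const (ε / 2)).sub h1).congr_fderiv ?_
  ext y
  simp [inner_eq_epre_lastC]
  ring

theorem niceDefining_graphF {m : ℕ} {c σ ε s : ℝ} {φ : E m → ℝ} (h : C2Sigma c σ φ)
    (hc : 0 ≤ c) (hs : s ^ 2 = 1) : NiceDefining c (graphF ε s φ) := by
  have e : ∀ x, gradient (graphF ε s φ) x = eglue (- gradient φ (epre x)) s := fun x =>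
    (hasGradientAt_graphF h x).gradient
  have hn : ∀ x, ‖gradient (graphF ε s φ) x‖ ^ 2 = 1 + ‖gradient φ (epre x)‖ ^ 2 := fun x => by
    rw [e, norm_sq_eq_epre_lastC]; simp [hs, add_comm]
  refine ⟨?_, fun x y => ?_, fun x => ?_, fun x => ?_⟩
  · exact ((contDiff_const.mul contDiff_lastC).sub contDiff_const).sub
      (h.1.comp (epreL m).contDiff)
  · rw [e, e]
    have : ‖eglue (- gradient φ (epre x)) s - eglue (- gradient φ (epre y)) s‖ =
        ‖gradient φ (epre x) - gradient φ (epre y)‖ := by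
      rw [← sq_eq_sq₀ (norm_nonneg _) (norm_nonneg _), norm_sq_eq_epre_lastC, epre_sub, lastC_sub]
      simp only [epre_eglue, lastC_eglue, sub_self]
      rw [← norm_neg, show -(-gradient φ (epre x) - -gradient φ (epre y)) =
        gradient φ (epre x) - gradient φ (epre y) by abel]
      ring
    rw [this]
    refine (h.lip _ _).trans ?_
    rw [← epre_sub]
    gcongr
    exact norm_epre_le _
  · have := hn x
    exact abs_le_of_sq_le_sq' (by nlinarith [sq_nonneg ‖gradient φ (epre x)‖]) (norm_nonneg _) |>.2
  · have h1 := hn x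
    have h2 := h.2.2.1 (epre x)
    have h3 := norm_nonneg (gradient φ (epre x))
    refine abs_le_of_sq_le_sq' ?_ (by positivity) |>.2
    nlinarith

/-- Assumptions on the geometry and on the solution. -/
structure NeckData {m : ℕ} (γ μ K c σ R0 ε : ℝ) (f g : E m → ℝ) (j : Fin m)
    (u : E (m+1) → ℝ) : Prop where
  hγ : 0 < γ
  hμ : 0 < μ
  hK : 0 < K
  hc : 0 < c
  hσ : σ ∈ Set.Ioo (0:ℝ) 1
  hR0 : 0 < R0
  hKR0 : K * R0 ^ σ ≤ μ / 2
  hε : ε ∈ Set.Ioo (0:ℝ) (R0/4)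
  hf : C2Sigma c σ f
  hg : C2Sigma c σ g
  f0 : f 0 = 0
  g0 : g 0 = 0
  df0 : gradient f 0 = 0
  dg0 : gradient g 0 = 0
  hfg : ∀ p : E m, ‖p‖ < R0 → |f p - g p - μ * ‖p‖^2| ≤ K * ‖p‖ ^ ((2:ℝ) + σ)
  ef : ∀ p : E m, f (flipCoord j p) = f p
  eg : ∀ p : E m, g (flipCoord j p) = g p
  sol : IsLocalSol ε R0 γ f g u 0 0
  odd : ∀ x ∈ regio ε R0 f g, u (flipCoord j.castSucc x) = - u x

namespace NeckData

variable {m : ℕ} {γ μ K c σ R0 ε : ℝ} {f g : E m → ℝ} {j : Fin m} {u : E (m+1) → ℝ}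

theorem sub_ge (D : NeckData γ μ K c σ R0 ε f g j u) {p : E m} (hp : ‖p‖ < R0) :
    μ / 2 * ‖p‖ ^ 2 ≤ f p - g p := by
  have h1 := (abs_le.1 (D.hfg p hp)).1
  have hσ := D.hσ.1
  have h2 : K * ‖p‖ ^ ((2:ℝ) + σ) ≤ μ / 2 * ‖p‖ ^ 2 := by
    rw [Real.rpow_add_of_nonneg (norm_nonneg _) (by norm_num) hσ.le, Real.rpow_two]
    have : ‖p‖ ^ σ ≤ R0 ^ σ := Real.rpow_le_rpow (norm_nonneg _) hp.le hσ.le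
    calc K * (‖p‖ ^ 2 * ‖p‖ ^ σ) ≤ K * (‖p‖ ^ 2 * R0 ^ σ) := by have := D.hK; gcongr
      _ = K * R0 ^ σ * ‖p‖ ^ 2 := by ring
      _ ≤ _ := by have := D.hKR0; gcongr
  linarith

theorem mem_neck_iff (_ : NeckData γ μ K c σ R0 ε f g j u) {x : E (m+1)} :
    x ∈ neck ε f g 0 R0 ↔ ‖epre x‖ < R0 ∧ graphF ε 1 f x < 0 ∧ graphF ε (-1) (fun y => - g y) x < 0 := by
  simp only [neck, mem_ofPred_eq, sub_zero, graphF]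
  constructor <;> rintro ⟨h1, h2, h3⟩ <;> exact ⟨h1, by linarith, by linarith⟩

theorem mem_regio (D : NeckData γ μ K c σ R0 ε f g j u) {x : E (m+1)} (hx : ‖epre x‖ < R0)
    (hF : graphF ε 1 f x ≤ 0) (hG : graphF ε (-1) (fun y => - g y) x ≤ 0) :
    x ∈ regio ε R0 f g := by
  rcases hF.lt_or_eq with h1 | h1
  · rcases hG.lt_or_eq with h2 | h2
    · exact Or.inl (Or.inl (D.mem_neck_iff.2 ⟨hx, h1, h2⟩))
    · refine Or.inr ⟨epre x, by simpa using hx, ext_epre_lastC (by simp) ?_⟩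
      simp only [graphF] at h2
      simp only [lastC_eglue]; linarith
  · refine Or.inl (Or.inr ⟨epre x, by simpa using hx, ext_epre_lastC (by simp) ?_⟩)
    simp only [graphF] at h1
    simp only [lastC_eglue]; linarith

theorem bd_top (D : NeckData γ μ K c σ R0 ε f g j u) {x : E (m+1)} (hx : ‖epre x‖ < R0)
    (hF : graphF ε 1 f x = 0) : ⟪gradient u x, gradient (graphF ε 1 f) x⟫ =
      - (1 / γ * (‖gradient (graphF ε 1 f) x‖ * u x)) := by
  have h := D.sol.2.2.2.2.1 (epre x) (by simpa using hx)
  have e : eglue (epre x) (ε / 2 + f (epre x)) = x := by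
    refine ext_epre_lastC (by simp) ?_
    simp only [graphF] at hF
    simp only [lastC_eglue]; linarith
  rw [e, nuP] at h
  have hγ := D.hγ
  have hg : gradient (graphF ε 1 f) x = eglue (- gradient f (epre x)) 1 :=
    (hasGradientAt_graphF D.hf x).gradient
  have hn : ‖gradient (graphF ε 1 f) x‖ = √(1 + ‖gradient f (epre x)‖ ^ 2) := by
    rw [eq_comm, Real.sqrt_eq_iff_eq_sq (by positivity) (norm_nonneg _), hg, norm_sq_eq_epre_lastC]
    simp [add_comm]
  rw [← hn, ← hg, real_inner_smul_left, real_inner_comm] at h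
  have h1 : ‖gradient (graphF ε 1 f) x‖ ≠ 0 := by
    rw [hn]; positivity
  field_simp at h ⊢
  linarith

theorem bd_bot (D : NeckData γ μ K c σ R0 ε f g j u) {x : E (m+1)} (hx : ‖epre x‖ < R0)
    (hF : graphF ε (-1) (fun y => - g y) x = 0) :
    ⟪gradient u x, gradient (graphF ε (-1) fun y => - g y) x⟫ =
      - (1 / γ * (‖gradient (graphF ε (-1) fun y => - g y) x‖ * u x)) := by
  have h := D.sol.2.2.2.2.2 (epre x) (by simpa using hx)
  have e : eglue (epre x) (-(ε / 2) + g (epre x)) = x := by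
    refine ext_epre_lastC (by simp) ?_
    simp only [graphF] at hF
    simp only [lastC_eglue]; linarith
  rw [e, nuM] at h
  have hγ := D.hγ
  have hg : gradient (graphF ε (-1) fun y => - g y) x = eglue (gradient g (epre x)) (-1) := by
    rw [(hasGradientAt_graphF D.hg.neg x).gradient]
    congr 1
    rw [show (fun y => - g y) = - g from rfl, gradient, fderiv_neg, map_neg, neg_neg]; rfl
  have hn : ‖gradient (graphF ε (-1) fun y => - g y) x‖ = √(1 + ‖gradient g (epre x)‖ ^ 2) := by
    rw [eq_comm, Real.sqrt_eq_iff_eq_sq (by positivity) (norm_nonneg _), hg, norm_sq_eq_epre_lastC]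
    simp [add_comm]
  rw [← hn, ← hg, real_inner_smul_left, real_inner_comm] at h
  have h1 : ‖gradient (graphF ε (-1) fun y => - g y) x‖ ≠ 0 := by
    rw [hn]; positivity
  field_simp at h ⊢
  linarith

theorem abs_le_of_closed (D : NeckData γ μ K c σ R0 ε f g j u) {x : E (m+1)} {M : ℝ}
    (hx : ‖epre x‖ < R0)
    (hF : graphF ε 1 f x ≤ 0) (hG : graphF ε (-1) (fun y => - g y) x ≤ 0)
    (hM : ∀ y ∈ neck ε f g 0 R0, epre y = epre x → |u y| ≤ M) : |u x| ≤ M := by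
  have hd := (D.sol.1 x (D.mem_regio hx hF hG)).continuousAt
  set z : E (m+1) := eglue (epre x) ((f (epre x) + g (epre x)) / 2)
  have hc : Filter.Tendsto (fun t : ℝ => |u (x + t • (z - x))|) (nhdsWithin 0 (Ioi 0))
      (nhds |u x|) := by
    refine Filter.Tendsto.abs ?_
    have h1 : Filter.Tendsto (fun t : ℝ => x + t • (z - x)) (nhdsWithin 0 (Ioi 0)) (nhds x) := by
      have : Continuous fun t : ℝ => x + t • (z - x) := by fun_prop
      have := this.tendsto 0
      simp only [zero_smul, add_zero] at this
      exact this.mono_left nhdsWithin_le_nhds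
    exact hd.tendsto.comp h1
  refine le_of_tendsto hc ?_
  filter_upwards [Ioo_mem_nhdsGT (show (0:ℝ) < 1 by norm_num)] with t ht
  have e : epre (x + t • (z - x)) = epre x := by
    rw [epre_add, epre_smul, epre_sub]; simp [z]
  refine hM _ (D.mem_neck_iff.2 ⟨by rwa [e], ?_, ?_⟩) e
  all_goals
    have hs := D.sub_ge hx
    have h0 : 0 ≤ μ / 2 * ‖epre x‖ ^ 2 := by have := D.hμ; positivity
    have hε := D.hε.1
    simp only [graphF, e, lastC_add, lastC_smul, lastC_sub, z, lastC_eglue] at hF hG ⊢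
    nlinarith [ht.1, ht.2]

end NeckData

/-- A purely numerical choice of the doubling scale. -/
theorem exists_scale (n : ℕ) {c k κ c0 D T : ℝ} (hc : 0 < c) (hk : 0 < k) (hκ : 0 < κ)
    (hc0 : 0 < c0) (hD : 0 < D) (hT : 0 ≤ T) :
    ∃ B, 0 < B ∧ ∀ δ, 0 < δ → δ ≤ D →
      2 * (6 / (κ * δ) ^ 2 * (5 / 2 * n + 1) + T * (8 * (1 + c) ^ 2 / (c0 * δ ^ 2) + n * c)) +
      4 * k * (17 / (κ * δ) + T * (1 + c)) + 4 * k ^ 2 < 32 / (δ / B) ^ 2 := by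
  set A := 2 * (6 / κ ^ 2 * (5 / 2 * n + 1) + T * (8 * (1 + c) ^ 2 / c0 + n * c * D ^ 2)) +
      4 * k * (17 / κ * D + T * (1 + c) * D ^ 2) + 4 * k ^ 2 * D ^ 2 with hA
  have hA0 : 0 ≤ A := by positivity
  refine ⟨A + 1, by positivity, fun δ hδ hδD => ?_⟩
  have hd : 32 / (δ / (A + 1)) ^ 2 = 32 * (A + 1) ^ 2 / δ ^ 2 := by field_simp
  rw [hd, lt_div_iff₀ (by positivity)]
  have e : (2 * (6 / (κ * δ) ^ 2 * (5 / 2 * n + 1) +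
      T * (8 * (1 + c) ^ 2 / (c0 * δ ^ 2) + n * c)) +
      4 * k * (17 / (κ * δ) + T * (1 + c)) + 4 * k ^ 2) * δ ^ 2 =
      2 * (6 / κ ^ 2 * (5 / 2 * n + 1) + T * (8 * (1 + c) ^ 2 / c0 + n * c * δ ^ 2)) +
      4 * k * (17 / κ * δ + T * (1 + c) * δ ^ 2) + 4 * k ^ 2 * δ ^ 2 := by
    field_simp
  rw [e]
  have : 2 * (6 / κ ^ 2 * (5 / 2 * n + 1) + T * (8 * (1 + c) ^ 2 / c0 + n * c * δ ^ 2)) +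
      4 * k * (17 / κ * δ + T * (1 + c) * δ ^ 2) + 4 * k ^ 2 * δ ^ 2 ≤ A := by
    rw [hA]; gcongr
  nlinarith

/-- A purely numerical choice of the radius. -/
theorem exists_radius {c k D R0 : ℝ} (hc : 0 < c) (hk : 0 < k) (hD : 0 < D) (hR0 : 0 < R0) :
    ∃ κ, 0 < κ ∧ κ ≤ 1 / 3 ∧ ∀ δ, 0 < δ → δ ≤ D → κ * δ ≤ R0 / 4 ∧
      (6 * c + 2) * (κ * δ) ≤ 1 / 4 ∧ k * (κ * δ) ≤ 1 / 2 ∧ k * c ^ 2 * (κ * δ) ^ 2 ≤ 6 := by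
  set Q := 3 + 4 * D / R0 + 4 * (6 * c + 2) * D + 2 * k * D + k * c ^ 2 * D ^ 2 with hQ
  have q1 : 0 < 4 * D / R0 := by positivity
  have q2 : 0 < 4 * (6 * c + 2) * D := by positivity
  have q3 : 0 < 2 * k * D := by positivity
  have q4 : 0 < k * c ^ 2 * D ^ 2 := by positivity
  have hQ0 : 0 < Q := by positivity
  have key : ∀ δ X, 0 < δ → δ ≤ D → 0 ≤ X → X * D ≤ Q → X * (1 / Q * δ) ≤ 1 := by
    intro δ X h1 h2 h3 h4
    rw [show X * (1 / Q * δ) = X * δ / Q by ring, div_le_one hQ0]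
    nlinarith
  refine ⟨1 / Q, by positivity, ?_, fun δ h1 h2 => ⟨?_, ?_, ?_, ?_⟩⟩
  · exact one_div_le_one_div_of_le (by norm_num) (by linarith)
  · have := key δ (4 / R0) h1 h2 (by positivity) (by
      rw [show 4 / R0 * D = 4 * D / R0 by ring]; linarith)
    rw [show 4 / R0 * (1 / Q * δ) = (4 * (1 / Q * δ)) / R0 by ring, div_le_one hR0] at this
    linarith
  · have := key δ (4 * (6 * c + 2)) h1 h2 (by positivity) (by linarith)
    linarith
  · have := key δ (2 * k) h1 h2 (by positivity) (by linarith)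
    linarith
  · have h5 : (1 / Q * δ) ^ 2 ≤ 1 / Q * D ^ 2 := by
      have : 1 / Q ≤ 1 := by rw [div_le_one hQ0]; linarith
      calc (1 / Q * δ) ^ 2 = 1 / Q * (1 / Q) * δ ^ 2 := by ring
        _ ≤ 1 / Q * 1 * D ^ 2 := by gcongr
        _ = _ := by ring
    calc k * c ^ 2 * (1 / Q * δ) ^ 2 ≤ k * c ^ 2 * (1 / Q * D ^ 2) := by gcongr
      _ = (k * c ^ 2 * D ^ 2) / Q := by ring
      _ ≤ 1 := by rw [div_le_one hQ0]; linarith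
      _ ≤ 6 := by norm_num

namespace NeckData

variable {m : ℕ} {γ μ K c σ R0 ε : ℝ} {f g : E m → ℝ} {j : Fin m} {u : E (m+1) → ℝ}

theorem thin (D : NeckData γ μ K c σ R0 ε f g j u) {p q : E m} {κ δ : ℝ} (hq : ‖q‖ < R0)
    (hκ' : κ ≤ 1 / 3) (hδ : δ ^ 2 = ε + ‖p‖ ^ 2) (hδ0 : 0 < δ) (hpq : ‖q - p‖ ≤ κ * δ) :
    min 1 (μ / 2) / 4 * δ ^ 2 ≤ ε + (f q - g q) := by
  have h1 := D.sub_ge hq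
  have hμ := D.hμ
  have hε := D.hε.1
  have h2 : ‖p‖ ≤ ‖q‖ + ‖q - p‖ := by
    have := norm_sub_le q (q - p); simpa using this
  have h3 : ‖q - p‖ ≤ 1 / 3 * δ := hpq.trans (by gcongr)
  have h4 : ‖p‖ ^ 2 ≤ 2 * ‖q‖ ^ 2 + 2 * (1 / 3 * δ) ^ 2 := by
    have : ‖p‖ ^ 2 ≤ (‖q‖ + 1 / 3 * δ) ^ 2 := by gcongr; linarith
    nlinarith [sq_nonneg (‖q‖ - 1 / 3 * δ)]
  have h5 : min 1 (μ / 2) * (ε + ‖q‖ ^ 2) ≤ ε + μ / 2 * ‖q‖ ^ 2 := by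
    have a1 := min_le_left 1 (μ / 2)
    have a2 := min_le_right 1 (μ / 2)
    nlinarith [sq_nonneg ‖q‖]
  have h6 : 0 < min 1 (μ / 2) := by positivity
  have h7 : δ ^ 2 / 4 ≤ ε + ‖q‖ ^ 2 := by nlinarith
  calc min 1 (μ / 2) / 4 * δ ^ 2 = min 1 (μ / 2) * (δ ^ 2 / 4) := by ring
    _ ≤ min 1 (μ / 2) * (ε + ‖q‖ ^ 2) := by gcongr
    _ ≤ _ := by linarith

theorem norm_gradient_le_aux (D : NeckData γ μ K c σ R0 ε f g j u) {p : E (m+1)}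
    {κ δ ρ M : ℝ} (hκ : 0 < κ) (hκ' : κ ≤ 1 / 3) (hδ : δ ^ 2 = ε + ‖epre p‖ ^ 2) (hδ0 : 0 < δ)
    (hp : p ∈ neck ε f g 0 R0) (hp2 : ‖epre p‖ ≤ R0 / 2) (hM : 0 < M)
    (hu : ∀ y ∈ neck ε f g 0 R0, ‖epre y - epre p‖ ≤ κ * δ → |u y| ≤ M)
    (r1 : κ * δ ≤ R0 / 4) (r2 : (6 * c + 2) * (κ * δ) ≤ 1 / 4) (r3 : 1 / γ * (κ * δ) ≤ 1 / 2)
    (r4 : 1 / γ * c ^ 2 * (κ * δ) ^ 2 ≤ 6) (hρ0 : 0 < ρ)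
    (hρ : 2 * (6 / (κ * δ) ^ 2 * (5 / 2 * (m + 1 : ℕ) + 1) + slopeT c (1 / γ) *
      (8 * (1 + c) ^ 2 / (min 1 (μ / 2) / 4 * δ ^ 2) + (m + 1 : ℕ) * c)) +
      4 * (1 / γ) * (17 / (κ * δ) + slopeT c (1 / γ) * (1 + c)) + 4 * (1 / γ) ^ 2 < 32 / ρ ^ 2) :
    ‖gradient u p‖ ≤ (32 / ρ + 1 / γ) * M := by
  have hR0 := D.hR0
  have hγ := D.hγ
  have hμ := D.hμ
  have hc := D.hc
  set F := graphF ε 1 f with hF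
  set G := graphF ε (-1) (fun y => - g y) with hG
  set v : E (m+1) → ℝ := fun x => M⁻¹ * u x with hv
  have hmem : ∀ x, ‖x - p‖ ≤ κ * δ → ‖epre x‖ < R0 := fun x hx => by
    have h1 : ‖epre x‖ ≤ ‖epre (x - p)‖ + ‖epre p‖ := by
      rw [epre_sub]; simpa using norm_add_le (epre x - epre p) (epre p)
    have h2 := norm_epre_le (x - p)
    linarith
  obtain ⟨-, hFp, hGp⟩ := D.mem_neck_iff.1 hp
  have thin : ∀ x, F x ≤ 0 → G x ≤ 0 → ‖x - p‖ ≤ κ * δ →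
      F x + G x ≤ -(min 1 (μ / 2) / 4 * δ ^ 2) := fun x _ _ hx => by
    have := D.thin (hmem x hx) hκ' hδ hδ0 (q := epre x)
      ((epre_sub x p ▸ norm_epre_le (x - p)).trans hx)
    simp only [hF, hG, graphF]
    linarith
  have hdiff : ∀ x, F x ≤ 0 → G x ≤ 0 → ‖x - p‖ ≤ κ * δ → DifferentiableAt ℝ u x :=
    fun x h1 h2 hx => D.sol.1 x (D.mem_regio (hmem x hx) h1 h2)
  have hgrad : ∀ x, DifferentiableAt ℝ u x → gradient v x = M⁻¹ • gradient u x := fun x hx => by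
    rw [gradient, hv, fderiv_const_mul hx, map_smul]; rfl
  have bdd : ∀ x, F x ≤ 0 → G x ≤ 0 → ‖x - p‖ ≤ κ * δ → |v x| ≤ 1 := fun x h1 h2 hx => by
    have := D.abs_le_of_closed (hmem x hx) h1 h2 (M := M) fun y hy hye => hu y hy (by
      rw [hye, ← epre_sub]; exact (norm_epre_le _).trans hx)
    rw [hv, abs_mul, abs_of_pos (by positivity), inv_mul_le_iff₀ hM]
    linarith
  have bdF : ∀ x, F x = 0 → G x ≤ 0 → ‖x - p‖ ≤ κ * δ →
      ⟪gradient v x, gradient F x⟫ = - (1 / γ * (‖gradient F x‖ * v x)) := fun x h1 h2 hx => by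
    rw [hgrad x (hdiff x h1.le h2 hx), real_inner_smul_left, D.bd_top (hmem x hx) h1]
    simp only [hv]; ring
  have bdG : ∀ x, F x ≤ 0 → G x = 0 → ‖x - p‖ ≤ κ * δ →
      ⟪gradient v x, gradient G x⟫ = - (1 / γ * (‖gradient G x‖ * v x)) := fun x h1 h2 hx => by
    rw [hgrad x (hdiff x h1 h2.le hx), real_inner_smul_left, D.bd_bot (hmem x hx) h2]
    simp only [hv]; ring
  have harm : ∀ x, F x < 0 → G x < 0 → ‖x - p‖ ≤ κ * δ → ContDiffAt ℝ 2 v x ∧ elap v x = 0 :=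
    fun x h1 h2 hx => by
    have hx' := D.mem_neck_iff.2 ⟨hmem x hx, h1, h2⟩
    have ho : IsOpen (neck ε f g 0 R0) := by
      have : neck ε f g 0 R0 = {x | ‖epre x‖ < R0} ∩ ({x | F x < 0} ∩ {x | G x < 0}) := by
        ext x; exact D.mem_neck_iff
      rw [this]
      have e1 : Continuous fun x : E (m+1) => ‖epre x‖ := (epreL m).continuous.norm
      have e2 : Continuous F :=
        (niceDefining_graphF D.hf D.hc.le (by norm_num)).differentiable.continuous
      have e3 : Continuous G :=
        (niceDefining_graphF D.hg.neg D.hc.le (by norm_num)).differentiable.continuous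
      exact (isOpen_lt e1 continuous_const).inter
        ((isOpen_lt e2 continuous_const).inter (isOpen_lt e3 continuous_const))
    have hcd : ContDiffAt ℝ 2 u x := D.sol.2.2.1.contDiffAt (ho.mem_nhds hx')
    refine ⟨contDiffAt_const.mul hcd, ?_⟩
    have h3 := D.sol.2.2.2.1 x hx'
    rw [elap] at h3 ⊢
    have : v = M⁻¹ • u := by ext; simp [hv]
    rw [this]
    simp only [iteratedFDeriv_const_smul_apply hcd, smul_apply,
      ← Finset.smul_sum, h3, smul_zero]
  have nF : NiceDefining c F := niceDefining_graphF D.hf D.hc.le (by norm_num)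
  have nG : NiceDefining c G := niceDefining_graphF D.hg.neg D.hc.le (by norm_num)
  have hvd : ∀ x, F x ≤ 0 → G x ≤ 0 → ‖x - p‖ ≤ κ * δ → DifferentiableAt ℝ v x :=
    fun x h1 h2 hx => (hdiff x h1 h2 hx).const_mul _
  have hpp : ‖p - p‖ ≤ κ * δ := by simp; positivity
  have ht := thin p hFp.le hGp.le hpp
  have key : ‖gradient v p‖ ≤ 32 / ρ + 1 / γ := by
    rcases le_total (G p) (F p) with h | h
    · have S : ThinSetting c (1 / γ) (κ * δ) (min 1 (μ / 2) / 4 * δ ^ 2) F G v p :=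
        ⟨hc, by positivity, by positivity, by positivity, r2, r3, r4, nF, nG, hFp, by linarith, thin,
          bdd, hvd, bdF, bdG, harm⟩
      exact S.norm_gradient_le hρ0 hρ
    · have S : ThinSetting c (1 / γ) (κ * δ) (min 1 (μ / 2) / 4 * δ ^ 2) G F v p :=
        ⟨hc, by positivity, by positivity, by positivity, r2, r3, r4, nG, nF, hGp, by linarith,
          fun x h1 h2 h3 => by rw [add_comm]; exact thin x h2 h1 h3,
          fun x h1 h2 => bdd x h2 h1, fun x h1 h2 => hvd x h2 h1, fun x h1 h2 => bdG x h2 h1,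
          fun x h1 h2 => bdF x h2 h1, fun x h1 h2 => harm x h2 h1⟩
      exact S.norm_gradient_le hρ0 hρ
  rw [hgrad p (hdiff p hFp.le hGp.le hpp), norm_smul, Real.norm_eq_abs,
    abs_of_pos (by positivity), inv_mul_le_iff₀ hM] at key
  linarith

end NeckData

theorem exists_gradient_bound (m : ℕ) {γ μ c R0 : ℝ} (hγ : 0 < γ) (hμ : 0 < μ) (hc : 0 < c)
    (hR0 : 0 < R0) :
    ∃ κ C : ℝ, 0 < κ ∧ κ ≤ 1 / 3 ∧ 0 < C ∧ ∀ {K σ ε : ℝ} {f g : E m → ℝ} {j : Fin m}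
      {u : E (m+1) → ℝ}, NeckData γ μ K c σ R0 ε f g j u → ∀ p ∈ neck ε f g 0 R0,
      ‖epre p‖ ≤ R0 / 2 → ∀ M : ℝ,
      (∀ y ∈ neck ε f g 0 R0, ‖epre y - epre p‖ ≤ κ * √(ε + ‖epre p‖ ^ 2) → |u y| ≤ M) →
      ‖gradient u p‖ ≤ C * M / √(ε + ‖epre p‖ ^ 2) := by
  have hk : 0 < 1 / γ := by positivity
  have hD : 0 < R0 + 1 := by positivity
  obtain ⟨κ, hκ, hκ', hr⟩ := exists_radius hc hk hD hR0
  have hT : 0 ≤ slopeT c (1 / γ) := by unfold slopeT; positivity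
  obtain ⟨B, hB, hρ⟩ := exists_scale (m + 1) hc hk hκ
    (show 0 < min 1 (μ / 2) / 4 by positivity) hD hT
  refine ⟨κ, 32 * B + 1 / γ * (R0 + 1), hκ, hκ', by positivity, ?_⟩
  intro K σ ε f g j u D p hp hp2 M hM
  have hε := D.hε
  have hε0 := hε.1
  set δ := √(ε + ‖epre p‖ ^ 2) with hδ
  have hδ0 : 0 < δ := Real.sqrt_pos.2 (by positivity)
  have hδ2 : δ ^ 2 = ε + ‖epre p‖ ^ 2 := Real.sq_sqrt (by positivity)
  have hδD : δ ≤ R0 + 1 := by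
    refine abs_le_of_sq_le_sq' ?_ hD.le |>.2
    have : ‖epre p‖ ^ 2 ≤ (R0 / 2) ^ 2 := by gcongr
    nlinarith [hε.2]
  obtain ⟨r1, r2, r3, r4⟩ := hr δ hδ0 hδD
  have hM0 : 0 ≤ M := (abs_nonneg _).trans (hM p hp (by simp; positivity))
  have main : ∀ M' > M, ‖gradient u p‖ ≤ (32 * B + 1 / γ * (R0 + 1)) * M' / δ := fun M' hM' => by
    have := D.norm_gradient_le_aux hκ hκ' hδ2 hδ0 hp hp2 (hM0.trans_lt hM')
      (fun y hy hy' => (hM y hy hy').trans hM'.le) r1 r2 r3 r4 (by positivity : 0 < δ / B)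
      (hρ δ hδ0 hδD)
    refine this.trans ?_
    rw [le_div_iff₀ hδ0, show (32 / (δ / B) + 1 / γ) * M' * δ = (32 * B + 1 / γ * δ) * M' by
      field_simp]
    have : 0 ≤ M' := hM0.trans hM'.le
    gcongr
  refine ge_of_tendsto (x := nhdsWithin M (Ioi M))
    (f := fun M' => (32 * B + 1 / γ * (R0 + 1)) * M' / δ) ?_
    (Filter.eventually_of_mem self_mem_nhdsWithin main)
  have : Continuous fun M' : ℝ => (32 * B + 1 / γ * (R0 + 1)) * M' / δ := by fun_prop
  exact (this.tendsto M).mono_left nhdsWithin_le_nhds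

namespace C2Sigma

variable {m : ℕ} {c σ : ℝ} {φ : E m → ℝ}

theorem norm_gradient_le (h : C2Sigma c σ φ) (h1 : gradient φ 0 = 0) (x : E m) :
    ‖gradient φ x‖ ≤ c * ‖x‖ := by
  simpa [h1] using h.lip x 0

theorem abs_le (h : C2Sigma c σ φ) (hc : 0 ≤ c) (h0 : φ 0 = 0) (h1 : gradient φ 0 = 0) (x : E m) :
    |φ x| ≤ c * ‖x‖ ^ 2 := by
  have := (convex_closedBall (0 : E m) ‖x‖).norm_image_sub_le_of_norm_hasFDerivWithin_le (𝕜 := ℝ)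
    (f := φ) (C := c * ‖x‖) (x := 0) (y := x)
    (fun z _ => (h.hasGradientAt z).hasFDerivAt.hasFDerivWithinAt)
    (fun z hz => by
      rw [LinearIsometryEquiv.norm_map]
      refine (h.norm_gradient_le h1 z).trans ?_
      gcongr
      simpa using hz) (by simp) (by simp)
  simpa [h0, pow_two, mul_assoc] using this

theorem norm_fderiv_apply_sub_gradient_le (h : C2Sigma c σ φ) (hc : 0 ≤ c) (hσ : 0 < σ)
    (h1 : gradient φ 0 = 0) (y : E m) :
    ‖fderiv ℝ (gradient φ) y y - gradient φ y‖ ≤ c * ‖y‖ ^ (1 + σ) := by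
  have := (convex_segment (𝕜 := ℝ) (0 : E m) y).norm_image_sub_le_of_norm_hasFDerivWithin_le'
    (f := gradient φ) (φ := fderiv ℝ (gradient φ) y) (C := c * ‖y‖ ^ σ) (x := 0) (y := y)
    (fun z _ => (h.contDiff_gradient.differentiable (by simp) z).hasFDerivAt.hasFDerivWithinAt)
    (fun z hz => by
      refine (h.2.2.2.2 z y).trans ?_
      gcongr
      rw [segment_symm] at hz
      have := norm_sub_le_of_mem_segment hz
      simpa using this) (left_mem_segment _ _ _) (right_mem_segment _ _ _)
  rw [h1, sub_zero, sub_zero, norm_sub_rev] at this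
  rw [Real.rpow_add_of_nonneg (norm_nonneg _) zero_le_one hσ.le, Real.rpow_one]
  linarith

theorem abs_inner_sub_le (h : C2Sigma c σ φ) (hc : 0 ≤ c) (hσ : 0 < σ) (h0 : φ 0 = 0)
    (h1 : gradient φ 0 = 0) (x : E m) :
    |⟪x, gradient φ x⟫ - 2 * φ x| ≤ c * ‖x‖ ^ (2 + σ) := by
  set k : ℝ → ℝ := fun t => ⟪t • x, gradient φ (t • x)⟫ - 2 * φ (t • x)
  have hd : ∀ t : ℝ, HasDerivAt k
      (⟪x, fderiv ℝ (gradient φ) (t • x) (t • x) - gradient φ (t • x)⟫) t := fun t => by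
    have e1 : HasDerivAt (fun t : ℝ => t • x) x t := by
      simpa using (hasDerivAt_id t).smul_const x
    have e2 := (h.contDiff_gradient.differentiable (by simp) (t • x)).hasFDerivAt.comp_hasDerivAt t e1
    have e3 := (h.hasGradientAt (t • x)).hasFDerivAt.comp_hasDerivAt t e1
    refine ((e1.inner ℝ e2).sub (e3.const_mul 2)).congr_deriv ?_
    simp only [InnerProductSpace.toDual_apply_apply, Function.comp_apply, map_smul, inner_smul_left,
      inner_smul_right, inner_sub_right, real_inner_comm x (gradient φ (t • x))]
    simp
    ring
  have := norm_image_sub_le_of_norm_deriv_le_segment_01' (f := k) (C := c * ‖x‖ ^ (2 + σ))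
    (fun t _ => (hd t).hasDerivWithinAt) (fun t ht => by
      refine (norm_inner_le_norm _ _).trans ?_
      have h2 := h.norm_fderiv_apply_sub_gradient_le hc hσ h1 (t • x)
      have h3 : ‖t • x‖ ≤ ‖x‖ := by
        rw [norm_smul, Real.norm_eq_abs, abs_of_nonneg ht.1]
        exact mul_le_of_le_one_left (norm_nonneg _) ht.2.le
      have h4 : ‖t • x‖ ^ (1 + σ) ≤ ‖x‖ ^ (1 + σ) := by gcongr
      calc ‖x‖ * _ ≤ ‖x‖ * (c * ‖x‖ ^ (1 + σ)) := by
            gcongr; exact h2.trans (by gcongr)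
        _ = c * (‖x‖ ^ (1 : ℝ) * ‖x‖ ^ (1 + σ)) := by rw [Real.rpow_one]; ring
        _ = _ := by
          rw [← Real.rpow_add_of_nonneg (norm_nonneg _) zero_le_one (by positivity)]
          congr 2; ring)
  simpa [k, h0] using this

/-- Second derivative at the origin in the `j`-th direction. -/
def curv (φ : E m → ℝ) (j : Fin m) : ℝ :=
  ⟪fderiv ℝ (gradient φ) 0 (EuclideanSpace.single j 1), EuclideanSpace.single j 1⟫

theorem abs_curv_le (h : C2Sigma c σ φ) (j : Fin m) : |curv φ j| ≤ c := by
  refine (abs_real_inner_le_norm _ _).trans ?_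
  have h1 := (fderiv ℝ (gradient φ) 0).le_opNorm (EuclideanSpace.single j (1:ℝ))
  have h2 := h.2.2.2.1 0
  simp only [PiLp.norm_single, norm_one, mul_one] at h1 ⊢
  exact h1.trans h2

theorem inner_gradient_single_eq_zero (h : C2Sigma c σ φ) {j : Fin m}
    (he : ∀ p : E m, φ (flipCoord j p) = φ p) {x : E m} (hx : x j = 0) :
    ⟪gradient φ x, EuclideanSpace.single j 1⟫ = 0 := by
  have e1 : HasDerivAt (fun t : ℝ => φ (x + t • EuclideanSpace.single j 1))
      ⟪gradient φ x, EuclideanSpace.single j 1⟫ 0 := by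
    have e : HasDerivAt (fun t : ℝ => x + t • (EuclideanSpace.single j 1 : E m))
        (EuclideanSpace.single j 1) 0 := by
      simpa using ((hasDerivAt_id (0:ℝ)).smul_const (EuclideanSpace.single j 1 : E m)).const_add x
    have e3 : HasFDerivAt φ (InnerProductSpace.toDual ℝ (E m) (gradient φ x))
        (x + (0:ℝ) • EuclideanSpace.single j 1) := by
      simpa using (h.hasGradientAt x).hasFDerivAt
    exact (e3.comp_hasDerivAt (0:ℝ) e).congr_deriv (InnerProductSpace.toDual_apply_apply ..)
  have e2 : (fun t : ℝ => φ (x + (-t) • EuclideanSpace.single j 1)) =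
      fun t : ℝ => φ (x + t • EuclideanSpace.single j 1) := by
    funext t
    rw [← he (x + t • EuclideanSpace.single j 1)]
    congr 1
    ext i
    by_cases hi : i = j
    · subst hi; simp [flipCoord, hx]
    · simp [flipCoord, hi]
  have e3 := (show HasDerivAt (fun t : ℝ => φ (x + t • EuclideanSpace.single j 1))
      ⟪gradient φ x, EuclideanSpace.single j 1⟫ (-0) by simpa using e1).scomp (0:ℝ) (hasDerivAt_neg 0)
  have e4 := e3.unique (e2 ▸ e1)
  simp only [neg_smul, one_smul] at e4
  linarith

private theorem norm_sub_single (x : E m) (j : Fin m) :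
    ‖x - (x j) • EuclideanSpace.single j (1:ℝ)‖ ≤ ‖x‖ := by
  rw [EuclideanSpace.norm_eq, EuclideanSpace.norm_eq]
  refine Real.sqrt_le_sqrt (Finset.sum_le_sum fun i _ => ?_)
  by_cases hi : i = j
  · subst hi; simp; positivity
  · simp [hi]

theorem abs_inner_gradient_single_sub_le (h : C2Sigma c σ φ) (hc : 0 ≤ c) (hσ : 0 < σ) {j : Fin m}
    (he : ∀ p : E m, φ (flipCoord j p) = φ p) (x : E m) :
    |⟪gradient φ x, EuclideanSpace.single j 1⟫ - curv φ j * x j| ≤ c * ‖x‖ ^ σ * |x j| := by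
  set x0 := x - (x j) • EuclideanSpace.single j (1:ℝ) with hx0
  have h0 := h.inner_gradient_single_eq_zero he (x := x0) (by simp [hx0])
  have := (convex_closedBall (0 : E m) ‖x‖).norm_image_sub_le_of_norm_hasFDerivWithin_le' (𝕜 := ℝ)
    (f := gradient φ) (φ := fderiv ℝ (gradient φ) 0) (C := c * ‖x‖ ^ σ) (x := x0) (y := x)
    (fun z _ => (h.contDiff_gradient.differentiable (by simp) z).hasFDerivAt.hasFDerivWithinAt)
    (fun z hz => by
      refine (h.2.2.2.2 z 0).trans ?_
      gcongr
      simpa using hz) (by simpa using norm_sub_single x j) (by simp)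
  have e : x - x0 = (x j) • EuclideanSpace.single j (1:ℝ) := by rw [hx0]; abel
  have hn : ‖x - x0‖ = |x j| := by rw [e, norm_smul]; simp
  rw [hn] at this
  have h2 : ⟪gradient φ x, EuclideanSpace.single j 1⟫ - curv φ j * x j =
      ⟪gradient φ x - gradient φ x0 - fderiv ℝ (gradient φ) 0 (x - x0), EuclideanSpace.single j 1⟫ := by
    rw [inner_sub_left, inner_sub_left, h0, e, map_smul, real_inner_smul_left, curv]; ring
  rw [h2]
  refine (abs_real_inner_le_norm _ _).trans ?_
  simpa using this

theorem abs_inner_gradient_single_le (h : C2Sigma c σ φ) {j : Fin m}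
    (he : ∀ p : E m, φ (flipCoord j p) = φ p) (x : E m) :
    |⟪gradient φ x, EuclideanSpace.single j 1⟫| ≤ c * |x j| := by
  set x0 := x - (x j) • EuclideanSpace.single j (1:ℝ) with hx0
  have h0 := h.inner_gradient_single_eq_zero he (x := x0) (by simp [hx0])
  have e : x - x0 = (x j) • EuclideanSpace.single j (1:ℝ) := by rw [hx0]; abel
  have hn : ‖x - x0‖ = |x j| := by rw [e, norm_smul]; simp
  have h2 : ⟪gradient φ x, EuclideanSpace.single j 1⟫ =
      ⟪gradient φ x - gradient φ x0, EuclideanSpace.single j 1⟫ := by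
    rw [inner_sub_left, h0, sub_zero]
  rw [h2, ← hn]
  refine (abs_real_inner_le_norm _ _).trans ?_
  simpa using h.lip x x0

theorem curv_neg (φ : E m → ℝ) (j : Fin m) : curv (fun x => - φ x) j = - curv φ j := by
  have e : gradient (fun x => - φ x) = fun p => - gradient φ p := by
    funext p
    rw [gradient, show (fun x => - φ x) = - φ from rfl, fderiv_neg, map_neg]; rfl
  rw [curv, curv, e, show (fun p => - gradient φ p) = - gradient φ from rfl, fderiv_neg]
  simp

theorem abs_two_mul_single_le (h : C2Sigma c σ φ) (hc : 0 ≤ c) (hσ : 0 < σ) (h0 : φ 0 = 0)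
    (h1 : gradient φ 0 = 0) {j : Fin m} (he : ∀ p : E m, φ (flipCoord j p) = φ p) {t : ℝ}
    (ht : 0 < t) :
    |2 * φ (EuclideanSpace.single j t) - curv φ j * t ^ 2| ≤ 2 * c * t ^ (2 + σ) := by
  have e1 := h.abs_inner_sub_le hc hσ h0 h1 (EuclideanSpace.single j t)
  have e2 := h.abs_inner_gradient_single_sub_le hc hσ he (EuclideanSpace.single j t)
  have e3 : EuclideanSpace.single j t = t • (EuclideanSpace.single j (1:ℝ) : E m) := by
    ext i; by_cases hi : i = j <;> simp [hi]
  have e4 : ⟪(EuclideanSpace.single j t : E m), gradient φ (EuclideanSpace.single j t)⟫ =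
      t * ⟪gradient φ (EuclideanSpace.single j t), (EuclideanSpace.single j 1 : E m)⟫ := by
    rw [real_inner_comm]
    conv_lhs => rw [e3, real_inner_smul_right, ← e3]
  rw [e4] at e1
  simp only [PiLp.norm_single, Real.norm_eq_abs, abs_of_pos ht, PiLp.single_apply,
    if_true] at e1 e2
  set d := ⟪gradient φ (EuclideanSpace.single j t), (EuclideanSpace.single j 1 : E m)⟫
  have e5 : t ^ (2 + σ) = t ^ σ * t * t := by
    rw [add_comm, Real.rpow_add ht, Real.rpow_two]; ring
  have e6 : |t * d - curv φ j * t ^ 2| ≤ c * t ^ (2 + σ) := by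
    rw [show t * d - curv φ j * t ^ 2 = t * (d - curv φ j * t) by ring, abs_mul, abs_of_pos ht, e5]
    nlinarith
  rw [_root_.abs_le] at *
  constructor <;> linarith

end C2Sigma

theorem NeckData.curv_sub {m : ℕ} {γ μ K c σ R0 ε : ℝ} {f g : E m → ℝ} {j : Fin m}
    {u : E (m+1) → ℝ} (D : NeckData γ μ K c σ R0 ε f g j u) :
    C2Sigma.curv f j - C2Sigma.curv g j = 2 * μ := by
  have hσ := D.hσ.1
  have key : ∀ t : ℝ, 0 < t → t < R0 →
      |C2Sigma.curv f j - C2Sigma.curv g j - 2 * μ| ≤ (4 * c + 2 * K) * t ^ σ := by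
    intro t ht htR
    have e1 := D.hf.abs_two_mul_single_le D.hc.le hσ D.f0 D.df0 D.ef ht
    have e2 := D.hg.abs_two_mul_single_le D.hc.le hσ D.g0 D.dg0 D.eg ht
    have e3 := D.hfg (EuclideanSpace.single j t) (by simpa [abs_of_pos ht] using htR)
    simp only [PiLp.norm_single, Real.norm_eq_abs, abs_of_pos ht] at e3
    have e5 : t ^ (2 + σ) = t ^ σ * t ^ 2 := by
      rw [add_comm, Real.rpow_add ht, Real.rpow_two]
    have : |C2Sigma.curv f j - C2Sigma.curv g j - 2 * μ| * t ^ 2 ≤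
        (4 * c + 2 * K) * t ^ σ * t ^ 2 := by
      rw [← abs_of_pos (show 0 < t ^ 2 by positivity), ← abs_mul, abs_of_pos (show 0 < t ^ 2 by positivity)]
      rw [e5] at e1 e2 e3
      rw [abs_le] at *
      constructor <;> nlinarith
    exact le_of_mul_le_mul_right this (by positivity)
  have hlim : Filter.Tendsto (fun t : ℝ => (4 * c + 2 * K) * t ^ σ) (nhdsWithin 0 (Ioi 0))
      (nhds 0) := by
    have : Continuous fun t : ℝ => (4 * c + 2 * K) * t ^ σ :=
      continuous_const.mul (Real.continuous_rpow_const hσ.le)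
    have := this.tendsto 0
    simp only [Real.zero_rpow hσ.ne', mul_zero] at this
    exact this.mono_left nhdsWithin_le_nhds
  have h0 : |C2Sigma.curv f j - C2Sigma.curv g j - 2 * μ| ≤ 0 := by
    refine ge_of_tendsto hlim ?_
    filter_upwards [Ioo_mem_nhdsGT D.hR0] with t ht using key t ht.1 ht.2
  linarith [abs_nonpos_iff.1 h0]

theorem HasLap.barrier {n : ℕ} {X R z y : E n → ℝ} {x e dR dz n0 : E n} {lR lz c : ℝ}
    {A A1 B B1 : ℝ → ℝ} {A2 B2 : ℝ}
    (hX : HasLap X x e 0) (hR : HasLap R x dR lR) (hz : HasLap z x dz lz) (hy : HasLap y x n0 0)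
    (hA : ContDiffAt ℝ 2 A (R x)) (hA1 : ∀ᶠ s in nhds (R x), HasDerivAt A (A1 s) s)
    (hA2 : HasDerivAt A1 A2 (R x)) (hB : ContDiffAt ℝ 2 B (R x))
    (hB1 : ∀ᶠ s in nhds (R x), HasDerivAt B (B1 s) s) (hB2 : HasDerivAt B1 B2 (R x)) :
    HasLap (fun p => X p * ((1 + c * y p) * A (R p) + B (R p) * (z p * z p))) x
      (((1 + c * y x) * A (R x) + B (R x) * z x ^ 2) • e +
        X x • (((1 + c * y x) * A1 (R x) + B1 (R x) * z x ^ 2) • dR + (c * A (R x)) • n0 +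
          (B (R x) * (2 * z x)) • dz))
      (X x * ((1 + c * y x) * (A2 * ‖dR‖ ^ 2 + A1 (R x) * lR) + 2 * c * A1 (R x) * ⟪n0, dR⟫ +
        B (R x) * (2 * z x * lz + 2 * ‖dz‖ ^ 2) + z x ^ 2 * (B2 * ‖dR‖ ^ 2 + B1 (R x) * lR) +
        4 * B1 (R x) * z x * ⟪dR, dz⟫) +
        2 * ((1 + c * y x) * A1 (R x) * ⟪e, dR⟫ + c * A (R x) * ⟪e, n0⟫ +
          B1 (R x) * z x ^ 2 * ⟪e, dR⟫ + 2 * B (R x) * z x * ⟪e, dz⟫)) := by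
  have h1 := ((HasLap.const 1).add (hy.const_mul c)).mul (hR.comp hA hA1 hA2)
  have h2 := (hR.comp hB hB1 hB2).mul (hz.mul hz)
  refine (hX.mul (h1.add h2)).congr ?_ ?_
  · module
  · simp only [inner_add_right, inner_smul_right, inner_smul_left, inner_add_left,
      real_inner_self_eq_norm_sq, inner_zero_left, inner_zero_right]
    simp
    ring

/-- Radial profile of the barrier. -/
def barA (β τ r : ℝ) : ℝ := r ^ β - r ^ (β + τ)

/-- Derivative of `barA`. -/
def barA1 (β τ r : ℝ) : ℝ := β * r ^ (β - 1) - (β + τ) * r ^ (β + τ - 1)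

/-- Second derivative of `barA`. -/
def barA2 (β τ r : ℝ) : ℝ :=
  β * ((β - 1) * r ^ (β - 1 - 1)) - (β + τ) * ((β + τ - 1) * r ^ (β + τ - 1 - 1))

/-- Coefficient of the quadratic vertical correction of the barrier. -/
def barB (β τ l ν e r : ℝ) : ℝ :=
  l * r ^ (β - 1) - 2 * β * e * r ^ (β - 1 - 1) + (ν - l) * r ^ (β + τ - 1) +
    2 * (β + τ) * e * r ^ (β + τ - 1 - 1)

/-- Derivative of `barB`. -/
def barB1 (β τ l ν e r : ℝ) : ℝ :=
  l * ((β - 1) * r ^ (β - 1 - 1)) - 2 * β * e * ((β - 1 - 1) * r ^ (β - 1 - 1 - 1)) +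
    (ν - l) * ((β + τ - 1) * r ^ (β + τ - 1 - 1)) +
    2 * (β + τ) * e * ((β + τ - 1 - 1) * r ^ (β + τ - 1 - 1 - 1))

/-- Second derivative of `barB`. -/
def barB2 (β τ l ν e r : ℝ) : ℝ :=
  l * ((β - 1) * ((β - 1 - 1) * r ^ (β - 1 - 1 - 1))) -
    2 * β * e * ((β - 1 - 1) * ((β - 1 - 1 - 1) * r ^ (β - 1 - 1 - 1 - 1))) +
    (ν - l) * ((β + τ - 1) * ((β + τ - 1 - 1) * r ^ (β + τ - 1 - 1 - 1))) +
    2 * (β + τ) * e * ((β + τ - 1 - 1) * ((β + τ - 1 - 1 - 1) * r ^ (β + τ - 1 - 1 - 1 - 1)))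

section Profile

variable {β τ l ν e r : ℝ}

theorem contDiffAt_barA (hr : 0 < r) : ContDiffAt ℝ 2 (barA β τ) r :=
  (Real.contDiffAt_rpow_const_of_ne hr.ne').sub (Real.contDiffAt_rpow_const_of_ne hr.ne')

theorem contDiffAt_barB (hr : 0 < r) : ContDiffAt ℝ 2 (barB β τ l ν e) r := by
  have h : ∀ p : ℝ, ContDiffAt ℝ 2 (fun x : ℝ => x ^ p) r := fun p =>
    Real.contDiffAt_rpow_const_of_ne hr.ne'
  exact (((contDiffAt_const.mul (h _)).sub (contDiffAt_const.mul (h _))).add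
    (contDiffAt_const.mul (h _))).add (contDiffAt_const.mul (h _))

theorem hasDerivAt_barA (hr : 0 < r) : HasDerivAt (barA β τ) (barA1 β τ r) r :=
  (Real.hasDerivAt_rpow_const (Or.inl hr.ne')).sub (Real.hasDerivAt_rpow_const (Or.inl hr.ne'))

theorem hasDerivAt_barA1 (hr : 0 < r) : HasDerivAt (barA1 β τ) (barA2 β τ r) r :=
  ((Real.hasDerivAt_rpow_const (Or.inl hr.ne')).const_mul _).sub
    ((Real.hasDerivAt_rpow_const (Or.inl hr.ne')).const_mul _)

theorem hasDerivAt_barB (hr : 0 < r) : HasDerivAt (barB β τ l ν e) (barB1 β τ l ν e r) r := by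
  have h : ∀ p : ℝ, HasDerivAt (fun x : ℝ => x ^ p) (p * r ^ (p - 1)) r := fun p =>
    Real.hasDerivAt_rpow_const (Or.inl hr.ne')
  exact ((((h _).const_mul _).sub ((h _).const_mul _)).add ((h _).const_mul _)).add
    ((h _).const_mul _)

theorem hasDerivAt_barB1 (hr : 0 < r) : HasDerivAt (barB1 β τ l ν e) (barB2 β τ l ν e r) r := by
  have h : ∀ p : ℝ, HasDerivAt (fun x : ℝ => x ^ p) (p * r ^ (p - 1)) r := fun p =>
    Real.hasDerivAt_rpow_const (Or.inl hr.ne')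
  exact (((((h _).const_mul _).const_mul _).sub (((h _).const_mul _).const_mul _)).add
    (((h _).const_mul _).const_mul _)).add (((h _).const_mul _).const_mul _)

theorem barA_eq (hr : 0 < r) : barA β τ r = r ^ (β - 1) * (r * (1 - r ^ τ)) := by
  rw [barA, Real.rpow_add hr, Real.rpow_sub_one hr.ne']; field_simp

theorem barA1_eq (hr : 0 < r) : barA1 β τ r = r ^ (β - 1) * (β - (β + τ) * r ^ τ) := by
  rw [barA1, show β + τ - 1 = (β - 1) + τ by ring, Real.rpow_add hr]; ring

theorem barA2_eq (hr : 0 < r) : barA2 β τ r =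
    r ^ (β - 1) * ((β * (β - 1) - (β + τ) * (β + τ - 1) * r ^ τ) / r) := by
  rw [barA2, show β + τ - 1 - 1 = (β - 1) + τ - 1 by ring, Real.rpow_sub_one hr.ne' (β - 1),
    Real.rpow_sub_one hr.ne' (β - 1 + τ), Real.rpow_add hr]; ring

theorem barB_eq (hr : 0 < r) : barB β τ l ν e r = r ^ (β - 1) *
    (l - 2 * β * (e / r) + (ν - l) * r ^ τ + 2 * (β + τ) * (e / r) * r ^ τ) := by
  rw [barB, show β + τ - 1 = (β - 1) + τ by ring, Real.rpow_sub_one hr.ne' (β - 1),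
    Real.rpow_sub_one hr.ne' (β - 1 + τ), Real.rpow_add hr]; ring

theorem barB1_eq (hr : 0 < r) : barB1 β τ l ν e r = r ^ (β - 1) *
    ((l * (β - 1) - 2 * β * (e / r) * (β - 2) + (ν - l) * (β + τ - 1) * r ^ τ +
      2 * (β + τ) * (e / r) * (β + τ - 2) * r ^ τ) / r) := by
  rw [barB1, show β + τ - 1 = (β - 1) + τ by ring]
  simp only [Real.rpow_sub_one hr.ne' (β - 1), Real.rpow_sub_one hr.ne' (β - 1 - 1),
    Real.rpow_sub_one hr.ne' (β - 1 + τ), Real.rpow_sub_one hr.ne' (β - 1 + τ - 1),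
    Real.rpow_add hr]
  ring

theorem barB2_eq (hr : 0 < r) : barB2 β τ l ν e r = r ^ (β - 1) *
    ((l * (β - 1) * (β - 2) - 2 * β * (e / r) * (β - 2) * (β - 3) +
      (ν - l) * (β + τ - 1) * (β + τ - 2) * r ^ τ +
      2 * (β + τ) * (e / r) * (β + τ - 2) * (β + τ - 3) * r ^ τ) / r ^ 2) := by
  rw [barB2, show β + τ - 1 = (β - 1) + τ by ring]
  simp only [Real.rpow_sub_one hr.ne' (β - 1), Real.rpow_sub_one hr.ne' (β - 1 - 1),
    Real.rpow_sub_one hr.ne' (β - 1 - 1 - 1), Real.rpow_sub_one hr.ne' (β - 1 + τ - 1 - 1),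
    Real.rpow_sub_one hr.ne' (β - 1 + τ), Real.rpow_sub_one hr.ne' (β - 1 + τ - 1),
    Real.rpow_add hr]
  ring

end Profile

theorem exists_bound_on_box {k : ℕ} {f : (Fin k → ℝ) → ℝ} (hf : Continuous f) (Q : ℝ) :
    ∃ C, 0 < C ∧ ∀ v, (∀ i, |v i| ≤ Q) → |f v| ≤ C := by
  obtain ⟨C, hC⟩ := (isCompact_univ_pi fun _ : Fin k => isCompact_Icc (a := -Q) (b := Q)).exists_bound_of_continuousOn
    hf.continuousOn
  refine ⟨max C 1, by positivity, fun v hv => le_max_of_le_left (hC v ?_)⟩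
  exact mem_univ_pi.2 fun i => abs_le.1 (hv i)

theorem exists_eq_mul_of_abs_le {a Q r : ℝ} (hr : 0 < r) (h : |a| ≤ Q * r) :
    ∃ b, |b| ≤ Q ∧ a = r * b :=
  ⟨a / r, by rwa [abs_div, abs_of_pos hr, div_le_iff₀ hr], by field_simp⟩

theorem eventually_mul_rpow_lt (C : ℝ) {p η : ℝ} (hp : 0 < p) (hη : 0 < η) :
    ∀ᶠ r : ℝ in nhdsWithin 0 (Ioi 0), C * r ^ p < η := by
  have : Continuous fun t : ℝ => C * t ^ p :=
    continuous_const.mul (Real.continuous_rpow_const hp.le)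
  have := this.tendsto 0
  simp only [Real.zero_rpow hp.ne', mul_zero] at this
  exact (this.mono_left nhdsWithin_le_nhds).eventually (gt_mem_nhds hη)

section Numeric

variable {β τ l Q : ℝ}

theorem barrier_interior_neg {m : ℕ} (hm : 1 ≤ m) (hβ : -(1 / 2) ≤ β) (hβ0 : β ≤ 0) (hτ : 0 < τ)
    (hτ1 : τ < 1) (hl : 4 * β + 2 * m * β + 4 * β ^ 2 + 2 * l ≤ 0) :
    ∀ᶠ r : ℝ in nhdsWithin 0 (Ioi 0), ∀ e, 0 ≤ e → e ≤ r → ∀ X c y z ζ d lz zj : ℝ, 0 < X →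
      |c| ≤ Q → |y| ≤ Q * r → |z| ≤ Q * r → |ζ| ≤ Q * r → |d| ≤ Q * r → |lz| ≤ Q →
      |zj| ≤ Q * X →
      X * ((1 + c * y) * (barA2 β τ r * (4 * (r - e) + 8 * y ^ 2) + barA1 β τ r * (2 * m + 4)) +
        2 * c * barA1 β τ r * (4 * y) +
        barB β τ l (m * τ / 2) e r * (2 * z * lz + 2 * (1 + d)) +
        z ^ 2 * (barB2 β τ l (m * τ / 2) e r * (4 * (r - e) + 8 * y ^ 2) +
          barB1 β τ l (m * τ / 2) e r * (2 * m + 4)) +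
        4 * barB1 β τ l (m * τ / 2) e r * z * ζ) +
        2 * ((1 + c * y) * barA1 β τ r * (2 * X) + c * barA β τ r * 0 +
          barB1 β τ l (m * τ / 2) e r * z ^ 2 * (2 * X) +
          2 * barB β τ l (m * τ / 2) e r * z * zj) < 0 := by
  obtain ⟨C, hC, hE⟩ := exists_bound_on_box (k := 10) (f := fun v =>
      let a1 := β - (β + τ) * v 1
      let a2 := β * (β - 1) - (β + τ) * (β + τ - 1) * v 1
      let b := l - 2 * β * v 2 + (m * τ / 2 - l) * v 1 + 2 * (β + τ) * v 2 * v 1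
      let b1 := l * (β - 1) - 2 * β * v 2 * (β - 2) + (m * τ / 2 - l) * (β + τ - 1) * v 1 +
        2 * (β + τ) * v 2 * (β + τ - 2) * v 1
      let b2 := l * (β - 1) * (β - 2) - 2 * β * v 2 * (β - 2) * (β - 3) +
        (m * τ / 2 - l) * (β + τ - 1) * (β + τ - 2) * v 1 +
        2 * (β + τ) * v 2 * (β + τ - 2) * (β + τ - 3) * v 1
      v 3 * v 4 * (a1 * (2 * m + 4) + a2 * (4 * (1 - v 2) + 8 * v 0 * v 4 ^ 2)) +
        8 * a2 * v 4 ^ 2 + 8 * v 3 * a1 * v 4 + 2 * b * v 5 * v 9 + 2 * b * v 7 +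
        4 * b1 * v 5 * v 6 +
        v 5 ^ 2 * (b1 * (2 * m + 4) + b2 * (4 * (1 - v 2) + 8 * v 0 * v 4 ^ 2)) +
        4 * v 3 * v 4 * a1 + 4 * b1 * v 5 ^ 2 + 4 * b * v 5 * v 8) (by fun_prop) (max Q 1)
  have hmτ : 0 < m * τ := by
    have : (0:ℝ) < m := by exact_mod_cast hm
    positivity
  filter_upwards [eventually_mul_rpow_lt C (p := 1 - τ) (by linarith) hmτ,
    Ioo_mem_nhdsGT (show (0:ℝ) < 1 by norm_num)] with r hr1 hr
  obtain ⟨hr0, hr01⟩ := hr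
  intro e he her X c y z ζ d lz zj hX hc hy hz hζ hd hlz hzj
  obtain ⟨ξ, hξ, rfl⟩ := exists_eq_mul_of_abs_le hr0 hy
  obtain ⟨η, hη, rfl⟩ := exists_eq_mul_of_abs_le hr0 hz
  obtain ⟨ω, hω, rfl⟩ := exists_eq_mul_of_abs_le hr0 hζ
  obtain ⟨δ, hδ, rfl⟩ := exists_eq_mul_of_abs_le hr0 hd
  obtain ⟨κ, hκ, rfl⟩ := exists_eq_mul_of_abs_le hX hzj
  obtain ⟨θ, hθ⟩ : ∃ θ, θ = e / r := ⟨_, rfl⟩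
  have hθ0 : 0 ≤ θ := by rw [hθ]; positivity
  have hθ1 : θ ≤ 1 := by rw [hθ, div_le_one hr0]; exact her
  have he' : e = r * θ := by rw [hθ]; field_simp
  have hρ0 : 0 < r ^ (β - 1) := Real.rpow_pos_of_pos hr0 _
  have hT0 : 0 < r ^ τ := Real.rpow_pos_of_pos hr0 _
  have hT1 : r ^ τ ≤ 1 := Real.rpow_le_one hr0.le hr01.le hτ.le
  have hrT : C * r < m * τ * r ^ τ := by
    calc C * r = C * r ^ (1 - τ) * r ^ τ := by
          rw [mul_assoc, ← Real.rpow_add hr0]; simp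
      _ < _ := by gcongr
  have hEv := hE ![r, r ^ τ, θ, c, ξ, η, ω, δ, κ, lz] (by
    have hQ := le_max_left Q 1
    have h1 := le_max_right Q 1
    intro i
    fin_cases i
    · exact (abs_of_pos hr0).le.trans (hr01.le.trans h1)
    · exact (abs_of_pos hT0).le.trans (hT1.trans h1)
    · exact (abs_of_nonneg hθ0).le.trans (hθ1.trans h1)
    · exact hc.trans hQ
    · exact hξ.trans hQ
    · exact hη.trans hQ
    · exact hω.trans hQ
    · exact hδ.trans hQ
    · exact hκ.trans hQ
    · exact hlz.trans hQ)
  rw [barB2_eq hr0, barB1_eq hr0, barB_eq hr0, barA2_eq hr0, barA1_eq hr0, barA_eq hr0, ← hθ, he']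
  generalize r ^ (β - 1) = ρ at *
  generalize r ^ τ = T at *
  simp only [Matrix.cons_val] at hEv
  generalize hS : c * ξ * ((β - (β + τ) * T) * (2 * m + 4) +
    (β * (β - 1) - (β + τ) * (β + τ - 1) * T) * (4 * (1 - θ) + 8 * r * ξ ^ 2)) + _ + _ + _ + _ + _ +
      _ + _ + _ + _ = S at hEv
  have hmain : (β - (β + τ) * T) * (2 * m + 8) +
      4 * (1 - θ) * (β * (β - 1) - (β + τ) * (β + τ - 1) * T) +
      2 * (l - 2 * β * θ + (m * τ / 2 - l) * T + 2 * (β + τ) * θ * T) ≤ - (m * τ * T) := by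
    have e1 : (β - (β + τ) * T) * (2 * m + 8) +
      4 * (1 - θ) * (β * (β - 1) - (β + τ) * (β + τ - 1) * T) +
      2 * (l - 2 * β * θ + (m * τ / 2 - l) * T + 2 * (β + τ) * θ * T) + m * τ * T =
      (1 - T) * ((4 * β + 2 * m * β + 4 * β ^ 2 + 2 * l) - 4 * β ^ 2 * θ) -
        4 * T * (τ * (1 + 2 * β) + τ ^ 2 * (1 - θ) + 2 * (-β) * τ * θ) := by ring
    have e2 : 0 ≤ (1 - T) * (4 * β ^ 2 * θ - (4 * β + 2 * m * β + 4 * β ^ 2 + 2 * l)) := by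
      have : 0 ≤ 4 * β ^ 2 * θ := by positivity
      exact mul_nonneg (by linarith) (by linarith)
    have e3 : 0 ≤ 4 * T * (τ * (1 + 2 * β) + τ ^ 2 * (1 - θ) + 2 * (-β) * τ * θ) := by
      have i1 : 0 ≤ 1 + 2 * β := by linarith
      have i2 : 0 ≤ 1 - θ := by linarith
      have i3 : 0 ≤ -β := by linarith
      positivity
    linarith
  have hfin : (β - (β + τ) * T) * (2 * m + 8) +
      4 * (1 - θ) * (β * (β - 1) - (β + τ) * (β + τ - 1) * T) +
      2 * (l - 2 * β * θ + (m * τ / 2 - l) * T + 2 * (β + τ) * θ * T) + r * S < 0 := by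
    have := (abs_le.1 hEv).2
    have : r * S ≤ C * r := by rw [mul_comm C]; gcongr
    linarith
  have hneg := mul_neg_of_pos_of_neg (mul_pos hX hρ0) hfin
  refine lt_of_eq_of_lt ?_ hneg
  rw [← hS]
  field_simp
  ring

theorem barrier_boundary_identity {μ X ρ r T a0 a1 b b1 θ c ξ η a k1 k2 k3 k4 κ q ν y : ℝ}
    (hr : r ≠ 0) (hκ : T ^ 2 * κ = r) (hy : y = (a - μ) * (ρ * (r * a0)))
    (hmain : a0 * (q - μ) + 2 * μ * θ * a1 + b * μ = μ * ν * T) :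
    X * ρ * r * T * (μ * ν + T * ((a0 * c * κ * ξ + κ * b * η ^ 2) *
          (-a + T ^ 2 * k2 + (1 + T ^ 2 * k4) * q) + a0 * (k2 + k4 * q) +
        (a1 * c * κ * ξ + κ * b1 * η ^ 2) * (2 * μ * θ + T ^ 2 * k1) + a1 * k1 + b * k3)) =
      (1 + T ^ 2 * k4) * q * (X * ((1 + c * (r * ξ)) * (ρ * (r * a0)) + ρ * b * (r * η) ^ 2)) +
        (((1 + c * (r * ξ)) * (ρ * (r * a0)) + ρ * b * (r * η) ^ 2) * (T ^ 2 * X * k2 - a * X) +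
        X * (((1 + c * (r * ξ)) * (ρ * a1) + ρ * (b1 / r) * (r * η) ^ 2) *
          (T ^ 2 * r * k1 + 2 * μ * (r * θ)) + y + ρ * b * (T ^ 2 * r * k3 + μ * r))) := by
  have hdiv : ρ * (b1 / r) * (r * η) ^ 2 = ρ * r * η ^ 2 * b1 := by field_simp
  rw [hdiv, hy]
  linear_combination (X * ρ * r * ((a0 * c * ξ + b * η ^ 2) *
      (-a + T ^ 2 * k2 + (1 + T ^ 2 * k4) * q) +
      (a1 * c * ξ + b1 * η ^ 2) * (2 * μ * θ + T ^ 2 * k1))) * hκ - X * ρ * r * hmain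

theorem add_mul_nonneg_of_bound {C T S w : ℝ} (hT : 0 ≤ T) (hS : -C ≤ S) (h : C * T ≤ w) :
    0 ≤ w + T * S := by
  nlinarith [mul_le_mul_of_nonneg_left hS hT]

set_option maxHeartbeats 1000000 in
theorem barrier_boundary_nonneg {μ γ σ ν : ℝ} (hμ : 0 < μ) (hγ : 0 < γ) (hσ : σ ∈ Ioo (0:ℝ) 1)
    (hν : 0 < ν) :
    ∀ᶠ r : ℝ in nhdsWithin 0 (Ioi 0), ∀ e, 0 ≤ e → e ≤ r → ∀ X c y z a s NX NR zN nn : ℝ, 0 ≤ X →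
      |c| ≤ Q → |y| ≤ Q * r → |z| ≤ Q * r → |a| ≤ Q → |NR - 2 * μ * e| ≤ Q * r ^ (1 + σ / 2) →
      |NX + a * X| ≤ Q * r ^ (σ / 2) * X → |zN - μ * r| ≤ Q * r ^ (1 + σ / 2) →
      |nn - 1| ≤ Q * r ^ (σ / 2) → c * s = a - μ →
      0 ≤ nn / γ * (X * ((1 + c * y) * barA β (σ / 4) r +
          barB β (σ / 4) (1 - 1 / (μ * γ)) ν e r * z ^ 2)) +
        (((1 + c * y) * barA β (σ / 4) r + barB β (σ / 4) (1 - 1 / (μ * γ)) ν e r * z ^ 2) * NX +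
        X * (((1 + c * y) * barA1 β (σ / 4) r +
          barB1 β (σ / 4) (1 - 1 / (μ * γ)) ν e r * z ^ 2) * NR +
          c * barA β (σ / 4) r * s + barB β (σ / 4) (1 - 1 / (μ * γ)) ν e r * zN)) := by
  set τ := σ / 4 with hτ
  have hτ0 : 0 < τ := by have := hσ.1; positivity
  set l := 1 - 1 / (μ * γ) with hl
  obtain ⟨C, hC, hE⟩ := exists_bound_on_box (k := 11) (f := fun v =>
      let a0 := 1 - v 0
      let a1 := β - (β + τ) * v 0
      let b := l - 2 * β * v 1 + (ν - l) * v 0 + 2 * (β + τ) * v 1 * v 0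
      let b1 := l * (β - 1) - 2 * β * v 1 * (β - 2) + (ν - l) * (β + τ - 1) * v 0 +
        2 * (β + τ) * v 1 * (β + τ - 2) * v 0
      (a0 * v 2 * v 10 * v 3 + v 10 * b * v 4 ^ 2) *
          (-v 5 + v 0 ^ 2 * v 7 + (1 + v 0 ^ 2 * v 9) * (1 / γ)) +
        a0 * (v 7 + v 9 * (1 / γ)) +
        (a1 * v 2 * v 10 * v 3 + v 10 * b1 * v 4 ^ 2) * (2 * μ * v 1 + v 0 ^ 2 * v 6) +
        a1 * v 6 + b * v 8) (by fun_prop) (max Q 1)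
  filter_upwards [eventually_mul_rpow_lt C hτ0 (mul_pos hμ hν),
    Ioo_mem_nhdsGT (show (0:ℝ) < 1 by norm_num)] with r hr1 hr
  obtain ⟨hr0, hr01⟩ := hr
  intro e he her X c y z a s NX NR zN nn hX hc hy hz ha hNR hNX hzN hnn hcs
  have hT0 : 0 < r ^ τ := Real.rpow_pos_of_pos hr0 _
  have hT1 : r ^ τ ≤ 1 := Real.rpow_le_one hr0.le hr01.le hτ0.le
  have hT2 : r ^ (σ / 2) = (r ^ τ) ^ 2 := by
    rw [pow_two, ← Real.rpow_add hr0]; congr 1; rw [hτ]; ring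
  have hT3 : r ^ (1 + σ / 2) = (r ^ τ) ^ 2 * r := by
    rw [Real.rpow_add hr0, hT2, Real.rpow_one, mul_comm]
  have hrT : r = (r ^ τ) ^ 2 * r ^ (1 - σ / 2) := by
    rw [← hT2, ← Real.rpow_add hr0]; simp
  have hκ0 : 0 < r ^ (1 - σ / 2) := Real.rpow_pos_of_pos hr0 _
  have hκ1 : r ^ (1 - σ / 2) ≤ 1 := Real.rpow_le_one hr0.le hr01.le (by linarith [hσ.2])
  have hρ0 : 0 < r ^ (β - 1) := Real.rpow_pos_of_pos hr0 _
  rcases hX.eq_or_lt with rfl | hX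
  · have : NX = 0 := by simpa using hNX
    rw [this]; simp
  obtain ⟨θ, hθ⟩ : ∃ θ, θ = e / r := ⟨_, rfl⟩
  have hθ0 : 0 ≤ θ := by rw [hθ]; positivity
  have hθ1 : θ ≤ 1 := by rw [hθ, div_le_one hr0]; exact her
  have he' : e = r * θ := by rw [hθ]; field_simp
  rw [barB1_eq hr0, barB_eq hr0, barA1_eq hr0, barA_eq hr0, ← hθ]
  rw [hT3] at hNR hzN
  rw [hT2] at hNX hnn
  generalize r ^ (β - 1) = ρ at *
  generalize r ^ τ = T at *
  generalize r ^ (1 - σ / 2) = κ at *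
  obtain ⟨ξ, hξ, rfl⟩ := exists_eq_mul_of_abs_le hr0 hy
  obtain ⟨η, hη, rfl⟩ := exists_eq_mul_of_abs_le hr0 hz
  obtain ⟨k1, hk1, e1⟩ := exists_eq_mul_of_abs_le (r := T ^ 2 * r) (by positivity) hNR
  obtain ⟨k2, hk2, e2⟩ := exists_eq_mul_of_abs_le (r := T ^ 2 * X) (Q := Q) (by positivity)
    (by rw [← mul_assoc]; exact hNX)
  obtain ⟨k3, hk3, e3⟩ := exists_eq_mul_of_abs_le (r := T ^ 2 * r) (by positivity) hzN
  obtain ⟨k4, hk4, e4⟩ := exists_eq_mul_of_abs_le (r := T ^ 2) (by positivity) hnn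
  have hEv := hE ![T, θ, c, ξ, η, a, k1, k2, k3, k4, κ] (by
    have hQ := le_max_left Q 1
    have h1 := le_max_right Q 1
    intro i
    fin_cases i
    · exact (abs_of_pos hT0).le.trans (hT1.trans h1)
    · exact (abs_of_nonneg hθ0).le.trans (hθ1.trans h1)
    · exact hc.trans hQ
    · exact hξ.trans hQ
    · exact hη.trans hQ
    · exact ha.trans hQ
    · exact hk1.trans hQ
    · exact hk2.trans hQ
    · exact hk3.trans hQ
    · exact hk4.trans hQ
    · exact (abs_of_pos hκ0).le.trans (hκ1.trans h1))
  simp only [Matrix.cons_val] at hEv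
  generalize hS : ((1 - T) * c * κ * ξ + _) * _ + _ + _ + _ + _ = S at hEv
  have hfin : 0 ≤ μ * ν + T * S := add_mul_nonneg_of_bound hT0.le (abs_le.1 hEv).1 hr1.le
  have hpos : 0 ≤ X * ρ * r * T * (μ * ν + T * S) := by positivity
  have n1 : NR = T ^ 2 * r * k1 + 2 * μ * (r * θ) := by rw [← he']; linarith only [e1]
  have n2 : NX = T ^ 2 * X * k2 - a * X := by linarith only [e2]
  have n3 : zN = T ^ 2 * r * k3 + μ * r := by linarith only [e3]
  have n4 : nn = 1 + T ^ 2 * k4 := by linarith only [e4]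
  have n5 : μ * l = μ - 1 / γ := by rw [hl]; field_simp
  have n6 : c * (ρ * (r * (1 - T))) * s = (a - μ) * (ρ * (r * (1 - T))) := by rw [← hcs]; ring
  have n7 : T ^ 2 * κ = r := hrT.symm
  refine hpos.trans_eq ?_
  rw [n1, n2, n3, n4, ← hS, div_eq_mul_one_div (1 + T ^ 2 * k4) γ]
  refine barrier_boundary_identity hr0.ne' n7 n6 ?_
  clear_value l τ
  linear_combination (1 - T) * n5

theorem barrier_size {ν : ℝ} (hτ : 0 < τ) :
    ∀ᶠ r : ℝ in nhdsWithin 0 (Ioi 0), ∀ e, 0 ≤ e → e ≤ r → ∀ c y z : ℝ,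
      |c| ≤ Q → |y| ≤ Q * r → |z| ≤ Q * r →
      1 / 4 * r ^ β ≤ (1 + c * y) * barA β τ r + barB β τ l ν e r * z ^ 2 ∧
        (1 + c * y) * barA β τ r + barB β τ l ν e r * z ^ 2 ≤ 2 * r ^ β := by
  obtain ⟨C, hC, hE⟩ := exists_bound_on_box (k := 5) (f := fun v =>
      v 2 * v 3 * (1 - v 0) + (l - 2 * β * v 1 + (ν - l) * v 0 + 2 * (β + τ) * v 1 * v 0) *
        v 4 ^ 2) (by fun_prop) (max Q 1)
  filter_upwards [eventually_mul_rpow_lt 1 hτ (show (0:ℝ) < 1 / 2 by norm_num),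
    eventually_mul_rpow_lt C one_pos (show (0:ℝ) < 1 / 4 by norm_num),
    Ioo_mem_nhdsGT (show (0:ℝ) < 1 by norm_num)] with r hr1 hr2 hr
  obtain ⟨hr0, hr01⟩ := hr
  intro e he her c y z hc hy hz
  have hT0 : 0 < r ^ τ := Real.rpow_pos_of_pos hr0 _
  have hρ0 : 0 < r ^ (β - 1) := Real.rpow_pos_of_pos hr0 _
  obtain ⟨θ, hθ⟩ : ∃ θ, θ = e / r := ⟨_, rfl⟩
  have hθ0 : 0 ≤ θ := by rw [hθ]; positivity
  have hθ1 : θ ≤ 1 := by rw [hθ, div_le_one hr0]; exact her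
  have hβr : r ^ β = r ^ (β - 1) * r := by rw [Real.rpow_sub_one hr0.ne']; field_simp
  rw [barB_eq hr0, barA_eq hr0, ← hθ, hβr]
  rw [Real.rpow_one] at hr2
  generalize r ^ (β - 1) = ρ at *
  generalize r ^ τ = T at *
  obtain ⟨ξ, hξ, rfl⟩ := exists_eq_mul_of_abs_le hr0 hy
  obtain ⟨η, hη, rfl⟩ := exists_eq_mul_of_abs_le hr0 hz
  have hEv := hE ![T, θ, c, ξ, η] (by
    have hQ := le_max_left Q 1
    have h1 := le_max_right Q 1
    intro i
    fin_cases i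
    · exact (abs_of_pos hT0).le.trans (by linarith)
    · exact (abs_of_nonneg hθ0).le.trans (hθ1.trans h1)
    · exact hc.trans hQ
    · exact hξ.trans hQ
    · exact hη.trans hQ)
  simp only [Matrix.cons_val] at hEv
  generalize hS : c * ξ * (1 - T) + _ = S at hEv
  have hY : (1 + c * (r * ξ)) * (ρ * (r * (1 - T))) +
      ρ * (l - 2 * β * θ + (ν - l) * T + 2 * (β + τ) * θ * T) * (r * η) ^ 2 =
      ρ * r * (1 - T + r * S) := by
    rw [← hS]; ring
  have hS1 := mul_le_mul_of_nonneg_left (abs_le.1 hEv).1 hr0.le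
  have hS2 := mul_le_mul_of_nonneg_left (abs_le.1 hEv).2 hr0.le
  have hρr : 0 < ρ * r := by positivity
  rw [hY]
  constructor
  · rw [mul_comm (1 / 4)]
    exact mul_le_mul_of_nonneg_left (by linarith) hρr.le
  · rw [mul_comm 2]
    exact mul_le_mul_of_nonneg_left (by linarith) hρr.le

end Numeric

/-- The squared distance to the origin, up to weights, regularised by the gap width. -/
def barR {m : ℕ} (μ ε : ℝ) (x : E (m+1)) : ℝ := ε / μ + ‖x‖ ^ 2 + lastC x * lastC x

/-- Height above the middle surface of the neck. -/
def barZ {m : ℕ} (s : ℝ) (φ ψ : E m → ℝ) (x : E (m+1)) : ℝ :=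
  lastC x - s * (φ (epre x) - ψ (epre x)) / 2

/-- Half the difference of the curvatures of the two sides of the neck. -/
def barC {m : ℕ} (s : ℝ) (φ ψ : E m → ℝ) (j : Fin m) : ℝ :=
  s * (C2Sigma.curv φ j - C2Sigma.curv ψ j) / 2

/-- The horizontal coordinate direction. -/
def hdir {m : ℕ} (j : Fin m) : E (m+1) := eglue (EuclideanSpace.single j 1) 0

/-- The comparison function. -/
def barrier {m : ℕ} (γ μ σ β ε s : ℝ) (φ ψ : E m → ℝ) (j : Fin m) (x : E (m+1)) : ℝ :=
  ⟪hdir j, x⟫ * ((1 + barC s φ ψ j * lastC x) * barA β (σ / 4) (barR μ ε x) +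
    barB β (σ / 4) (1 - 1 / (μ * γ)) (m * (σ / 4) / 2) (ε / μ) (barR μ ε x) *
      (barZ s φ ψ x * barZ s φ ψ x))

theorem inner_hdir {m : ℕ} (j : Fin m) (x : E (m+1)) : ⟪hdir j, x⟫ = epre x j := by
  simp [hdir, inner_eq_epre_lastC, EuclideanSpace.inner_single_left]

theorem hasLap_lastC {m : ℕ} (x : E (m+1)) : HasLap lastC x (eglue 0 1) 0 := by
  rw [show (lastC : E (m+1) → ℝ) = fun x => ⟪eglue 0 1, x⟫ from funext lastC_eq_inner]
  exact HasLap.inner _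

theorem norm_eglue_zero_one {m : ℕ} : ‖(eglue 0 1 : E (m+1))‖ ^ 2 = 1 := by
  rw [norm_sq_eq_epre_lastC]; simp

theorem hasLap_barR {m : ℕ} (μ ε : ℝ) (x : E (m+1)) :
    HasLap (barR μ ε) x ((2:ℝ) • x + (2 * lastC x) • eglue 0 1) (2 * m + 4) := by
  have h1 := HasLap.norm_sub_sq (x := x) (0 : E (m+1))
  simp only [sub_zero] at h1
  refine (((HasLap.const (ε / μ)).add h1).add ((hasLap_lastC x).mul (hasLap_lastC x))).congr ?_ ?_
  · module
  · rw [real_inner_self_eq_norm_sq, norm_eglue_zero_one]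
    push_cast
    ring

theorem norm_sq_gradient_barR {m : ℕ} (μ ε : ℝ) (x : E (m+1)) :
    ‖(2:ℝ) • x + (2 * lastC x) • (eglue 0 1 : E (m+1))‖ ^ 2 =
      4 * (barR μ ε x - ε / μ) + 8 * lastC x ^ 2 := by
  have h := norm_sq_eq_epre_lastC x
  rw [barR, norm_sq_eq_epre_lastC, epre_add, lastC_add, epre_smul, epre_smul, lastC_smul,
    lastC_smul, epre_eglue, lastC_eglue, h, smul_zero, add_zero, norm_smul]
  norm_num
  ring

theorem rpow_le_of_sq_le {a R σ : ℝ} (ha : 0 ≤ a) (hR : a ^ 2 ≤ R) (hσ : 0 < σ) :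
    a ^ σ ≤ R ^ (σ / 2) ∧ a ^ (2 + σ) ≤ R ^ (1 + σ / 2) := by
  have e : ∀ p : ℝ, 0 ≤ p → a ^ p ≤ R ^ (p / 2) := fun p hp => by
    have : a ^ p = (a ^ 2) ^ (p / 2) := by
      rw [← Real.rpow_natCast, ← Real.rpow_mul ha]; congr 1; push_cast; ring
    rw [this]
    exact Real.rpow_le_rpow (sq_nonneg _) hR (by positivity)
  refine ⟨e σ hσ.le, ?_⟩
  have := e (2 + σ) (by positivity)
  rwa [show (2 + σ) / 2 = 1 + σ / 2 by ring] at this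

theorem le_rpow_of_le_one {R p : ℝ} (hR0 : 0 < R) (hR : R ≤ 1) (hp : p ≤ 1) : R ≤ R ^ p := by
  simpa using Real.rpow_le_rpow_of_exponent_ge hR0 hR hp

/-- One side of the neck: the graph of `s φ`, the opposite side being the graph of `-s ψ`. -/
structure Side {m : ℕ} (μ K c σ R0 s : ℝ) (φ ψ : E m → ℝ) (j : Fin m) : Prop where
  hμ : 0 < μ
  hK : 0 < K
  hc : 0 < c
  hσ : σ ∈ Set.Ioo (0:ℝ) 1
  hs : s ^ 2 = 1
  hφ : C2Sigma c σ φ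
  hψ : C2Sigma c σ ψ
  φ0 : φ 0 = 0
  ψ0 : ψ 0 = 0
  dφ0 : gradient φ 0 = 0
  dψ0 : gradient ψ 0 = 0
  eφ : ∀ p : E m, φ (flipCoord j p) = φ p
  eψ : ∀ p : E m, ψ (flipCoord j p) = ψ p
  hsum : ∀ p : E m, ‖p‖ < R0 → |φ p + ψ p - μ * ‖p‖^2| ≤ K * ‖p‖ ^ ((2:ℝ) + σ)
  curv_add : C2Sigma.curv φ j + C2Sigma.curv ψ j = 2 * μ

/-- Bound for all the normalised error terms of the barrier. -/
def barQ (m : ℕ) (μ c K : ℝ) : ℝ :=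
  10 * (μ + c) + (m + 1) * c + c ^ 2 + K + 2 * μ * (μ + c) ^ 2 + (μ + 2 * c) * c ^ 2

theorem gradient_neg_fun {m : ℕ} (φ : E m → ℝ) (p : E m) :
    gradient (fun x => - φ x) p = - gradient φ p := by
  rw [gradient, show (fun x => - φ x) = - φ from rfl, fderiv_neg, map_neg]; rfl

theorem NeckData.side {m : ℕ} {γ μ K c σ R0 ε : ℝ} {f g : E m → ℝ} {j : Fin m} {u : E (m+1) → ℝ}
    (D : NeckData γ μ K c σ R0 ε f g j u) : Side μ K c σ R0 1 f (fun x => - g x) j where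
  hμ := D.hμ
  hK := D.hK
  hc := D.hc
  hσ := D.hσ
  hs := by norm_num
  hφ := D.hf
  hψ := D.hg.neg
  φ0 := D.f0
  ψ0 := by simp [D.g0]
  dφ0 := D.df0
  dψ0 := by rw [gradient_neg_fun, D.dg0, neg_zero]
  eφ := D.ef
  eψ := fun p => by rw [D.eg]
  hsum := fun p hp => by rw [← sub_eq_add_neg]; exact D.hfg p hp
  curv_add := by rw [C2Sigma.curv_neg, ← sub_eq_add_neg]; exact D.curv_sub

namespace Side

variable {m : ℕ} {γ μ K c σ R0 ε s β : ℝ} {φ ψ : E m → ℝ} {j : Fin m} {x : E (m+1)}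

theorem symm (S : Side μ K c σ R0 s φ ψ j) : Side μ K c σ R0 (-s) ψ φ j where
  hμ := S.hμ
  hK := S.hK
  hc := S.hc
  hσ := S.hσ
  hs := by rw [neg_sq]; exact S.hs
  hφ := S.hψ
  hψ := S.hφ
  φ0 := S.ψ0
  ψ0 := S.φ0
  dφ0 := S.dψ0
  dψ0 := S.dφ0
  eφ := S.eψ
  eψ := S.eφ
  hsum := fun p hp => by rw [add_comm (ψ p)]; exact S.hsum p hp
  curv_add := by rw [add_comm]; exact S.curv_add

theorem barrier_symm : barrier (m := m) γ μ σ β ε (-s) ψ φ j = barrier γ μ σ β ε s φ ψ j := by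
  have h1 : barZ (-s) ψ φ = barZ s φ ψ := by funext y; simp only [barZ]; ring
  have h2 : barC (-s) ψ φ j = barC s φ ψ j := by simp only [barC]; ring
  funext y
  simp only [barrier, h1, h2]

theorem abs_s (S : Side μ K c σ R0 s φ ψ j) : |s| = 1 := by
  rcases sq_eq_one_iff.1 S.hs with h | h <;> simp [h]

theorem barR_pos (S : Side μ K c σ R0 s φ ψ j) (hε : 0 < ε) (x : E (m+1)) : 0 < barR μ ε x := by
  have := S.hμ
  have : 0 < ε / μ := by positivity
  rw [barR]; nlinarith [sq_nonneg ‖x‖, mul_self_nonneg (lastC x)]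

theorem norm_sq_le (S : Side μ K c σ R0 s φ ψ j) (hε : 0 < ε) (x : E (m+1)) :
    ‖epre x‖ ^ 2 ≤ barR μ ε x ∧ ε ≤ μ * barR μ ε x := by
  have hμ := S.hμ
  have h0 : 0 < ε / μ := by positivity
  have h1 := norm_sq_eq_epre_lastC x
  have h3 : ε = μ * (ε / μ) := by field_simp
  constructor
  · rw [barR]; nlinarith [mul_self_nonneg (lastC x)]
  · rw [barR]
    nth_rw 1 [h3]
    gcongr
    nlinarith [sq_nonneg ‖x‖, mul_self_nonneg (lastC x)]

theorem abs_lastC_le (S : Side μ K c σ R0 s φ ψ j)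
    (hF : graphF ε s φ x ≤ 0) (hG : graphF ε (-s) ψ x ≤ 0) :
    |lastC x| ≤ ε / 2 + c * ‖epre x‖ ^ 2 := by
  have h1 := (abs_le.1 (S.hφ.abs_le S.hc.le S.φ0 S.dφ0 (epre x))).2
  have h2 := (abs_le.1 (S.hψ.abs_le S.hc.le S.ψ0 S.dψ0 (epre x))).2
  simp only [graphF] at hF hG
  have : |lastC x| = |s * lastC x| := by
    rw [abs_mul, S.abs_s,
      one_mul]
  rw [this, abs_le]
  constructor <;> linarith

theorem abs_barZ_le (S : Side μ K c σ R0 s φ ψ j)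
    (hF : graphF ε s φ x ≤ 0) (hG : graphF ε (-s) ψ x ≤ 0) :
    |barZ s φ ψ x| ≤ ε / 2 + c * ‖epre x‖ ^ 2 := by
  have h1 := (abs_le.1 (S.hφ.abs_le S.hc.le S.φ0 S.dφ0 (epre x))).2
  have h2 := (abs_le.1 (S.hψ.abs_le S.hc.le S.ψ0 S.dψ0 (epre x))).2
  simp only [graphF] at hF hG
  have hs := S.hs
  have e : s * barZ s φ ψ x = s * lastC x - (φ (epre x) - ψ (epre x)) / 2 := by
    rw [barZ]; linear_combination (-(φ (epre x) - ψ (epre x)) / 2) * hs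
  have : |barZ s φ ψ x| = |s * barZ s φ ψ x| := by
    rw [abs_mul, S.abs_s,
      one_mul]
  rw [this, e, abs_le]
  constructor <;> linarith

theorem half_add_le (S : Side μ K c σ R0 s φ ψ j) (hε : 0 < ε) (x : E (m+1)) :
    ε / 2 + c * ‖epre x‖ ^ 2 ≤ (μ + c) * barR μ ε x := by
  obtain ⟨h1, h2⟩ := S.norm_sq_le hε x
  have := mul_le_mul_of_nonneg_left h1 S.hc.le
  linarith

theorem abs_barC_le (S : Side μ K c σ R0 s φ ψ j) : |barC s φ ψ j| ≤ c := by
  have h1 := S.hφ.abs_curv_le j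
  have h2 := S.hψ.abs_curv_le j
  rw [barC, abs_div, abs_mul,
    S.abs_s, one_mul,
    abs_two]
  linarith [abs_sub (C2Sigma.curv φ j) (C2Sigma.curv ψ j)]

/-- The gradient of `barZ`. -/
def dbarZ (s : ℝ) (φ ψ : E m → ℝ) (x : E (m+1)) : E (m+1) :=
  eglue (-(s / 2) • (gradient φ (epre x) - gradient ψ (epre x))) 1

theorem hasLap_barZ (S : Side μ K c σ R0 s φ ψ j) (x : E (m+1)) :
    ∃ l, HasLap (barZ s φ ψ) x (dbarZ s φ ψ x) l ∧ |l| ≤ (m + 1) * c := by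
  obtain ⟨l1, h1, b1⟩ := (niceDefining_graphF (ε := 0) S.hφ S.hc.le S.hs).lap S.hc.le x
  obtain ⟨l2, h2, b2⟩ := (niceDefining_graphF (ε := 0) S.hψ S.hc.le S.symm.hs).lap S.hc.le x
  have h := ((h1.sub h2).const_mul (s / 2))
  rw [(hasGradientAt_graphF S.hφ x).gradient, (hasGradientAt_graphF S.hψ x).gradient] at h
  have e : (fun y => s / 2 * (graphF 0 s φ y - graphF 0 (-s) ψ y)) = barZ s φ ψ := by
    funext y
    simp only [graphF, barZ]
    linear_combination lastC y * S.hs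
  rw [e] at h
  refine ⟨s / 2 * (l1 - l2), h.congr ?_ rfl, ?_⟩
  · refine ext_epre_lastC ?_ ?_
    · rw [dbarZ, epre_smul, epre_sub, epre_eglue, epre_eglue, epre_eglue]; module
    · rw [dbarZ, lastC_smul, lastC_sub, lastC_eglue, lastC_eglue, lastC_eglue]
      linear_combination S.hs
  · rw [abs_mul, abs_div, S.abs_s, abs_two]
    push_cast at b1 b2
    linarith [abs_sub l1 l2]

theorem hasLap_barrier (S : Side μ K c σ R0 s φ ψ j) (hε : 0 < ε) {lz R y z C ν l e : ℝ}
    {N dR dZ : E (m+1)} (hl : HasLap (barZ s φ ψ) x dZ lz) (hR : R = barR μ ε x)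
    (hy : y = lastC x) (hz : z = barZ s φ ψ x) (hC : C = barC s φ ψ j)
    (hν : ν = m * (σ / 4) / 2) (hle : l = 1 - 1 / (μ * γ)) (he : e = ε / μ) (hN : N = eglue 0 1)
    (hdR : dR = (2:ℝ) • x + (2 * lastC x) • eglue 0 1) :
    HasLap (barrier γ μ σ β ε s φ ψ j) x
      (((1 + C * y) * barA β (σ / 4) R + barB β (σ / 4) l ν e R * z ^ 2) • hdir j +
        epre x j • (((1 + C * y) * barA1 β (σ / 4) R + barB1 β (σ / 4) l ν e R * z ^ 2) • dR +
          (C * barA β (σ / 4) R) • N + (barB β (σ / 4) l ν e R * (2 * z)) • dZ))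
      (epre x j * ((1 + C * y) * (barA2 β (σ / 4) R * ‖dR‖ ^ 2 +
          barA1 β (σ / 4) R * (2 * m + 4)) +
        2 * C * barA1 β (σ / 4) R * ⟪N, dR⟫ +
        barB β (σ / 4) l ν e R * (2 * z * lz + 2 * ‖dZ‖ ^ 2) +
        z ^ 2 * (barB2 β (σ / 4) l ν e R * ‖dR‖ ^ 2 +
          barB1 β (σ / 4) l ν e R * (2 * m + 4)) +
        4 * barB1 β (σ / 4) l ν e R * z * ⟪dR, dZ⟫) +
        2 * ((1 + C * y) * barA1 β (σ / 4) R * ⟪hdir j, dR⟫ +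
          C * barA β (σ / 4) R * ⟪hdir j, N⟫ +
          barB1 β (σ / 4) l ν e R * z ^ 2 * ⟪hdir j, dR⟫ +
          2 * barB β (σ / 4) l ν e R * z * ⟪hdir j, dZ⟫)) := by
  subst hR hy hz hC hν hle he hN hdR
  have := HasLap.barrier (c := barC s φ ψ j) (HasLap.inner (x := x) (hdir j)) (hasLap_barR μ ε x)
    hl (hasLap_lastC x) (contDiffAt_barA (β := β) (τ := σ / 4) (S.barR_pos hε x))
    (by filter_upwards [lt_mem_nhds (S.barR_pos hε x)] with r hr using hasDerivAt_barA hr)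
    (hasDerivAt_barA1 (S.barR_pos hε x))
    (contDiffAt_barB (β := β) (τ := σ / 4) (l := 1 - 1 / (μ * γ)) (ν := m * (σ / 4) / 2)
      (e := ε / μ) (S.barR_pos hε x))
    (by filter_upwards [lt_mem_nhds (S.barR_pos hε x)] with r hr using hasDerivAt_barB hr)
    (hasDerivAt_barB1 (S.barR_pos hε x))
  rw [inner_hdir] at this
  exact this

end Side

namespace Side

variable {m : ℕ} {γ μ K c σ R0 ε s β : ℝ} {φ ψ : E m → ℝ} {j : Fin m} {x : E (m+1)}

theorem barQ_ge (hμ : 0 < μ) (hK : 0 < K) (hc : 0 < c) :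
    10 * (μ + c) ≤ barQ m μ c K ∧ (m + 1) * c ≤ barQ m μ c K ∧ c ^ 2 ≤ barQ m μ c K ∧
      K + 2 * μ * (μ + c) ^ 2 + (μ + 2 * c) * c ^ 2 ≤ barQ m μ c K := by
  have h1 : 0 < 10 * (μ + c) := by positivity
  have h2 : 0 < (m + 1) * c := by positivity
  have h3 : 0 < c ^ 2 := by positivity
  have h4 : 0 < K + 2 * μ * (μ + c) ^ 2 + (μ + 2 * c) * c ^ 2 := by positivity
  rw [barQ]
  refine ⟨?_, ?_, ?_, ?_⟩ <;> linarith

theorem norm_half_sub_le (S : Side μ K c σ R0 s φ ψ j) (x : E m) :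
    ‖gradient φ x - gradient ψ x‖ ≤ 2 * (c * ‖x‖) := by
  have h1 := S.hφ.norm_gradient_le S.dφ0 x
  have h2 := S.hψ.norm_gradient_le S.dψ0 x
  linarith [norm_sub_le (gradient φ x) (gradient ψ x)]

theorem norm_sq_dbarZ (S : Side μ K c σ R0 s φ ψ j) (hε : 0 < ε) (x : E (m+1)) :
    |‖dbarZ s φ ψ x‖ ^ 2 - 1| ≤ c ^ 2 * barR μ ε x := by
  have h1 := S.norm_half_sub_le (epre x)
  have h2 := (S.norm_sq_le hε x).1
  have e : ‖dbarZ s φ ψ x‖ ^ 2 - 1 = ‖gradient φ (epre x) - gradient ψ (epre x)‖ ^ 2 / 4 := by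
    rw [norm_sq_eq_epre_lastC, dbarZ, epre_eglue, lastC_eglue, norm_smul, norm_neg, norm_div,
      Real.norm_eq_abs, S.abs_s]
    norm_num
    ring
  rw [e, abs_of_nonneg (by positivity)]
  have h3 : ‖gradient φ (epre x) - gradient ψ (epre x)‖ ^ 2 ≤ (2 * (c * ‖epre x‖)) ^ 2 := by
    gcongr
  have h4 := mul_le_mul_of_nonneg_left h2 (sq_nonneg c)
  nlinarith

theorem abs_inner_dbarR_dbarZ (S : Side μ K c σ R0 s φ ψ j) (hε : 0 < ε)
    (hF : graphF ε s φ x ≤ 0) (hG : graphF ε (-s) ψ x ≤ 0) :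
    |⟪(2:ℝ) • x + (2 * lastC x) • (eglue 0 1 : E (m+1)), dbarZ s φ ψ x⟫| ≤
      10 * (μ + c) * barR μ ε x := by
  have h1 := S.norm_half_sub_le (epre x)
  have h2 := (S.norm_sq_le hε x).1
  have h3 := (S.abs_lastC_le hF hG).trans (S.half_add_le hε x)
  have e : ⟪(2:ℝ) • x + (2 * lastC x) • (eglue 0 1 : E (m+1)), dbarZ s φ ψ x⟫ =
      - s * ⟪epre x, gradient φ (epre x) - gradient ψ (epre x)⟫ + 4 * lastC x := by
    rw [inner_eq_epre_lastC, dbarZ, epre_eglue, lastC_eglue, epre_add, lastC_add, epre_smul,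
      epre_smul, lastC_smul, lastC_smul, epre_eglue, lastC_eglue, smul_zero, add_zero,
      real_inner_smul_left, real_inner_smul_right]
    ring
  have h4 : |⟪epre x, gradient φ (epre x) - gradient ψ (epre x)⟫| ≤ 2 * c * barR μ ε x := by
    refine (abs_real_inner_le_norm _ _).trans ?_
    have := mul_le_mul_of_nonneg_left h1 (norm_nonneg (epre x))
    have := mul_le_mul_of_nonneg_left h2 S.hc.le
    nlinarith
  have hR := S.barR_pos hε x
  have : 0 < μ * barR μ ε x := mul_pos S.hμ hR
  have : 0 < c * barR μ ε x := mul_pos S.hc hR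
  rw [e]
  refine (abs_add_le _ _).trans ?_
  rw [abs_mul, abs_neg, S.abs_s, one_mul, abs_mul, show |(4:ℝ)| = 4 by norm_num]
  linarith

theorem abs_inner_hdir_dbarZ (S : Side μ K c σ R0 s φ ψ j) (x : E (m+1)) :
    |⟪hdir j, dbarZ s φ ψ x⟫| ≤ c * |epre x j| := by
  have h1 := S.hφ.abs_inner_gradient_single_le S.eφ (epre x)
  have h2 := S.hψ.abs_inner_gradient_single_le S.eψ (epre x)
  have e : ⟪hdir j, dbarZ s φ ψ x⟫ = - (s / 2) * (⟪gradient φ (epre x), EuclideanSpace.single j 1⟫ -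
      ⟪gradient ψ (epre x), EuclideanSpace.single j 1⟫) := by
    rw [real_inner_comm, inner_eq_epre_lastC, dbarZ, hdir, epre_eglue, lastC_eglue, epre_eglue,
      lastC_eglue, real_inner_smul_left, inner_sub_left]
    ring
  rw [e, abs_mul, abs_neg, abs_div, S.abs_s, abs_two]
  linarith [abs_sub ⟪gradient φ (epre x), EuclideanSpace.single j (1:ℝ)⟫
    ⟪gradient ψ (epre x), EuclideanSpace.single j (1:ℝ)⟫]

theorem inner_hdir_dbarR (x : E (m+1)) (j : Fin m) :
    ⟪hdir j, (2:ℝ) • x + (2 * lastC x) • (eglue 0 1 : E (m+1))⟫ = 2 * epre x j := by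
  rw [inner_hdir, epre_add, epre_smul, epre_smul, epre_eglue]
  simp

theorem inner_vert_dbarR (x : E (m+1)) :
    ⟪(eglue 0 1 : E (m+1)), (2:ℝ) • x + (2 * lastC x) • (eglue 0 1 : E (m+1))⟫ = 4 * lastC x := by
  rw [← lastC_eq_inner, lastC_add, lastC_smul, lastC_smul, lastC_eglue]
  ring

/-- All the facts about the sides needed to treat the barrier inside the neck. -/
theorem common_bounds (S : Side μ K c σ R0 s φ ψ j) (hε : 0 < ε)
    (hF : graphF ε s φ x ≤ 0) (hG : graphF ε (-s) ψ x ≤ 0) :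
    |barC s φ ψ j| ≤ barQ m μ c K ∧ |lastC x| ≤ barQ m μ c K * barR μ ε x ∧
      |barZ s φ ψ x| ≤ barQ m μ c K * barR μ ε x := by
  obtain ⟨q1, q2, q3, q4⟩ := barQ_ge (m := m) S.hμ S.hK S.hc
  have hR := (S.barR_pos hε x).le
  have hμ := S.hμ
  have hc := S.hc
  have h := (S.half_add_le hε x).trans
    (mul_le_mul_of_nonneg_right (show μ + c ≤ barQ m μ c K by linarith) hR)
  exact ⟨S.abs_barC_le.trans (by linarith), (S.abs_lastC_le hF hG).trans h,
    (S.abs_barZ_le hF hG).trans h⟩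

theorem eventually_interior (hm : 1 ≤ m)
    (hβ : -(1 / 2) ≤ β) (hβ0 : β ≤ 0) (hσ : σ ∈ Set.Ioo (0:ℝ) 1)
    (hl : 4 * β + 2 * m * β + 4 * β ^ 2 + 2 * (1 - 1 / (μ * γ)) ≤ 0) :
    ∀ᶠ r : ℝ in nhdsWithin 0 (Ioi 0), ∀ {ε s : ℝ} {φ ψ : E m → ℝ} {j : Fin m} {x : E (m+1)},
      Side μ K c σ R0 s φ ψ j → 0 < ε → graphF ε s φ x ≤ 0 → graphF ε (-s) ψ x ≤ 0 →
      barR μ ε x = r → 0 < epre x j →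
      ∃ d l, HasLap (barrier γ μ σ β ε s φ ψ j) x d l ∧ l < 0 := by
  filter_upwards [barrier_interior_neg (Q := barQ m μ c K) hm hβ hβ0
    (τ := σ / 4) (by have := hσ.1; positivity) (by linarith [hσ.2]) hl] with r hr
  intro ε s φ ψ j x S hε hF hG hx hX
  obtain ⟨b1, b2, b3⟩ := S.common_bounds hε hF hG
  obtain ⟨q1, q2, q3, q4⟩ := barQ_ge (m := m) S.hμ S.hK S.hc
  obtain ⟨lz, hz, bz⟩ := S.hasLap_barZ x
  have hR := S.barR_pos hε x
  refine ⟨_, _, S.hasLap_barrier (γ := γ) (β := β) hε hz hx.symm rfl rfl rfl rfl rfl rfl rfl rfl,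
    ?_⟩
  have he : ε / μ ≤ r := by
    rw [← hx, barR]; nlinarith [sq_nonneg ‖x‖, mul_self_nonneg (lastC x)]
  rw [norm_sq_gradient_barR, inner_hdir_dbarR, inner_vert_dbarR, hx]
  rw [hx] at b2 b3 hR
  have hd : ‖dbarZ s φ ψ x‖ ^ 2 = 1 + (‖dbarZ s φ ψ x‖ ^ 2 - 1) := by ring
  have h0 : ⟪hdir j, (eglue 0 1 : E (m+1))⟫ = 0 := by rw [inner_hdir, epre_eglue]; simp
  rw [hd, h0]
  have hc := S.hc
  have hμ := S.hμ
  refine hr (ε / μ) (by positivity) he _ _ _ _ _ _ _ _ hX b1 b2 b3 ?_ ?_ (bz.trans q2) ?_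
  · refine (S.abs_inner_dbarR_dbarZ hε hF hG).trans ?_
    rw [hx]; gcongr
  · refine (S.norm_sq_dbarZ hε x).trans ?_
    rw [hx]; gcongr
  · refine (S.abs_inner_hdir_dbarZ x).trans ?_
    rw [abs_of_pos hX]; gcongr; linarith

theorem inner_normal_hdir (S : Side μ K c σ R0 s φ ψ j) (hε : 0 < ε) :
    |⟪eglue (- gradient φ (epre x)) s, hdir j⟫ + C2Sigma.curv φ j * epre x j| ≤
      c * barR μ ε x ^ (σ / 2) * |epre x j| := by
  have h1 := S.hφ.abs_inner_gradient_single_sub_le S.hc.le S.hσ.1 S.eφ (epre x)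
  have h2 := (rpow_le_of_sq_le (norm_nonneg _) (S.norm_sq_le hε x).1 S.hσ.1).1
  have e : ⟪eglue (- gradient φ (epre x)) s, hdir j⟫ =
      - ⟪gradient φ (epre x), EuclideanSpace.single j 1⟫ := by
    rw [inner_eq_epre_lastC, hdir, epre_eglue, lastC_eglue, epre_eglue, lastC_eglue, inner_neg_left]
    ring
  rw [e, ← abs_neg, neg_add, neg_neg, ← sub_eq_add_neg]
  refine h1.trans ?_
  have := S.hc
  gcongr

theorem inner_normal_dbarR (S : Side μ K c σ R0 s φ ψ j) (hε : 0 < ε) (hF : graphF ε s φ x = 0) :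
    |⟪eglue (- gradient φ (epre x)) s, (2:ℝ) • x + (2 * lastC x) • (eglue 0 1 : E (m+1))⟫ -
      2 * μ * (ε / μ)| ≤ 2 * c * barR μ ε x ^ (1 + σ / 2) := by
  have h1 := S.hφ.abs_inner_sub_le S.hc.le S.hσ.1 S.φ0 S.dφ0 (epre x)
  have h2 := (rpow_le_of_sq_le (norm_nonneg _) (S.norm_sq_le hε x).1 S.hσ.1).2
  have hμ := S.hμ
  have hc := S.hc
  have e : ⟪eglue (- gradient φ (epre x)) s,
      (2:ℝ) • x + (2 * lastC x) • (eglue 0 1 : E (m+1))⟫ - 2 * μ * (ε / μ) =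
      -2 * (⟪epre x, gradient φ (epre x)⟫ - 2 * φ (epre x)) := by
    rw [inner_eq_epre_lastC, epre_add, lastC_add, epre_smul, epre_smul, lastC_smul, lastC_smul,
      epre_eglue, lastC_eglue, epre_eglue, lastC_eglue, smul_zero, add_zero,
      real_inner_smul_right, inner_neg_left, real_inner_comm, mul_assoc 2 μ,
      mul_div_cancel₀ _ hμ.ne']
    simp only [graphF] at hF
    linear_combination 4 * hF
  rw [e, abs_mul, show |(-2:ℝ)| = 2 by norm_num, mul_assoc 2 c]
  have := mul_le_mul_of_nonneg_left h2 hc.le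
  linarith

theorem inner_normal_dbarZ (S : Side μ K c σ R0 s φ ψ j) (hε : 0 < ε) (hF : graphF ε s φ x = 0)
    (hR0 : ‖epre x‖ < R0) (hR1 : barR μ ε x ≤ 1) (hx : |lastC x| ≤ (μ + c) * barR μ ε x) :
    |2 * barZ s φ ψ x * ⟪eglue (- gradient φ (epre x)) s, dbarZ s φ ψ x⟫ - μ * barR μ ε x| ≤
      (K + 2 * μ * (μ + c) ^ 2 + (μ + 2 * c) * c ^ 2) * barR μ ε x ^ (1 + σ / 2) := by
  obtain ⟨p1, p2⟩ := S.norm_sq_le hε x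
  have h2 := (rpow_le_of_sq_le (norm_nonneg _) p1 S.hσ.1).2
  have hμ := S.hμ
  have hc := S.hc
  have hK := S.hK
  have hR := S.barR_pos hε x
  have h3 := S.hsum (epre x) hR0
  have h4 := S.norm_half_sub_le (epre x)
  have h5 := S.hφ.norm_gradient_le S.dφ0 (epre x)
  have h6 := (S.hφ.abs_le hc.le S.φ0 S.dφ0 (epre x))
  have h7 := (S.hψ.abs_le hc.le S.ψ0 S.dψ0 (epre x))
  set I := ⟪gradient φ (epre x), gradient φ (epre x) - gradient ψ (epre x)⟫ with hI
  set h := ε + φ (epre x) + ψ (epre x) with hh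
  have e1 : ⟪eglue (- gradient φ (epre x)) s, dbarZ s φ ψ x⟫ = s / 2 * I + s := by
    rw [inner_eq_epre_lastC, dbarZ, epre_eglue, lastC_eglue, epre_eglue, lastC_eglue,
      inner_neg_left, real_inner_smul_right]
    ring
  have e2 : s * barZ s φ ψ x = h / 2 := by
    simp only [graphF] at hF
    rw [barZ]
    linear_combination hF - (φ (epre x) - ψ (epre x)) / 2 * S.hs
  have e3 : 2 * barZ s φ ψ x * (s / 2 * I + s) = h + h * (I / 2) := by
    linear_combination (I + 2) * e2
  have bI : |I / 2| ≤ c ^ 2 * barR μ ε x := by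
    have : |I| ≤ ‖gradient φ (epre x)‖ * ‖gradient φ (epre x) - gradient ψ (epre x)‖ :=
      abs_real_inner_le_norm _ _
    have t1 : ‖gradient φ (epre x)‖ * ‖gradient φ (epre x) - gradient ψ (epre x)‖ ≤
        (c * ‖epre x‖) * (2 * (c * ‖epre x‖)) := by gcongr
    have t2 : c ^ 2 * ‖epre x‖ ^ 2 ≤ c ^ 2 * barR μ ε x := by gcongr
    rw [abs_div, abs_two]
    linarith
  have bh : |h| ≤ (μ + 2 * c) * barR μ ε x := by
    have t : c * ‖epre x‖ ^ 2 ≤ c * barR μ ε x := by gcongr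
    rw [hh, abs_le]
    have := abs_le.1 h6
    have := abs_le.1 h7
    constructor <;> linarith
  have hRR : barR μ ε x * barR μ ε x ≤ barR μ ε x ^ (1 + σ / 2) := by
    rw [Real.rpow_add hR, Real.rpow_one]
    exact mul_le_mul_of_nonneg_left (le_rpow_of_le_one hR hR1 (by linarith [S.hσ.2])) hR.le
  have e4 : h - μ * barR μ ε x = (φ (epre x) + ψ (epre x) - μ * ‖epre x‖ ^ 2) -
      2 * μ * (lastC x * lastC x) := by
    rw [barR, norm_sq_eq_epre_lastC, hh]
    field_simp
    ring
  have bl : |lastC x * lastC x| ≤ (μ + c) ^ 2 * (barR μ ε x * barR μ ε x) := by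
    rw [abs_mul]
    calc |lastC x| * |lastC x| ≤ ((μ + c) * barR μ ε x) * ((μ + c) * barR μ ε x) := by gcongr
      _ = _ := by ring
  rw [e1, e3, show h + h * (I / 2) - μ * barR μ ε x = (h - μ * barR μ ε x) + h * (I / 2) by ring,
    e4]
  refine (abs_add_le _ _).trans ((add_le_add (abs_sub _ _) le_rfl).trans ?_)
  rw [abs_mul (2 * μ), abs_mul h, abs_of_pos (show 0 < 2 * μ by positivity)]
  have c1 : K * ‖epre x‖ ^ (2 + σ) ≤ K * barR μ ε x ^ (1 + σ / 2) := by gcongr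
  have c2 : 2 * μ * |lastC x * lastC x| ≤
      2 * μ * ((μ + c) ^ 2 * barR μ ε x ^ (1 + σ / 2)) := by
    refine mul_le_mul_of_nonneg_left (bl.trans ?_) (by positivity)
    gcongr
  have c3 : |h| * |I / 2| ≤ (μ + 2 * c) * c ^ 2 * barR μ ε x ^ (1 + σ / 2) := by
    calc |h| * |I / 2| ≤ ((μ + 2 * c) * barR μ ε x) * (c ^ 2 * barR μ ε x) := by gcongr
      _ = (μ + 2 * c) * c ^ 2 * (barR μ ε x * barR μ ε x) := by ring
      _ ≤ _ := by gcongr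
  clear_value h I
  linarith

theorem norm_normal (S : Side μ K c σ R0 s φ ψ j) (hε : 0 < ε) (hR1 : barR μ ε x ≤ 1) :
    |‖(eglue (- gradient φ (epre x)) s : E (m+1))‖ - 1| ≤ c ^ 2 * barR μ ε x ^ (σ / 2) := by
  have hR := S.barR_pos hε x
  have h1 := S.hφ.norm_gradient_le S.dφ0 (epre x)
  have e : ‖(eglue (- gradient φ (epre x)) s : E (m+1))‖ ^ 2 = 1 + ‖gradient φ (epre x)‖ ^ 2 := by
    rw [norm_sq_eq_epre_lastC, epre_eglue, lastC_eglue, norm_neg, S.hs, add_comm]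
  have h0 := norm_nonneg (eglue (- gradient φ (epre x)) s : E (m+1))
  have h2 : ‖gradient φ (epre x)‖ ^ 2 ≤ c ^ 2 * barR μ ε x := by
    calc ‖gradient φ (epre x)‖ ^ 2 ≤ (c * ‖epre x‖) ^ 2 := by gcongr
      _ = c ^ 2 * ‖epre x‖ ^ 2 := by ring
      _ ≤ _ := by gcongr; exact (S.norm_sq_le hε x).1
  have h3 := le_rpow_of_le_one hR hR1 (p := σ / 2) (by linarith [S.hσ.2])
  have h4 : c ^ 2 * barR μ ε x ≤ c ^ 2 * barR μ ε x ^ (σ / 2) := by gcongr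
  have h5 : 1 ≤ ‖(eglue (- gradient φ (epre x)) s : E (m+1))‖ := by
    nlinarith [sq_nonneg ‖gradient φ (epre x)‖]
  rw [abs_of_nonneg (by linarith)]
  nlinarith

theorem eventually_boundary (hm : 1 ≤ m) (hγ : 0 < γ) (hμ : 0 < μ) (hσ : σ ∈ Set.Ioo (0:ℝ) 1) :
    ∀ᶠ r : ℝ in nhdsWithin 0 (Ioi 0), ∀ {ε s : ℝ} {φ ψ : E m → ℝ} {j : Fin m} {x : E (m+1)},
      Side μ K c σ R0 s φ ψ j → 0 < ε → graphF ε s φ x = 0 → graphF ε (-s) ψ x ≤ 0 →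
      ‖epre x‖ < R0 → barR μ ε x = r → 0 ≤ epre x j →
      0 ≤ ‖gradient (graphF ε s φ) x‖ / γ * barrier γ μ σ β ε s φ ψ j x +
        ⟪gradient (graphF ε s φ) x, gradient (barrier γ μ σ β ε s φ ψ j) x⟫ := by
  have hν : 0 < (m : ℝ) * (σ / 4) / 2 := by
    have h1 : (0:ℝ) < m := by exact_mod_cast hm
    have h2 := hσ.1
    positivity
  filter_upwards [barrier_boundary_nonneg (Q := barQ m μ c K) (β := β) hμ hγ hσ hν,
    Ioo_mem_nhdsGT (show (0:ℝ) < 1 by norm_num)] with r hr hr01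
  intro ε s φ ψ j x S hε hF hG hxR hx hX
  obtain ⟨b1, b2, b3⟩ := S.common_bounds hε hF.le hG
  obtain ⟨q1, q2, q3, q4⟩ := barQ_ge (m := m) S.hμ S.hK S.hc
  obtain ⟨lz, hz, bz⟩ := S.hasLap_barZ x
  have hR := S.barR_pos hε x
  have hR1 : barR μ ε x ≤ 1 := hx.le.trans hr01.2.le
  have hL := S.hasLap_barrier (γ := γ) (β := β) hε hz hx.symm rfl rfl rfl rfl rfl rfl rfl rfl
  have he : ε / μ ≤ r := by
    rw [← hx, barR]; nlinarith [sq_nonneg ‖x‖, mul_self_nonneg (lastC x)]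
  have hc := S.hc
  have e1 := S.inner_normal_hdir (x := x) hε
  have e2 := S.inner_normal_dbarR hε hF
  have e3 := S.inner_normal_dbarZ hε hF hxR hR1
    ((S.abs_lastC_le hF.le hG).trans (S.half_add_le hε x))
  have e4 := S.norm_normal hε hR1
  have e5 : ⟪eglue (- gradient φ (epre x)) s, (eglue 0 1 : E (m+1))⟫ = s := by
    rw [real_inner_comm, ← lastC_eq_inner, lastC_eglue]
  have e6 : barC s φ ψ j * s = C2Sigma.curv φ j - μ := by
    rw [barC]
    linear_combination (C2Sigma.curv φ j - C2Sigma.curv ψ j) / 2 * S.hs - S.curv_add / 2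
  rw [hL.2.1.gradient, (hasGradientAt_graphF S.hφ x).gradient, barrier, inner_hdir, hx]
  generalize (eglue (- gradient φ (epre x)) s : E (m+1)) = N at *
  rw [hx] at b2 b3 e1 e2 e3 e4
  rw [abs_of_nonneg hX] at e1
  have hr0 := hr01.1
  have key := hr (ε / μ) (by positivity) he (epre x j) (barC s φ ψ j) (lastC x) (barZ s φ ψ x)
    (C2Sigma.curv φ j) s _ _ _ _ hX b1 b2 b3 ((S.hφ.abs_curv_le j).trans (by linarith))
    (e2.trans (by gcongr; linarith)) (e1.trans (by gcongr; linarith)) (e3.trans (by gcongr))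
    (e4.trans (by gcongr)) e6
  refine key.trans_eq ?_
  generalize (2:ℝ) • x + (2 * lastC x) • (eglue 0 1 : E (m+1)) = W
  rw [inner_add_right, real_inner_smul_right, real_inner_smul_right, inner_add_right,
    inner_add_right, real_inner_smul_right, real_inner_smul_right, real_inner_smul_right, e5]
  ring

theorem eventually_size (hσ : 0 < σ) :
    ∀ᶠ r : ℝ in nhdsWithin 0 (Ioi 0), ∀ {ε s : ℝ} {φ ψ : E m → ℝ} {j : Fin m} {x : E (m+1)},
      Side μ K c σ R0 s φ ψ j → 0 < ε → graphF ε s φ x ≤ 0 → graphF ε (-s) ψ x ≤ 0 →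
      barR μ ε x = r → 0 ≤ epre x j →
      1 / 4 * r ^ β * epre x j ≤ barrier γ μ σ β ε s φ ψ j x ∧
        barrier γ μ σ β ε s φ ψ j x ≤ 2 * r ^ β * epre x j := by
  filter_upwards [barrier_size (Q := barQ m μ c K) (β := β) (τ := σ / 4) (l := 1 - 1 / (μ * γ))
    (ν := m * (σ / 4) / 2) (by positivity)] with r hr
  intro ε s φ ψ j x S hε hF hG hx hX
  obtain ⟨b1, b2, b3⟩ := S.common_bounds hε hF hG
  have hμ := S.hμ
  have he : ε / μ ≤ r := by
    rw [← hx, barR]; nlinarith [sq_nonneg ‖x‖, mul_self_nonneg (lastC x)]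
  rw [hx] at b2 b3
  obtain ⟨k1, k2⟩ := hr (ε / μ) (by positivity) he _ _ _ b1 b2 b3
  rw [barrier, inner_hdir, hx, ← pow_two, mul_comm (epre x j)]
  exact ⟨mul_le_mul_of_nonneg_right k1 hX, mul_le_mul_of_nonneg_right k2 hX⟩

end Side

/-- A positive supersolution of the Robin problem on the half neck `0 < x_j`, comparable
with `x_j` times a power of the distance to the origin. -/
structure HalfBarrier {m : ℕ} (γ ε β ρ C : ℝ) (f g : E m → ℝ) (j : Fin m) (w : E (m+1) → ℝ) :
    Prop where
  cont : Continuous w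
  lap : ∀ {x}, graphF ε 1 f x ≤ 0 → graphF ε (-1) (fun y => - g y) x ≤ 0 → ‖epre x‖ ≤ ρ →
    0 < epre x j → ∃ d l, HasLap w x d l ∧ l < 0
  top : ∀ {x}, graphF ε 1 f x = 0 → graphF ε (-1) (fun y => - g y) x ≤ 0 → ‖epre x‖ ≤ ρ →
    0 < epre x j → 0 ≤ ‖gradient (graphF ε 1 f) x‖ / γ * w x +
      ⟪gradient (graphF ε 1 f) x, gradient w x⟫
  bot : ∀ {x}, graphF ε 1 f x ≤ 0 → graphF ε (-1) (fun y => - g y) x = 0 → ‖epre x‖ ≤ ρ →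
    0 < epre x j → 0 ≤ ‖gradient (graphF ε (-1) (fun y => - g y)) x‖ / γ * w x +
      ⟪gradient (graphF ε (-1) (fun y => - g y)) x, gradient w x⟫
  lower : ∀ {x}, graphF ε 1 f x ≤ 0 → graphF ε (-1) (fun y => - g y) x ≤ 0 → ‖epre x‖ ≤ ρ →
    0 ≤ epre x j → 1 / 4 * epre x j ≤ w x
  upper : ∀ {x}, graphF ε 1 f x ≤ 0 → graphF ε (-1) (fun y => - g y) x ≤ 0 → ‖epre x‖ ≤ ρ →
    0 ≤ epre x j → w x ≤ C * epre x j * (ε + ‖epre x‖ ^ 2) ^ β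

theorem barR_lt_of_small {μ c ρ ε p y R : ℝ} (hμ : 0 < μ) (hρ : 0 < ρ) (hρ1 : ρ ≤ 1)
    (hR : ρ * (1 / μ + 1 + 2 * (1 / 2 + c) ^ 2) < R) (hc : 0 < c)
    (hε : ε ≤ ρ ^ 2) (hp0 : 0 ≤ p) (hp : p ≤ ρ) (hy : |y| ≤ ε / 2 + c * p ^ 2) :
    ε / μ + (p ^ 2 + y ^ 2) + y * y < R := by
  have h1 : p ^ 2 ≤ ρ ^ 2 := by gcongr
  have h2 : |y| ≤ (1 / 2 + c) * ρ ^ 2 := by nlinarith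
  have h3 : y ^ 2 ≤ ((1 / 2 + c) * ρ ^ 2) ^ 2 := by
    rw [← sq_abs]; gcongr
  have h4 : ε / μ ≤ ρ ^ 2 / μ := by gcongr
  have h5 : ρ ^ 2 ≤ ρ := by nlinarith
  have h6 : ((1 / 2 + c) * ρ ^ 2) ^ 2 ≤ (1 / 2 + c) ^ 2 * ρ := by
    rw [mul_pow]
    have : (ρ ^ 2) ^ 2 ≤ ρ := by nlinarith [sq_nonneg ρ]
    gcongr
  have h7 : ρ ^ 2 / μ ≤ ρ / μ := by gcongr
  have e : ρ * (1 / μ + 1 + 2 * (1 / 2 + c) ^ 2) = ρ / μ + ρ + 2 * ((1 / 2 + c) ^ 2 * ρ) := by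
    ring
  rw [e] at hR
  nlinarith

theorem exists_halfBarrier {m : ℕ} {γ μ K c σ R0 β : ℝ} (hm : 1 ≤ m) (hγ : 0 < γ) (hμ : 0 < μ)
    (hc : 0 < c) (hσ : σ ∈ Set.Ioo (0:ℝ) 1) (hR0 : 0 < R0) (hβ : -(1 / 2) ≤ β) (hβ0 : β ≤ 0)
    (hl : 4 * β + 2 * m * β + 4 * β ^ 2 + 2 * (1 - 1 / (μ * γ)) ≤ 0) :
    ∃ ρ C : ℝ, 0 < ρ ∧ ρ ≤ R0 / 2 ∧ 0 < C ∧ ∀ {ε : ℝ} {f g : E m → ℝ} {j : Fin m}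
      {u : E (m+1) → ℝ}, NeckData γ μ K c σ R0 ε f g j u → ε ≤ ρ ^ 2 →
      ∃ w, HalfBarrier γ ε β ρ C f g j w := by
  have H := ((Side.eventually_interior (K := K) (c := c) (R0 := R0) (γ := γ) (μ := μ) hm hβ hβ0
    hσ hl).and ((Side.eventually_boundary (K := K) (c := c) (R0 := R0) (β := β) hm hγ hμ hσ).and
    (Side.eventually_size (m := m) (μ := μ) (K := K) (c := c) (R0 := R0) (γ := γ) (β := β)
      hσ.1))).and (Ioo_mem_nhdsGT (show (0:ℝ) < 1 by norm_num))
  obtain ⟨r, hr, hrH⟩ := mem_nhdsGT_iff_exists_Ioo_subset.1 H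
  replace hr : 0 < r := hr
  set B := 1 / μ + 1 + 2 * (1 / 2 + c) ^ 2 with hB
  have hB0 : 0 < B := by positivity
  obtain ⟨ρ, hρ, hρ1, hρR, hρr⟩ : ∃ ρ : ℝ, 0 < ρ ∧ ρ ≤ 1 ∧ ρ ≤ R0 / 2 ∧ ρ * B < r := by
    refine ⟨min 1 (min (R0 / 2) (r / (2 * B))), by positivity, min_le_left _ _,
      (min_le_right _ _).trans (min_le_left _ _), ?_⟩
    calc min 1 (min (R0 / 2) (r / (2 * B))) * B ≤ r / (2 * B) * B := by
          gcongr; exact (min_le_right _ _).trans (min_le_right _ _)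
      _ = r / 2 := by field_simp
      _ < r := by linarith
  set a := min (1 / μ) 1 with ha
  have ha0 : 0 < a := by positivity
  refine ⟨ρ, 2 * a ^ β, hρ, hρR, by positivity, ?_⟩
  intro ε f g j u D hερ
  have hε := D.hε.1
  set φ : E m → ℝ := fun y => - g y with hφ
  have S : Side μ K c σ R0 1 f φ j := D.side
  have S' : Side μ K c σ R0 (-1) φ f j := S.symm
  have hR : ∀ {x : E (m+1)}, graphF ε 1 f x ≤ 0 → graphF ε (-1) φ x ≤ 0 → ‖epre x‖ ≤ ρ →
      barR μ ε x ∈ Ioo 0 r := by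
    intro x hF hG hx
    refine ⟨S.barR_pos hε x, ?_⟩
    rw [barR, norm_sq_eq_epre_lastC]
    exact barR_lt_of_small hμ hρ hρ1 hρr hc hερ (norm_nonneg _) hx (S.abs_lastC_le hF hG)
  refine ⟨barrier γ μ σ β ε 1 f φ j, ?_, ?_, ?_, ?_, ?_, ?_⟩
  · rw [continuous_iff_continuousAt]
    intro x
    obtain ⟨lz, hz, bz⟩ := S.hasLap_barZ x
    exact (S.hasLap_barrier (γ := γ) (β := β) hε hz rfl rfl rfl rfl rfl rfl rfl rfl
      rfl).1.continuousAt
  · intro x hF hG hx hX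
    exact (hrH (hR hF hG hx)).1.1 S hε hF hG rfl hX
  · intro x hF hG hx hX
    exact (hrH (hR hF.le hG hx)).1.2.1 S hε hF hG (by linarith) rfl hX.le
  · intro x hF hG hx hX
    rw [← Side.barrier_symm]
    exact (hrH (hR hF hG.le hx)).1.2.1 S' hε hG (by rwa [neg_neg]) (by linarith) rfl hX.le
  · intro x hF hG hx hX
    have h1 := hrH (hR hF hG hx)
    refine le_trans ?_ (h1.1.2.2 S hε hF hG rfl hX).1
    have : 1 ≤ barR μ ε x ^ β :=
      Real.one_le_rpow_of_pos_of_le_one_of_nonpos h1.2.1 h1.2.2.le hβ0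
    gcongr
    linarith
  · intro x hF hG hx hX
    have h1 := hrH (hR hF hG hx)
    refine (h1.1.2.2 S hε hF hG rfl hX).2.trans ?_
    have h2 : a * (ε + ‖epre x‖ ^ 2) ≤ barR μ ε x := by
      have h3 : a * ε ≤ 1 / μ * ε := by gcongr; exact min_le_left _ _
      have h4 : a * ‖epre x‖ ^ 2 ≤ 1 * ‖epre x‖ ^ 2 := by gcongr; exact min_le_right _ _
      rw [barR, norm_sq_eq_epre_lastC, div_eq_inv_mul, ← one_div]
      nlinarith [sq_nonneg (lastC x)]
    have h5 : barR μ ε x ^ β ≤ a ^ β * (ε + ‖epre x‖ ^ 2) ^ β := by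
      rw [← Real.mul_rpow ha0.le (by positivity)]
      exact Real.rpow_le_rpow_of_nonpos (by positivity) h2 hβ0
    calc 2 * barR μ ε x ^ β * epre x j ≤ 2 * (a ^ β * (ε + ‖epre x‖ ^ 2) ^ β) * epre x j := by
          gcongr
      _ = _ := by ring

theorem inner_gradient_nonneg_of_max {n : ℕ} {c : ℝ} {H H' v : E n → ℝ} {x d : E n}
    (hH : NiceDefining c H) (hH' : NiceDefining c H') (hx : H x = 0) (hx' : H' x < 0)
    (hv : HasGradientAt v d x)
    (hm : ∀ᶠ z in nhds x, H z ≤ 0 → H' z ≤ 0 → v z ≤ v x) : 0 ≤ ⟪d, gradient H x⟫ := by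
  set N := gradient H x with hN
  have hline : HasDerivAt (fun t : ℝ => x - t • N) (-N) 0 := by
    simpa using ((hasDerivAt_id (0 : ℝ)).smul_const N).const_sub x
  have d1 : HasDerivAt (fun t : ℝ => v (x - t • N)) (-⟪d, N⟫) 0 := by
    have h1 : HasFDerivAt v (fderiv ℝ v x) (x - (0 : ℝ) • N) := by
      rw [zero_smul, sub_zero]; exact hv.differentiableAt.hasFDerivAt
    refine (h1.comp_hasDerivAt 0 hline).congr_deriv ?_
    rw [map_neg, hv.fderiv_apply]
  have ht : Filter.Tendsto (fun t : ℝ => x - t • N) (nhdsWithin 0 (Ioi 0)) (nhds x) := by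
    have : Continuous fun t : ℝ => x - t • N := by fun_prop
    have := this.tendsto 0
    simp only [zero_smul, sub_zero] at this
    exact this.mono_left nhdsWithin_le_nhds
  have := deriv_nonpos_of_right_max d1 (by
    filter_upwards [ht.eventually hm, ThinSetting.eventually_mem_of_gradient hH hH' hx hx']
      with t h1 h2
    simpa using h1 h2.1 h2.2)
  linarith

theorem isCompact_halfNeck {m : ℕ} {c σ ε ρ : ℝ} {φ ψ : E m → ℝ} {j : Fin m}
    (hφ : C2Sigma c σ φ) (hψ : C2Sigma c σ ψ) :
    IsCompact {x : E (m+1) | graphF ε 1 φ x ≤ 0 ∧ graphF ε (-1) ψ x ≤ 0 ∧ ‖epre x‖ ≤ ρ ∧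
      0 ≤ epre x j} := by
  have c0 : Continuous (epre : E (m+1) → E m) := (epreL m).continuous
  have c1 : Continuous (graphF ε 1 φ) := by
    have := hφ.1.continuous
    have := (contDiff_lastC (m := m)).continuous
    unfold graphF; fun_prop
  have c2 : Continuous (graphF ε (-1) ψ) := by
    have := hψ.1.continuous
    have := (contDiff_lastC (m := m)).continuous
    unfold graphF; fun_prop
  refine Metric.isCompact_of_isClosed_isBounded ?_ ?_
  · have c3 : Continuous fun x : E (m+1) => epre x j := by fun_prop
    exact (isClosed_le c1 continuous_const).inter ((isClosed_le c2 continuous_const).inter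
      ((isClosed_le c0.norm continuous_const).inter (isClosed_le continuous_const c3)))
  · rw [isBounded_iff_forall_norm_le]
    refine ⟨ρ + (ε / 2 + c), ?_⟩
    rintro x ⟨h1, h2, h3, -⟩
    simp only [graphF] at h1 h2
    have b1 := abs_le.1 (hφ.2.1 (epre x))
    have b2 := abs_le.1 (hψ.2.1 (epre x))
    have h4 : |lastC x| ≤ ε / 2 + c := abs_le.2 ⟨by linarith, by linarith⟩
    have h5 := norm_sq_eq_epre_lastC x
    have h6 := abs_nonneg (lastC x)
    have h7 : ‖x‖ ^ 2 ≤ (‖epre x‖ + |lastC x|) ^ 2 := by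
      rw [h5, ← sq_abs (lastC x)]; nlinarith [norm_nonneg (epre x)]
    have := abs_le_of_sq_le_sq' h7 (by positivity)
    linarith [this.2]

namespace NeckData

variable {m : ℕ} {γ μ K c σ R0 ε β ρ C A : ℝ} {f g : E m → ℝ} {j : Fin m} {u w : E (m+1) → ℝ}

theorem eq_zero_of_coord (D : NeckData γ μ K c σ R0 ε f g j u) {x : E (m+1)}
    (hx : ‖epre x‖ < R0) (hF : graphF ε 1 f x ≤ 0) (hG : graphF ε (-1) (fun y => - g y) x ≤ 0)
    (h0 : epre x j = 0) : u x = 0 := by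
  have h1 := D.odd x (D.mem_regio hx hF hG)
  have : flipCoord j.castSucc x = x := by
    ext i
    by_cases hi : i = j.castSucc
    · subst hi
      rw [epre_apply] at h0
      simp [flipCoord, h0]
    · simp [flipCoord, hi]
  rw [this] at h1
  linarith

theorem graphF_add_neg (D : NeckData γ μ K c σ R0 ε f g j u) {x : E (m+1)}
    (hx : ‖epre x‖ < R0) : graphF ε 1 f x + graphF ε (-1) (fun y => - g y) x < 0 := by
  have h1 := D.sub_ge hx
  have h2 := D.hμ
  have h3 := D.hε.1
  have : 0 ≤ μ / 2 * ‖epre x‖ ^ 2 := by positivity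
  simp only [graphF]
  linarith

theorem le_mul_halfBarrier (D : NeckData γ μ K c σ R0 ε f g j u)
    (W : HalfBarrier γ ε β ρ C f g j w) (hρ : ρ ≤ R0 / 2) (hA : 0 < A)
    (hlat : ∀ x, graphF ε 1 f x ≤ 0 → graphF ε (-1) (fun y => - g y) x ≤ 0 → ‖epre x‖ = ρ →
      0 ≤ epre x j → u x ≤ A / 4 * epre x j)
    {x : E (m+1)} (hF : graphF ε 1 f x ≤ 0) (hG : graphF ε (-1) (fun y => - g y) x ≤ 0)
    (hx : ‖epre x‖ ≤ ρ) (hX : 0 ≤ epre x j) : u x ≤ A * w x := by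
  have hR0 := D.hR0
  have c0 : Continuous (epre : E (m+1) → E m) := (epreL m).continuous
  obtain ⟨z, ⟨zF, zG, zρ, zX⟩, hz⟩ := (isCompact_halfNeck (ε := ε) (ρ := ρ) (j := j) D.hf
    D.hg.neg).exists_isMaxOn (f := fun y => u y - A * w y) ⟨x, hF, hG, hx, hX⟩ (by
      refine ContinuousOn.sub (fun y hy => ?_) (W.cont.continuousOn.const_smul A)
      exact (D.sol.1 y (D.mem_regio (by linarith [hy.2.2.1]) hy.1
        hy.2.1)).continuousAt.continuousWithinAt)
  have hxz : u x - A * w x ≤ u z - A * w z := hz ⟨hF, hG, hx, hX⟩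
  by_contra! hcon
  have hpos : 0 < u z - A * w z := by linarith
  have hzR : ‖epre z‖ < R0 := by linarith
  have hlow := W.lower zF zG zρ zX
  rcases zX.eq_or_lt with h0 | zX'
  · have := D.eq_zero_of_coord hzR zF zG h0.symm
    rw [← h0] at hlow
    nlinarith
  rcases zρ.eq_or_lt with h0 | zρ'
  · have := hlat z zF zG h0 zX
    nlinarith
  obtain ⟨d, l, hw, hl⟩ := W.lap zF zG zρ zX'
  have hnear : ∀ᶠ y in nhds z, ‖epre y‖ ≤ ρ ∧ 0 ≤ epre y j := by
    refine ((c0.norm.continuousAt.eventually (gt_mem_nhds zρ')).mono fun y hy => hy.le).and ?_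
    have : Continuous fun y : E (m+1) => epre y j := by fun_prop
    exact (this.continuousAt.eventually (lt_mem_nhds zX')).mono fun y hy => hy.le
  have hmax : ∀ᶠ y in nhds z, graphF ε 1 f y ≤ 0 → graphF ε (-1) (fun y => - g y) y ≤ 0 →
      u y - A * w y ≤ u z - A * w z :=
    hnear.mono fun y hy h1 h2 => hz ⟨h1, h2, hy.1, hy.2⟩
  have n1 := niceDefining_graphF (ε := ε) D.hf D.hc.le (show (1:ℝ) ^ 2 = 1 by norm_num)
  have n2 := niceDefining_graphF (ε := ε) D.hg.neg D.hc.le (show (-1:ℝ) ^ 2 = 1 by norm_num)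
  have hsum := D.graphF_add_neg hzR
  have hgrad : HasGradientAt (fun y => u y - A * w y) (gradient u z - A • d) z := by
    rw [hasGradientAt_iff_hasFDerivAt, map_sub]
    exact (D.sol.1 z (D.mem_regio hzR zF zG)).hasGradientAt.hasFDerivAt.sub
      (hw.const_mul A).2.1.hasFDerivAt
  have hneg : ∀ N : E (m+1), 1 ≤ ‖N‖ → ⟪gradient u z, N⟫ = -(1 / γ * (‖N‖ * u z)) →
      0 ≤ ‖N‖ / γ * w z + ⟪N, d⟫ → ⟪gradient u z - A • d, N⟫ < 0 := by
    intro N hN h1 h2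
    have hγ := D.hγ
    rw [inner_sub_left, real_inner_smul_left, h1, real_inner_comm]
    have h3 : 0 < ‖N‖ / γ * (u z - A * w z) := by positivity
    have h4 := mul_nonneg hA.le h2
    have : 1 / γ * (‖N‖ * u z) = ‖N‖ / γ * u z := by ring
    rw [this]
    nlinarith
  rcases zF.lt_or_eq with zF' | zF'
  · rcases zG.lt_or_eq with zG' | zG'
    · have zn : z ∈ neck ε f g 0 R0 := D.mem_neck_iff.2 ⟨hzR, zF', zG'⟩
      have hopen : ∀ᶠ y in nhds z, graphF ε 1 f y ≤ 0 ∧ graphF ε (-1) (fun y => - g y) y ≤ 0 :=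
        ((n1.differentiable.continuous.continuousAt.eventually (gt_mem_nhds zF')).mono
          fun y hy => hy.le).and
        ((n2.differentiable.continuous.continuousAt.eventually (gt_mem_nhds zG')).mono
          fun y hy => hy.le)
      have zN : neck ε f g 0 R0 ∈ nhds z := by
        filter_upwards [c0.norm.continuousAt.eventually (gt_mem_nhds hzR),
          n1.differentiable.continuous.continuousAt.eventually (gt_mem_nhds zF'),
          n2.differentiable.continuous.continuousAt.eventually (gt_mem_nhds zG')] with y h1 h2 h3
        exact D.mem_neck_iff.2 ⟨h1, h2, h3⟩
      have hu := HasLap.of_elap (D.sol.2.2.1.contDiffAt zN) (D.sol.2.2.2.1 z zn)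
      have := (hu.sub (hw.const_mul A)).nonpos_of_isLocalMax
        ((hmax.and hopen).mono fun y hy => hy.1 hy.2.1 hy.2.2)
      nlinarith
    · have h1 := inner_gradient_nonneg_of_max n2 n1 zG' zF' hgrad
        (hmax.mono fun y hy h1 h2 => hy h2 h1)
      have h2 := W.bot zF zG' zρ zX'
      rw [hw.2.1.gradient] at h2
      exact absurd (hneg _ (n2.one_le z) (D.bd_bot hzR zG') h2) (not_lt.2 h1)
  · have h1 := inner_gradient_nonneg_of_max n1 n2 zF' (by linarith) hgrad hmax
    have h2 := W.top zF' zG zρ zX'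
    rw [hw.2.1.gradient] at h2
    exact absurd (hneg _ (n1.one_le z) (D.bd_top hzR zF') h2) (not_lt.2 h1)

end NeckData

namespace NeckData

variable {m : ℕ} {γ μ K c σ R0 ε β ρ M L : ℝ} {f g : E m → ℝ} {j : Fin m} {u : E (m+1) → ℝ}

theorem abs_le_mul_coord_of_near (D : NeckData γ μ K c σ R0 ε f g j u) (hρ : ρ ≤ R0 / 2)
    (hgrad : ∀ p ∈ neck ε f g 0 R0, ρ / 2 ≤ ‖epre p‖ → ‖epre p‖ ≤ ρ → ‖gradient u p‖ ≤ L)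
    {x : E (m+1)} (hx : x ∈ neck ε f g 0 R0) (hxρ : ‖epre x‖ = ρ) (hX : 0 ≤ epre x j)
    (hX' : epre x j ≤ ρ / 2) : |u x| ≤ L * (1 + c) * epre x j := by
  have hR0 := D.hR0
  have hε := D.hε.1
  have hc := D.hc
  have hμ := D.hμ
  set p := epre x with hp
  set X := p j with hXdef
  set e : E m := EuclideanSpace.single j 1 with he
  have hne : ‖e‖ = 1 := by simp [he]
  have hpe : ⟪p, e⟫ = X := by
    rw [he, EuclideanSpace.inner_single_right]; simp [hXdef]
  have hgap : ∀ q : E m, ‖q‖ < R0 → 0 < ε + f q - g q := fun q hq => by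
    have h1 := D.sub_ge hq
    have : 0 ≤ μ / 2 * ‖q‖ ^ 2 := by positivity
    linarith
  obtain ⟨θ, θ0, θ1, hθ⟩ : ∃ θ : ℝ, 0 < θ ∧ θ < 1 ∧
      lastC x = -(ε / 2) + g p + θ * (ε + f p - g p) := by
    have h0 := hgap p (by linarith)
    refine ⟨(lastC x + ε / 2 - g p) / (ε + f p - g p), ?_, ?_, ?_⟩
    · have := hx.2.1
      exact div_pos (by linarith) h0
    · have := hx.2.2
      rw [div_lt_one h0]; linarith
    · field_simp; ring
  let q : ℝ → E m := fun t => p + (t - 1) • X • e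
  let h : ℝ → ℝ := fun t => -(ε / 2) + g (q t) + θ * (ε + f (q t) - g (q t))
  let y : ℝ → E (m+1) := fun t => eglue p 0 + (t - 1) • X • hdir j + h t • eglue 0 1
  have yq : ∀ t, epre (y t) = q t := fun t => by
    simp only [y, q, epre_add, epre_smul, epre_eglue, hdir, smul_zero, add_zero, he]
  have yh : ∀ t, lastC (y t) = h t := fun t => by
    simp only [y, lastC_add, lastC_smul, lastC_eglue, hdir, mul_zero, zero_add, mul_one]
  have qn : ∀ t ∈ Icc (0:ℝ) 1, ρ / 2 ≤ ‖q t‖ ∧ ‖q t‖ ≤ ρ := by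
    intro t ht
    constructor
    · have h1 : ‖(t - 1) • X • e‖ ≤ ρ / 2 := by
        rw [norm_smul, norm_smul, hne, mul_one, Real.norm_eq_abs, Real.norm_eq_abs,
          abs_of_nonneg hX, abs_of_nonpos (by linarith [ht.2])]
        nlinarith [ht.1, ht.2]
      have h2 := norm_sub_norm_le p (-((t - 1) • X • e))
      rw [norm_neg, sub_neg_eq_add] at h2
      change _ ≤ ‖p + (t - 1) • X • e‖
      linarith
    · have h1 : ‖q t‖ ^ 2 ≤ ρ ^ 2 := by
        change ‖p + (t - 1) • X • e‖ ^ 2 ≤ _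
        rw [norm_add_sq_real, real_inner_smul_right, real_inner_smul_right, hpe, norm_smul,
          norm_smul, hne, hxρ, mul_one, mul_pow, Real.norm_eq_abs, Real.norm_eq_abs, sq_abs, sq_abs]
        nlinarith [mul_nonneg (mul_nonneg (sub_nonneg.2 ht.2) (add_nonneg ht.1 zero_le_one))
          (sq_nonneg X)]
      exact abs_le_of_sq_le_sq' h1 (by rw [← hxρ]; exact norm_nonneg _) |>.2
  have yn : ∀ t ∈ Icc (0:ℝ) 1, y t ∈ neck ε f g 0 R0 := by
    intro t ht
    have h1 := qn t ht
    have h2 := hgap (q t) (by linarith)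
    have h3 := mul_pos θ0 h2
    have h4 := mul_pos (sub_pos.2 θ1) h2
    refine ⟨?_, ?_, ?_⟩ <;> rw [yq]
    · rw [sub_zero]; linarith
    · rw [yh]; simp only [h]; linarith
    · rw [yh]; simp only [h]; linarith
  have dq : ∀ t, HasDerivAt q (X • e) t := fun t => by
    exact ((((hasDerivAt_id t).sub_const 1).smul_const (X • e)).const_add p).congr_deriv (by simp)
  have dcomp : ∀ {φ : E m → ℝ}, C2Sigma c σ φ → ∀ t,
      HasDerivAt (fun t => φ (q t)) ⟪gradient φ (q t), X • e⟫ t := fun hφ t => by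
    have := (hφ.hasGradientAt (q t)).hasFDerivAt.comp_hasDerivAt t (dq t)
    exact this
  have bcomp : ∀ {φ : E m → ℝ}, C2Sigma c σ φ → ∀ t, |⟪gradient φ (q t), X • e⟫| ≤ c * X :=
    fun hφ t => by
      refine (abs_real_inner_le_norm _ _).trans ?_
      rw [norm_smul, hne, mul_one, Real.norm_eq_abs, abs_of_nonneg hX]
      exact mul_le_mul_of_nonneg_right (hφ.2.2.1 _) hX
  have dh : ∀ t, ∃ h', HasDerivAt h h' t ∧ |h'| ≤ c * X := fun t => by
    refine ⟨_, ((dcomp D.hg t).const_add _).add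
      ((((dcomp D.hf t).const_add ε).sub (dcomp D.hg t)).const_mul θ), ?_⟩
    have b1 := abs_le.1 (bcomp D.hg t)
    have b2 := abs_le.1 (bcomp D.hf t)
    rw [abs_le]
    constructor <;> nlinarith
  have dy : ∀ t, ∃ y', HasDerivAt y y' t ∧ ‖y'‖ ≤ (1 + c) * X := fun t => by
    obtain ⟨h', hd, hb⟩ := dh t
    have h1 : HasDerivAt (fun t : ℝ => eglue p 0 + (t - 1) • X • hdir j) (X • hdir j : E (m+1)) t := by
      simpa using (((hasDerivAt_id t).sub_const 1).smul_const (X • hdir j : E (m+1))).const_add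
        (eglue p 0)
    refine ⟨_, h1.add (hd.smul_const (eglue 0 1)), ?_⟩
    have n1 : ‖(eglue 0 1 : E (m+1))‖ = 1 := by
      have := norm_eglue_zero_one (m := m)
      nlinarith [norm_nonneg (eglue 0 1 : E (m+1))]
    have n2 : ‖(hdir j : E (m+1))‖ = 1 := by
      have : ‖(hdir j : E (m+1))‖ ^ 2 = 1 := by
        rw [norm_sq_eq_epre_lastC, hdir, epre_eglue, lastC_eglue]; simp
      nlinarith [norm_nonneg (hdir j : E (m+1))]
    refine (norm_add_le _ _).trans ?_
    rw [norm_smul, norm_smul, n1, n2, Real.norm_eq_abs, Real.norm_eq_abs, abs_of_nonneg hX]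
    linarith
  choose y' hy' by' using dy
  have du : ∀ t ∈ Icc (0:ℝ) 1, HasDerivAt (fun t => u (y t)) ⟪gradient u (y t), y' t⟫ t :=
    fun t ht => by
      have := (D.sol.1 (y t) (Or.inl (Or.inl (yn t ht)))).hasGradientAt.hasFDerivAt.comp_hasDerivAt
        t (hy' t)
      exact this
  have hL : 0 ≤ L := by
    have h1 := qn 1 (by simp)
    rw [← yq] at h1
    exact (norm_nonneg _).trans (hgrad _ (yn 1 (by simp)) h1.1 h1.2)
  have key := norm_image_sub_le_of_norm_deriv_le_segment_01' (f := fun t => u (y t))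
    (C := L * (1 + c) * X) (fun t ht => (du t ht).hasDerivWithinAt) (fun t ht => by
      have ht' : t ∈ Icc (0:ℝ) 1 := ⟨ht.1, ht.2.le⟩
      have h1 := qn t ht'
      rw [← yq] at h1
      refine (norm_inner_le_norm _ _).trans ?_
      calc ‖gradient u (y t)‖ * ‖y' t‖ ≤ L * ((1 + c) * X) :=
            mul_le_mul (hgrad _ (yn t ht') h1.1 h1.2) (by' t) (norm_nonneg _) hL
        _ = _ := by ring)
  have y1 : y 1 = x := by
    refine ext_epre_lastC ?_ ?_
    · rw [yq]; simp [q, hp]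
    · rw [yh, hθ]; simp [h, q]
  have y0 : u (y 0) = 0 := by
    have h1 := yn 0 (by simp)
    have h2 := D.mem_neck_iff.1 h1
    refine D.eq_zero_of_coord h2.1 h2.2.1.le h2.2.2.le ?_
    rw [yq]
    simp [q, he, hXdef]
  simp only [y1, y0, sub_zero, Real.norm_eq_abs] at key
  exact key

theorem abs_le_mul_coord (D : NeckData γ μ K c σ R0 ε f g j u) (hρ0 : 0 < ρ) (hρ : ρ ≤ R0 / 2)
    (hgrad : ∀ p ∈ neck ε f g 0 R0, ρ / 2 ≤ ‖epre p‖ → ‖epre p‖ ≤ ρ → ‖gradient u p‖ ≤ L)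
    (hM : ∀ y ∈ neck ε f g 0 R0, |u y| ≤ M) {x : E (m+1)} (hF : graphF ε 1 f x ≤ 0)
    (hG : graphF ε (-1) (fun y => - g y) x ≤ 0) (hxρ : ‖epre x‖ = ρ) (hX : 0 ≤ epre x j) :
    |u x| ≤ max (2 / ρ * M) (L * (1 + c)) * epre x j := by
  refine D.abs_le_of_closed (by linarith [D.hR0]) hF hG fun y hy hyx => ?_
  rw [← hyx] at hX hxρ ⊢
  rcases le_total (epre y j) (ρ / 2) with h | h
  · refine (D.abs_le_mul_coord_of_near hρ hgrad hy hxρ hX h).trans ?_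
    exact mul_le_mul_of_nonneg_right (le_max_right _ _) hX
  · have h0 := hM y hy
    have hM0 : 0 ≤ M := (abs_nonneg _).trans h0
    calc |u y| ≤ 2 / ρ * M * (ρ / 2) := by rw [show 2 / ρ * M * (ρ / 2) = M by field_simp]; exact h0
      _ ≤ 2 / ρ * M * epre y j := by gcongr
      _ ≤ _ := mul_le_mul_of_nonneg_right (le_max_left _ _) hX

end NeckData

theorem epre_flipCoord {m : ℕ} (j : Fin m) (x : E (m+1)) :
    epre (flipCoord j.castSucc x) = flipCoord j (epre x) := by
  ext i
  simp [epre, flipCoord, Fin.castSucc_inj]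

theorem lastC_flipCoord {m : ℕ} (j : Fin m) (x : E (m+1)) :
    lastC (flipCoord j.castSucc x) = lastC x := by
  have : Fin.last m ≠ j.castSucc := (Fin.castSucc_lt_last j).ne'
  simp [lastC, flipCoord, this]

theorem norm_flipCoord {m : ℕ} (j : Fin m) (p : E m) : ‖flipCoord j p‖ = ‖p‖ := by
  rw [EuclideanSpace.norm_eq, EuclideanSpace.norm_eq]
  congr 1
  refine Finset.sum_congr rfl fun i _ => ?_
  by_cases hi : i = j <;> simp [flipCoord, hi]

namespace NeckData

variable {m : ℕ} {γ μ K c σ R0 ε β ρ C : ℝ} {f g : E m → ℝ} {j : Fin m} {u : E (m+1) → ℝ}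

theorem neg (D : NeckData γ μ K c σ R0 ε f g j u) :
    NeckData γ μ K c σ R0 ε f g j (fun x => - u x) where
  hγ := D.hγ
  hμ := D.hμ
  hK := D.hK
  hc := D.hc
  hσ := D.hσ
  hR0 := D.hR0
  hKR0 := D.hKR0
  hε := D.hε
  hf := D.hf
  hg := D.hg
  f0 := D.f0
  g0 := D.g0
  df0 := D.df0
  dg0 := D.dg0
  hfg := D.hfg
  ef := D.ef
  eg := D.eg
  sol := by
    obtain ⟨h1, h2, h3, h4, h5, h6⟩ := D.sol
    refine ⟨fun x hx => (h1 x hx).neg, ?_, h3.neg, fun x hx => ?_, fun p hp => ?_, fun p hp => ?_⟩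
    · simp only [gradient_neg_fun]; exact h2.neg
    · have := h4 x hx
      rw [elap] at this ⊢
      rw [show (fun x => - u x) = - u from rfl, iteratedFDeriv_neg]
      simp only [Pi.neg_apply, _root_.neg_apply, Finset.sum_neg_distrib, this,
        neg_zero]
    · rw [gradient_neg_fun, inner_neg_right]; linarith [h5 p hp]
    · rw [gradient_neg_fun, inner_neg_right]; linarith [h6 p hp]
  odd := fun x hx => by rw [D.odd x hx]

end NeckData

theorem exists_decay {m : ℕ} {γ μ K c σ R0 β : ℝ} (hm : 1 ≤ m) (hγ : 0 < γ) (hμ : 0 < μ)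
    (hc : 0 < c) (hσ : σ ∈ Set.Ioo (0:ℝ) 1) (hR0 : 0 < R0) (hβ : -(1 / 2) ≤ β) (hβ0 : β ≤ 0)
    (hl : 4 * β + 2 * m * β + 4 * β ^ 2 + 2 * (1 - 1 / (μ * γ)) ≤ 0) :
    ∃ ρ C : ℝ, 0 < ρ ∧ ρ ≤ R0 / 2 ∧ 0 < C ∧ ∀ {ε : ℝ} {f g : E m → ℝ} {j : Fin m}
      {u : E (m+1) → ℝ}, NeckData γ μ K c σ R0 ε f g j u → ε ≤ ρ ^ 2 → ∀ M : ℝ,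
      (∀ y ∈ neck ε f g 0 R0, |u y| ≤ M) → ∀ x ∈ neck ε f g 0 R0, ‖epre x‖ ≤ ρ →
      |u x| ≤ C * M * ‖epre x‖ * (ε + ‖epre x‖ ^ 2) ^ β := by
  obtain ⟨ρ, C, hρ, hρR, hC, hw⟩ := exists_halfBarrier (K := K) hm hγ hμ hc hσ hR0 hβ hβ0 hl
  obtain ⟨κ, C0, hκ, hκ', hC0, hgb⟩ := exists_gradient_bound m hγ hμ hc hR0
  set B := 2 / ρ * (1 + C0 * (1 + c)) with hB
  have hB0 : 0 < B := by positivity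
  refine ⟨ρ, 4 * B * C, hρ, hρR, by positivity, ?_⟩
  intro ε f g j u D hερ M hM x hx hxρ
  have hε := D.hε.1
  have hM0 : 0 ≤ M := (abs_nonneg _).trans (hM x hx)
  rcases hM0.eq_or_lt with h0 | hM0
  · have := hM x hx
    rw [← h0] at this ⊢
    simpa using this
  obtain ⟨w, W⟩ := hw D hερ
  have one : ∀ {v : E (m+1) → ℝ}, NeckData γ μ K c σ R0 ε f g j v →
      (∀ y ∈ neck ε f g 0 R0, |v y| ≤ M) → ∀ z ∈ neck ε f g 0 R0, ‖epre z‖ ≤ ρ →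
      0 ≤ epre z j → v z ≤ 4 * B * M * w z := by
    intro v V hvM z hz hzρ hzX
    have hz' := V.mem_neck_iff.1 hz
    refine V.le_mul_halfBarrier W hρR (by positivity) (fun y hF hG hy hX => ?_) hz'.2.1.le
      hz'.2.2.le hzρ hzX
    have h1 := V.abs_le_mul_coord (L := C0 * M / (ρ / 2)) hρ hρR (fun p hp h1 h2 => by
      refine (hgb V p hp (h2.trans hρR) M fun y hy _ => hvM y hy).trans ?_
      gcongr
      exact Real.le_sqrt_of_sq_le (by nlinarith)) hvM hF hG hy hX
    refine (le_abs_self _).trans (h1.trans ?_)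
    gcongr
    rw [max_le_iff]
    have e : 4 * B * M / 4 = 2 / ρ * M + C0 * M / (ρ / 2) * (1 + c) := by
      rw [hB]; field_simp
    have p1 : 0 ≤ 2 / ρ * M := by positivity
    have p2 : 0 ≤ C0 * M / (ρ / 2) * (1 + c) := by positivity
    rw [e]
    constructor <;> linarith
  have two : ∀ z ∈ neck ε f g 0 R0, ‖epre z‖ ≤ ρ → 0 ≤ epre z j →
      |u z| ≤ 4 * B * C * M * ‖epre z‖ * (ε + ‖epre z‖ ^ 2) ^ β := by
    intro z hz hzρ hzX
    have hz' := D.mem_neck_iff.1 hz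
    have h1 := one D hM z hz hzρ hzX
    have h2 := one D.neg (fun y hy => by rw [abs_neg]; exact hM y hy) z hz hzρ hzX
    have h3 := W.upper hz'.2.1.le hz'.2.2.le hzρ hzX
    have h4 : epre z j ≤ ‖epre z‖ := by
      have := PiLp.norm_apply_le (epre z) j
      exact (le_abs_self _).trans this
    calc |u z| ≤ 4 * B * M * w z := abs_le'.2 ⟨h1, h2⟩
      _ ≤ 4 * B * M * (C * epre z j * (ε + ‖epre z‖ ^ 2) ^ β) := by gcongr
      _ ≤ 4 * B * M * (C * ‖epre z‖ * (ε + ‖epre z‖ ^ 2) ^ β) := by gcongr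
      _ = _ := by ring
  rcases le_total 0 (epre x j) with h | h
  · exact two x hx hxρ h
  · have hn : ‖epre (flipCoord j.castSucc x)‖ = ‖epre x‖ := by
      rw [epre_flipCoord, norm_flipCoord]
    have hf : flipCoord j.castSucc x ∈ neck ε f g 0 R0 := by
      refine ⟨?_, ?_, ?_⟩
      · have := hx.1
        rw [sub_zero] at this ⊢
        rwa [hn]
      · rw [lastC_flipCoord, epre_flipCoord, D.eg]; exact hx.2.1
      · rw [lastC_flipCoord, epre_flipCoord, D.ef]; exact hx.2.2
    have := two _ hf (hn.trans_le hxρ) (by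
      rw [epre_flipCoord]; simp [flipCoord, h])
    rwa [hn, D.odd x (Or.inl (Or.inl hx)), abs_neg] at this

theorem rpow_scale_le {β s t : ℝ} (hβ : -(1 / 2) ≤ β) (hβ0 : β ≤ 0) (hs : 0 < s)
    (ht : 0 < t) (hts : t ≤ 4 * s) {y : ℝ} (hy : y ≤ √t) :
    y * t ^ β ≤ 2 * (√s * s ^ β) := by
  calc y * t ^ β ≤ √t * t ^ β := by gcongr
    _ = t ^ (1 / 2 + β) := by rw [Real.sqrt_eq_rpow, ← Real.rpow_add ht]
    _ ≤ (4 * s) ^ (1 / 2 + β) := Real.rpow_le_rpow ht.le hts (by linarith)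
    _ = 4 ^ (1 / 2 + β) * s ^ (1 / 2 + β) := Real.mul_rpow (by norm_num) hs.le
    _ ≤ 2 * s ^ (1 / 2 + β) := by
        gcongr
        calc (4:ℝ) ^ (1 / 2 + β) ≤ 4 ^ (1 / 2 : ℝ) :=
              Real.rpow_le_rpow_of_exponent_le (by norm_num) (by linarith)
          _ = 2 := by
              rw [← Real.sqrt_eq_rpow, show (4:ℝ) = 2 ^ 2 by norm_num,
                Real.sqrt_sq (by norm_num)]
    _ = _ := by rw [Real.sqrt_eq_rpow, ← Real.rpow_add hs]

theorem exists_weighted_gradient_bound {m : ℕ} {γ μ K c σ R0 β : ℝ} (hm : 1 ≤ m) (hγ : 0 < γ)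
    (hμ : 0 < μ) (hc : 0 < c) (hσ : σ ∈ Set.Ioo (0:ℝ) 1) (hR0 : 0 < R0)
    (hβ : -(1 / 2) ≤ β) (hβ0 : β ≤ 0)
    (hl : 4 * β + 2 * m * β + 4 * β ^ 2 + 2 * (1 - 1 / (μ * γ)) ≤ 0) :
    ∃ C : ℝ, 0 < C ∧ ∀ {ε : ℝ} {f g : E m → ℝ} {j : Fin m} {u : E (m+1) → ℝ},
      NeckData γ μ K c σ R0 ε f g j u → ∀ M : ℝ, (∀ y ∈ neck ε f g 0 R0, |u y| ≤ M) →
      ∀ x ∈ neck ε f g 0 (R0 / 2), ‖gradient u x‖ ≤ C * M * (ε + ‖epre x‖ ^ 2) ^ β := by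
  obtain ⟨ρ, C1, hρ, hρR, hC1, hdec⟩ := exists_decay (K := K) hm hγ hμ hc hσ hR0 hβ hβ0 hl
  obtain ⟨κ, C0, hκ, hκ', hC0, hgb⟩ := exists_gradient_bound m hγ hμ hc hR0
  set T := R0 / 4 + R0 ^ 2 with hT
  have hT0 : 0 < T := by positivity
  refine ⟨2 * C0 * C1 + 2 * C0 / ρ * (T ^ β)⁻¹, by positivity, ?_⟩
  intro ε f g j u D M hM x hx
  have hε := D.hε.1
  have hxR : ‖epre x‖ < R0 / 2 := by simpa using hx.1
  have hxn : x ∈ neck ε f g 0 R0 := ⟨by rw [sub_zero]; linarith, hx.2⟩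
  have hM0 : 0 ≤ M := (abs_nonneg _).trans (hM x hxn)
  have hp0 := norm_nonneg (epre x)
  set s := ε + ‖epre x‖ ^ 2 with hs
  have hs0 : 0 < s := by positivity
  have hsp : 0 < s ^ β := by positivity
  by_cases hfar : ε ≤ ρ ^ 2 / 4 ∧ ‖epre x‖ ≤ ρ / 2
  · obtain ⟨h1, h2⟩ := hfar
    have hsρ : √s ≤ ρ := by
      rw [Real.sqrt_le_left hρ.le]; nlinarith
    have hss : √s ^ 2 = s := Real.sq_sqrt hs0.le
    have := hgb D x hxn hxR.le (C1 * M * (2 * (√s * s ^ β))) fun y hy hyx => by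
      have n1 : ‖epre y‖ ≤ ‖epre x‖ + √s / 3 := by
        have := norm_le_norm_add_norm_sub' (epre y) (epre x)
        have h3 : κ * √s ≤ 1 / 3 * √s := by gcongr
        linarith
      have n2 : ‖epre x‖ ≤ √s := Real.le_sqrt_of_sq_le (by rw [hs]; linarith)
      have h3 := hdec D (by nlinarith) M hM y hy (by linarith)
      have hy0 := norm_nonneg (epre y)
      have ht0 : 0 < ε + ‖epre y‖ ^ 2 := by positivity
      have h5 : ‖epre y‖ ^ 2 ≤ (‖epre x‖ + √s / 3) ^ 2 := by gcongr
      have h6 := rpow_scale_le (t := ε + ‖epre y‖ ^ 2) hβ hβ0 hs0 ht0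
        (by nlinarith [Real.sqrt_nonneg s]) (Real.le_sqrt_of_sq_le (by linarith : ‖epre y‖ ^ 2 ≤ _))
      calc |u y| ≤ C1 * M * ‖epre y‖ * (ε + ‖epre y‖ ^ 2) ^ β := h3
        _ = C1 * M * (‖epre y‖ * (ε + ‖epre y‖ ^ 2) ^ β) := by ring
        _ ≤ _ := by gcongr
    refine this.trans ?_
    have e : C0 * (C1 * M * (2 * (√s * s ^ β))) / √s = 2 * C0 * C1 * M * s ^ β := by
      have : 0 < √s := Real.sqrt_pos.2 hs0
      field_simp
    rw [e]
    gcongr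
    have : 0 < 2 * C0 / ρ * (T ^ β)⁻¹ := by positivity
    linarith
  · have hsρ : ρ / 2 ≤ √s := by
      refine Real.le_sqrt_of_sq_le ?_
      rw [not_and_or, not_le, not_le] at hfar
      rcases hfar with h | h <;> nlinarith
    have hsT : s ≤ T := by
      have := D.hε.2
      rw [hs, hT]; nlinarith
    have h1 : T ^ β ≤ s ^ β := Real.rpow_le_rpow_of_nonpos hs0 hsT hβ0
    calc ‖gradient u x‖ ≤ C0 * M / √s := hgb D x hxn hxR.le M fun y hy _ => hM y hy
      _ ≤ C0 * M / (ρ / 2) := by gcongr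
      _ = 2 * C0 / ρ * (T ^ β)⁻¹ * M * T ^ β := by
          have : 0 < T ^ β := by positivity
          field_simp
      _ ≤ 2 * C0 / ρ * (T ^ β)⁻¹ * M * s ^ β := by gcongr
      _ ≤ _ := by
          gcongr
          have : 0 < 2 * C0 * C1 := by positivity
          linarith

theorem exponent_bounds {k θ : ℝ} (hk : 1 ≤ k) (hθ : 0 < θ) (hθ1 : θ ≤ 1) :
    -(1 / 2) ≤ ((-k + √(k ^ 2 + 4 * (k - 1 + 2 * θ))) / 2 - 1) / 2 ∧
    ((-k + √(k ^ 2 + 4 * (k - 1 + 2 * θ))) / 2 - 1) / 2 ≤ 0 ∧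
    4 * (((-k + √(k ^ 2 + 4 * (k - 1 + 2 * θ))) / 2 - 1) / 2) +
      2 * k * (((-k + √(k ^ 2 + 4 * (k - 1 + 2 * θ))) / 2 - 1) / 2) +
      4 * (((-k + √(k ^ 2 + 4 * (k - 1 + 2 * θ))) / 2 - 1) / 2) ^ 2 + 2 * (1 - θ) ≤ 0 := by
  have h0 : 0 ≤ k ^ 2 + 4 * (k - 1 + 2 * θ) := by nlinarith
  have h1 : k ≤ √(k ^ 2 + 4 * (k - 1 + 2 * θ)) := Real.le_sqrt_of_sq_le (by linarith)
  have h2 : √(k ^ 2 + 4 * (k - 1 + 2 * θ)) ≤ k + 2 := by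
    rw [Real.sqrt_le_left (by linarith)]; nlinarith
  have h3 := Real.sq_sqrt h0
  refine ⟨by linarith, by linarith, le_of_eq ?_⟩
  linear_combination h3 / 4

/-- Theorem 1.6 (dichotomy upper bounds): under the `C^{2,σ}` assumption
`f - g = μ|x'|² + O(|x'|^{2+σ})` and odd symmetry of `u` in some horizontal
coordinate `x_j`, the gradient is bounded when `γ ≤ 1/μ` and blows up with
rate at most `(ε+|x'|²)^{(α-1)/2}` when `γ > 1/μ`. -/
theorem dichotomy_upper_bound (m : ℕ) (hm : 1 ≤ m) (γ μ K c3 σ R0 : ℝ)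
    (hγ : 0 < γ) (hμ : 0 < μ) (hK : 0 < K) (hc3 : 0 < c3) (hσ : σ ∈ Set.Ioo (0:ℝ) 1)
    (hR0 : 0 < R0) (hKR0 : K * R0 ^ σ ≤ μ / 2) :
    ∃ C : ℝ, 0 < C ∧
      ∀ ε ∈ Set.Ioo (0:ℝ) (R0/4), ∀ f g : E m → ℝ,
      C2Sigma c3 σ f → C2Sigma c3 σ g →
      f 0 = 0 → g 0 = 0 → gradient f 0 = 0 → gradient g 0 = 0 →
      (∀ p : E m, ‖p‖ < R0 → |f p - g p - μ * ‖p‖^2| ≤ K * ‖p‖ ^ ((2:ℝ) + σ)) →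
      ∀ j : Fin m,
      (∀ p : E m, f (flipCoord j p) = f p) →
      (∀ p : E m, g (flipCoord j p) = g p) →
      ∀ u : E (m+1) → ℝ, IsLocalSol ε R0 γ f g u 0 0 →
      (∀ x ∈ regio ε R0 f g, u (flipCoord j.castSucc x) = - u x) →
      ∀ M : ℝ, (∀ y ∈ neck ε f g 0 R0, |u y| ≤ M) →
      ∀ x ∈ neck ε f g 0 (R0/2),
        (γ ≤ 1/μ → ‖gradient u x‖ ≤ C * M) ∧
        (1/μ < γ → ‖gradient u x‖ ≤ C * M *
          (ε + ‖epre x‖^2) ^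
            (((-(m:ℝ) + Real.sqrt ((m:ℝ)^2 + 4*((m:ℝ) - 1 + 2/(μ*γ))))/2 - 1)/2)) := by
  rcases le_or_gt γ (1 / μ) with hγμ | hγμ
  · have h1 : 1 ≤ 1 / (μ * γ) := by
      rw [le_div_iff₀ hμ] at hγμ
      rw [le_div_iff₀ (by positivity)]; linarith
    obtain ⟨C, hC, H⟩ := exists_weighted_gradient_bound (K := K) (β := 0) hm hγ hμ hc3 hσ hR0
      (by norm_num) le_rfl (by linarith)
    refine ⟨C, hC, ?_⟩
    intro ε hε f g hf hg f0 g0 df0 dg0 hfg j ef eg u sol odd M hM x hx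
    have D : NeckData γ μ K c3 σ R0 ε f g j u :=
      ⟨hγ, hμ, hK, hc3, hσ, hR0, hKR0, hε, hf, hg, f0, g0, df0, dg0, hfg, ef, eg, sol, odd⟩
    refine ⟨fun _ => ?_, fun h => absurd h (not_lt.2 hγμ)⟩
    simpa using H D M hM x hx
  · have h1 : 1 / (μ * γ) ≤ 1 := by
      rw [div_lt_iff₀ hμ] at hγμ
      rw [div_le_one (by positivity)]; linarith
    obtain ⟨b1, b2, b3⟩ := exponent_bounds (k := m) (θ := 1 / (μ * γ)) (by exact_mod_cast hm)
      (by positivity) h1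
    obtain ⟨C, hC, H⟩ := exists_weighted_gradient_bound (K := K) hm hγ hμ hc3 hσ hR0 b1 b2 b3
    refine ⟨C, hC, ?_⟩
    intro ε hε f g hf hg f0 g0 df0 dg0 hfg j ef eg u sol odd M hM x hx
    have D : NeckData γ μ K c3 σ R0 ε f g j u :=
      ⟨hγ, hμ, hK, hc3, hσ, hR0, hKR0, hε, hf, hg, f0, g0, df0, dg0, hfg, ef, eg, sol, odd⟩
    refine ⟨fun h => absurd h (not_le.2 hγμ), fun _ => ?_⟩
    rw [← mul_one_div (2:ℝ)]
    exact H D M hM x hx
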